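/- For every PCTSP instance and every feasible solution (x,y) of the PCTSP LP relaxation, there exists a tour whose value (tour cost plus penalties of unvisited vertices) is at most 1.599 · (Σ_{e∈E} c_e x_e + Σ_{v∈V} π_v (1 − y_v)). In particular, the integrality gap of the PCTSP LP relaxation is at most 1.599. -/

import Mathlib

/-- The edge set of the complete graph on `V`: all 2-element subsets of `V`. -/
def completeEdges (V : Type*) [Fintype V] [DecidableEq V] : Finset (Finset V) :=
  Finset.univ.powersetCard 2

/-- The cut `δ(S)`: edges of the complete graph with exactly one endpoint in `S`. -/
def cutEdges (V : Type*) [Fintype V] [DecidableEq V] (S : Finset V) : Finset (Finset V) :=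
  (completeEdges V).filter (fun e => (e ∩ S).card = 1)

/-- Feasibility for the PCTSP LP relaxation. -/
def IsFeasibleLP {V : Type*} [Fintype V] [DecidableEq V]
    (r : V) (x : Finset V → ℝ) (y : V → ℝ) : Prop :=
  (∀ e ∈ completeEdges V, 0 ≤ x e) ∧ (∀ v : V, 0 ≤ y v) ∧ y r = 1 ∧
  (∀ v : V, v ≠ r → ∑ e ∈ cutEdges V {v}, x e = 2 * y v) ∧
  (∑ e ∈ cutEdges V {r}, x e ≤ 2) ∧
  (∀ S : Finset V, r ∉ S → ∀ v ∈ S, 2 * y v ≤ ∑ e ∈ cutEdges V S, x e)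

/-- The cost of a tour given as a list of (distinct) vertices: the sum of the costs of
consecutive edges, plus the closing edge back to the start if the tour has at least two
vertices. -/
def tourCost {V : Type*} [DecidableEq V] (c : Finset V → ℝ) (t : List V) : ℝ :=
  if t.length ≤ 1 then 0
  else ((t.zip (t.rotate 1)).map (fun p => c {p.1, p.2})).sum


set_option linter.unusedSectionVars false

namespace PCTSP

section Cuts
variable {V : Type*} [Fintype V] [DecidableEq V]

/-- The total weight of the ordered pairs leaving `S`. -/
def wcut (w : V → V → ℝ) (S : Finset V) : ℝ :=
  ∑ a, ∑ b, if a ∈ S ∧ b ∉ S then w a b else 0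

lemma wcut_nonneg {w : V → V → ℝ} (hw : ∀ a b, 0 ≤ w a b) (S : Finset V) : 0 ≤ wcut w S := by
  refine Finset.sum_nonneg fun a _ => Finset.sum_nonneg fun b _ => ?_
  split_ifs
  exacts [hw a b, le_rfl]

lemma wcut_compl {w : V → V → ℝ} (hs : ∀ a b, w a b = w b a) (S : Finset V) :
    wcut w Sᶜ = wcut w S := by
  unfold wcut
  rw [Finset.sum_comm]
  refine Finset.sum_congr rfl fun a _ => Finset.sum_congr rfl fun b _ => ?_
  simp only [Finset.mem_compl, not_not, hs b a, and_comm]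

/-- Submodularity of the cut function, with its error term. -/
lemma wcut_add_wcut {w : V → V → ℝ} (hs : ∀ a b, w a b = w b a) (X Y : Finset V) :
    wcut w X + wcut w Y = wcut w (X ∩ Y) + wcut w (X ∪ Y) +
      2 * ∑ a, ∑ b, if a ∈ X \ Y ∧ b ∈ Y \ X then w a b else 0 := by
  have h : (∑ a, ∑ b, if a ∈ X \ Y ∧ b ∈ Y \ X then w a b else 0) =
      ∑ a, ∑ b, if a ∈ Y \ X ∧ b ∈ X \ Y then w a b else 0 := by
    rw [Finset.sum_comm]
    refine Finset.sum_congr rfl fun a _ => Finset.sum_congr rfl fun b _ => ?_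
    simp only [hs b a, and_comm]
  rw [two_mul]
  nth_rewrite 2 [h]
  unfold wcut
  simp only [← Finset.sum_add_distrib]
  refine Finset.sum_congr rfl fun a _ => Finset.sum_congr rfl fun b _ => ?_
  by_cases h1 : a ∈ X <;> by_cases h2 : b ∈ X <;> by_cases h3 : a ∈ Y <;> by_cases h4 : b ∈ Y <;>
    simp [h1, h2, h3, h4]

/-- Posimodularity of the cut function, with its error term. -/
lemma wcut_add_wcut' {w : V → V → ℝ} (hs : ∀ a b, w a b = w b a) (X Y : Finset V) :
    wcut w X + wcut w Y = wcut w (X \ Y) + wcut w (Y \ X) +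
      2 * ∑ a, ∑ b, if a ∈ X ∩ Y ∧ b ∉ X ∪ Y then w a b else 0 := by
  have h := wcut_add_wcut hs X Yᶜ
  rw [wcut_compl hs Y, ← wcut_compl hs (X ∪ Yᶜ)] at h
  have e1 : X ∩ Yᶜ = X \ Y := by ext; simp
  have e2 : (X ∪ Yᶜ)ᶜ = Y \ X := by ext; simp [and_comm]
  have e3 : X \ Yᶜ = X ∩ Y := by ext; simp
  have e4 : Yᶜ \ X = (X ∪ Y)ᶜ := by ext; simp [and_comm]
  rw [e1, e2, e3, e4] at h
  simpa only [Finset.mem_compl] using h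

lemma wcut_singleton (w : V → V → ℝ) (v : V) :
    wcut w {v} = ∑ b, if b ≠ v then w v b else 0 := by
  unfold wcut
  rw [Finset.sum_eq_single v]
  · simp
  · intro a _ ha; simp [ha]
  · simp

end Cuts

section Splitting
variable {V : Type*} [Fintype V] [DecidableEq V]

/-- A connectivity requirement on the subsets of `V ∖ {v}` which is symmetric and uncrosses. -/
structure Requirement (v : V) (f : Finset V → ℝ) : Prop where
  symm : ∀ X, v ∉ X → f (insert v X)ᶜ = f X
  uncross : ∀ X Y, v ∉ X → v ∉ Y →
    f X + f Y ≤ f (X ∩ Y) + f (X ∪ Y) ∨ f X + f Y ≤ f (X \ Y) + f (Y \ X)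

lemma exists_unblocked {v u : V} {f : Finset V → ℝ} (hf : Requirement v f) {g : V → V → ℝ}
    (hg : ∀ a b, 0 ≤ g a b) (hs : ∀ a b, g a b = g b a) (hcut : ∀ X, v ∉ X → f X ≤ wcut g X)
    (huv : u ≠ v) (hu : 0 < g v u) :
    ∃ t, t ≠ v ∧ 0 < g v t ∧ ∀ X, v ∉ X → u ∈ X → t ∈ X → f X < wcut g X := by
  by_contra! hcon
  have hex : ∀ t, t ≠ v → 0 < g v t → ∃ X, v ∉ X ∧ u ∈ X ∧ t ∈ X ∧ wcut g X = f X := by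
    intro t ht h0
    obtain ⟨X, h1, h2, h3, h4⟩ := hcon t ht h0
    exact ⟨X, h1, h2, h3, le_antisymm h4 (hcut X h1)⟩
  obtain ⟨X0, a1, a2, -, a4⟩ := hex u huv hu
  obtain ⟨M, hM, hmax⟩ := Finset.exists_max_image
    (Finset.univ.filter fun X : Finset V => v ∉ X ∧ u ∈ X ∧ wcut g X = f X) Finset.card
    ⟨X0, by simp [a1, a2, a4]⟩
  simp only [Finset.mem_filter, Finset.mem_univ, true_and] at hM hmax
  obtain ⟨m1, m2, m3⟩ := hM
  have hall : ∀ t, t ≠ v → 0 < g v t → t ∈ M := by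
    intro t ht h0
    obtain ⟨X, h1, h2, h3, h4⟩ := hex t ht h0
    have hvU : v ∉ M ∪ X := by simp [m1, h1]
    have hpos : 0 < ∑ a, ∑ b, if a ∈ M ∩ X ∧ b ∉ M ∪ X then g a b else 0 := by
      refine Finset.sum_pos' (fun a _ => Finset.sum_nonneg fun b _ => ?_) ⟨u, Finset.mem_univ _, ?_⟩
      · split_ifs
        exacts [hg a b, le_rfl]
      · refine Finset.sum_pos' (fun b _ => ?_) ⟨v, Finset.mem_univ _, ?_⟩
        · split_ifs
          exacts [hg _ _, le_rfl]
        · rw [if_pos ⟨by simp [m2, h2], hvU⟩, hs]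
          exact hu
    rcases hf.uncross M X m1 h1 with h | h
    · have e := wcut_add_wcut hs M X
      have hn : 0 ≤ ∑ a, ∑ b, if a ∈ M \ X ∧ b ∈ X \ M then g a b else 0 := by
        refine Finset.sum_nonneg fun a _ => Finset.sum_nonneg fun b _ => ?_
        split_ifs
        exacts [hg a b, le_rfl]
      have i1 := hcut (M ∩ X) (by simp [m1])
      have i2 := hcut (M ∪ X) hvU
      have ht : wcut g (M ∪ X) = f (M ∪ X) := by linarith
      have hc := hmax (M ∪ X) ⟨hvU, by simp [m2], ht⟩
      have := Finset.eq_of_subset_of_card_le Finset.subset_union_left hc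
      rw [this]; simp [h3]
    · exfalso
      have e := wcut_add_wcut' hs M X
      have i1 := hcut (M \ X) (by simp [m1])
      have i2 := hcut (X \ M) (by simp [h1])
      linarith
  have hle := hcut (insert v M)ᶜ (by simp)
  rw [hf.symm M m1, ← m3] at hle
  have hlt : wcut g (insert v M)ᶜ < wcut g M := by
    rw [wcut_compl hs]
    unfold wcut
    have hz : ∀ b, b ∉ insert v M → g v b = 0 := by
      intro b hb
      simp only [Finset.mem_insert, not_or] at hb
      by_contra hne
      exact hb.2 (hall b hb.1 (lt_of_le_of_ne (hg _ _) (Ne.symm hne)))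
    refine Finset.sum_lt_sum (fun a _ => ?_) ⟨u, Finset.mem_univ _, ?_⟩
    · refine Finset.sum_le_sum fun b _ => ?_
      by_cases hav : a = v
      · subst hav
        split_ifs with c1 c2
        exacts [le_rfl, (hz b c1.2).le, hg _ _, le_rfl]
      · by_cases hbv : b = v
        · subst hbv
          simp only [Finset.mem_insert, true_or, not_true, and_false, if_false]
          split_ifs
          exacts [hg _ _, le_rfl]
        · simp [hav, hbv]
    · refine Finset.sum_lt_sum (fun b _ => ?_) ⟨v, Finset.mem_univ _, ?_⟩
      · by_cases hbv : b = v
        · subst hbv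
          simp only [Finset.mem_insert, true_or, not_true, and_false, if_false]
          split_ifs
          exacts [hg _ _, le_rfl]
        · simp [huv, hbv]
      · rw [if_neg (by simp), if_pos ⟨m2, m1⟩, hs]
        exact hu
  linarith

/-- The graph obtained from `w` by splitting off at `v` the pairs of edges recorded by `s`. -/
def splitWeight (v : V) (w s : V → V → ℝ) (a b : V) : ℝ :=
  if a = v then
    if b = v then 0 else w v b - ∑ c, (s b c + s c b)
  else if b = v then w v a - ∑ c, (s a c + s c a)
  else w a b + s a b + s b a

lemma splitWeight_symm {v : V} {w s : V → V → ℝ} (hs : ∀ a b, w a b = w b a) (a b : V) :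
    splitWeight v w s a b = splitWeight v w s b a := by
  unfold splitWeight
  split_ifs <;> first | rfl | (rw [hs a b]; ring)

lemma wcut_splitWeight {v : V} {w s : V → V → ℝ} (hs : ∀ a b, w a b = w b a)
    (h0 : ∀ a b, a = v ∨ b = v → s a b = 0) {X : Finset V} (hX : v ∉ X) :
    wcut (splitWeight v w s) X = wcut w X - 2 * ∑ a ∈ X, ∑ b ∈ X, s a b := by
  have key : ∀ a, (∑ b, if a ∈ X ∧ b ∉ X then splitWeight v w s a b else 0) =
      (∑ b, if a ∈ X ∧ b ∉ X then w a b else 0) -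
        if a ∈ X then ∑ b ∈ X, (s a b + s b a) else 0 := by
    intro a
    by_cases ha : a ∈ X
    · have hav : a ≠ v := fun h => hX (h ▸ ha)
      have e : ∀ b, (if a ∈ X ∧ b ∉ X then splitWeight v w s a b else 0) =
          (if a ∈ X ∧ b ∉ X then w a b else 0) + (if b ∈ X then 0 else (s a b + s b a))
            - if b = v then ∑ c, (s a c + s c a) else 0 := by
        intro b
        by_cases hb : b ∈ X
        · have hbv : b ≠ v := fun h => hX (h ▸ hb)
          simp [hb, hbv]
        · by_cases hbv : b = v
          · subst hbv
            simp [ha, hb, splitWeight, hav, h0 a b (Or.inr rfl), h0 b a (Or.inl rfl), hs a b]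
          · simp [ha, hb, splitWeight, hav, hbv]; ring
      rw [Finset.sum_congr rfl fun b _ => e b, Finset.sum_sub_distrib, Finset.sum_add_distrib,
        Finset.sum_ite_eq' Finset.univ v, if_pos (Finset.mem_univ _), if_pos ha]
      have e2 : (∑ b, if b ∈ X then 0 else (s a b + s b a)) =
          (∑ c, (s a c + s c a)) - ∑ b ∈ X, (s a b + s b a) := by
        rw [← Finset.sum_filter_add_sum_filter_not Finset.univ (· ∈ X) (fun c => s a c + s c a)]
        rw [Finset.filter_mem_eq_inter, Finset.univ_inter, add_sub_cancel_left, Finset.sum_filter]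
        exact Finset.sum_congr rfl fun b _ => by by_cases hb : b ∈ X <;> simp [hb]
      rw [e2]; ring
    · simp [ha]
  unfold wcut
  rw [Finset.sum_congr rfl fun a _ => key a, Finset.sum_sub_distrib]
  congr 1
  rw [Finset.sum_ite_mem, Finset.univ_inter, two_mul]
  simp only [Finset.sum_add_distrib]
  congr 1
  exact Finset.sum_comm

/-- Fractional splitting off at `v` (in the spirit of Lovász and Mader): all edges at `v` can be
paired up without violating the requirement `f`. -/
theorem exists_splitting {v : V} {f : Finset V → ℝ} (hf : Requirement v f) {w : V → V → ℝ}
    (hw : ∀ a b, 0 ≤ w a b) (hs : ∀ a b, w a b = w b a) (hcut : ∀ X, v ∉ X → f X ≤ wcut w X) :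
    ∃ s : V → V → ℝ, (∀ a b, 0 ≤ s a b) ∧ (∀ a b, a = v ∨ b = v → s a b = 0) ∧
      (∀ u, u ≠ v → ∑ c, (s u c + s c u) = w v u) ∧
      ∀ X, v ∉ X → f X ≤ wcut w X - 2 * ∑ a ∈ X, ∑ b ∈ X, s a b := by
  let K : Set (V → V → ℝ) := {s | (∀ a b, 0 ≤ s a b) ∧ (∀ a b, a = v ∨ b = v → s a b = 0) ∧
    (∀ u, u ≠ v → ∑ c, (s u c + s c u) ≤ w v u) ∧
    ∀ X, v ∉ X → f X ≤ wcut w X - 2 * ∑ a ∈ X, ∑ b ∈ X, s a b}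
  have hclosed : IsClosed K := by
    refine IsClosed.and ?_ (IsClosed.and ?_ (IsClosed.and ?_ ?_))
    · simp only [Set.ofPred_forall]
      exact isClosed_iInter fun a => isClosed_iInter fun b =>
        isClosed_le continuous_const (by fun_prop)
    · simp only [Set.ofPred_forall]
      exact isClosed_iInter fun a => isClosed_iInter fun b => isClosed_iInter fun _ =>
        isClosed_eq (by fun_prop) continuous_const
    · simp only [Set.ofPred_forall]
      exact isClosed_iInter fun a => isClosed_iInter fun _ =>
        isClosed_le (by fun_prop) continuous_const
    · simp only [Set.ofPred_forall]
      exact isClosed_iInter fun a => isClosed_iInter fun _ =>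
        isClosed_le continuous_const (by fun_prop)
  have hsub : K ⊆ Set.Icc (fun _ _ => 0) (fun a _ => w v a) := by
    rintro s ⟨h1, h2, h3, -⟩
    refine ⟨fun a b => h1 a b, fun a b => ?_⟩
    by_cases ha : a = v
    · rw [h2 a b (Or.inl ha)]; exact hw _ _
    · refine le_trans ?_ (h3 a ha)
      refine le_trans (le_add_of_nonneg_right (h1 b a)) ?_
      exact Finset.single_le_sum (f := fun c => s a c + s c a)
        (fun c _ => add_nonneg (h1 _ _) (h1 _ _)) (Finset.mem_univ b)
  have hcomp : IsCompact K := isCompact_Icc.of_isClosed_subset hclosed hsub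
  have hne : K.Nonempty := by
    refine ⟨fun _ _ => 0, fun _ _ => le_rfl, fun _ _ _ => rfl, fun u _ => ?_, fun X hX => ?_⟩
    · simpa using hw v u
    · simpa using hcut X hX
  obtain ⟨s, ⟨h1, h2, h3, h4⟩, hmax⟩ := hcomp.exists_isMaxOn hne
    (f := fun s : V → V → ℝ => ∑ a, ∑ b, s a b) (by fun_prop)
  refine ⟨s, h1, h2, ?_, h4⟩
  by_contra! hcon
  obtain ⟨u, huv, hune⟩ := hcon
  have hult : ∑ c, (s u c + s c u) < w v u := lt_of_le_of_ne (h3 u huv) hune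
  have gvt : ∀ t, t ≠ v → splitWeight v w s v t = w v t - ∑ c, (s t c + s c t) := by
    intro t ht; simp [splitWeight, ht]
  obtain ⟨t, htv, ht0, ht⟩ := exists_unblocked hf (g := splitWeight v w s)
    (by
      intro a b
      unfold splitWeight
      split_ifs with c1 c2 c3
      · exact le_rfl
      · exact sub_nonneg.2 (h3 b c2)
      · exact sub_nonneg.2 (h3 a c1)
      · exact add_nonneg (add_nonneg (hw _ _) (h1 _ _)) (h1 _ _))
    (splitWeight_symm hs) (fun X hX => by rw [wcut_splitWeight hs h2 hX]; exact h4 X hX) huv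
    (by rw [gvt u huv]; linarith)
  rw [gvt t htv] at ht0
  have hev : ∀ᶠ ε : ℝ in nhdsWithin 0 (Set.Ioi 0),
      (2 * ε < w v u - ∑ c, (s u c + s c u)) ∧ (2 * ε < w v t - ∑ c, (s t c + s c t)) ∧
      ∀ X : Finset V, v ∉ X → u ∈ X → t ∈ X →
        2 * ε < (wcut w X - 2 * ∑ a ∈ X, ∑ b ∈ X, s a b) - f X := by
    have small : ∀ δ : ℝ, 0 < δ → ∀ᶠ ε : ℝ in nhdsWithin 0 (Set.Ioi 0), 2 * ε < δ := by
      intro δ hδ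
      filter_upwards [Ioo_mem_nhdsGT (show (0 : ℝ) < δ / 2 by linarith)] with ε hε
      linarith [hε.2]
    refine (small _ (by linarith)).and ((small _ ht0).and ?_)
    rw [Filter.eventually_all]
    intro X
    by_cases hX : v ∉ X ∧ u ∈ X ∧ t ∈ X
    · have := ht X hX.1 hX.2.1 hX.2.2
      rw [wcut_splitWeight hs h2 hX.1] at this
      filter_upwards [small _ (sub_pos.2 this)] with ε hε _ _ _
      exact hε
    · filter_upwards with ε c1 c2 c3
      exact absurd ⟨c1, c2, c3⟩ hX
  obtain ⟨ε, ⟨e1, e2, e3⟩, e0⟩ := (hev.and self_mem_nhdsWithin).exists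
  replace e0 : 0 < ε := e0
  let δ : V → V → ℝ := fun a b => if a = u ∧ b = t then ε else 0
  have hδ0 : ∀ a b, 0 ≤ δ a b := by
    intro a b; simp only [δ]; split_ifs; exacts [e0.le, le_rfl]
  have hδsum : ∀ X Y : Finset V, ∑ a ∈ X, ∑ b ∈ Y, δ a b = if u ∈ X ∧ t ∈ Y then ε else 0 := by
    intro X Y
    have : ∀ a ∈ X, ∑ b ∈ Y, δ a b = if a = u then (if t ∈ Y then ε else 0) else 0 := by
      intro a _
      by_cases ha : a = u
      · simp [δ, ha]
      · simp [δ, ha]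
    rw [Finset.sum_congr rfl this, Finset.sum_ite_eq']
    by_cases hu : u ∈ X <;> simp [hu]
  have hmem : (fun a b => s a b + δ a b) ∈ K := by
    refine ⟨fun a b => add_nonneg (h1 _ _) (hδ0 _ _), fun a b hab => ?_, fun z hz => ?_,
      fun X hX => ?_⟩
    · have : ¬ (a = u ∧ b = t) := by
        rintro ⟨rfl, rfl⟩
        exact hab.elim huv htv
      simp [δ, this, h2 a b hab]
    · have e : ∑ c, (s z c + δ z c + (s c z + δ c z)) =
          ∑ c, (s z c + s c z) + ((∑ a ∈ {z}, ∑ b, δ a b) + ∑ a, ∑ b ∈ {z}, δ a b) := by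
        simp only [Finset.sum_singleton, ← Finset.sum_add_distrib]
        exact Finset.sum_congr rfl fun c _ => by ring
      simp only
      rw [e, hδsum, hδsum]
      have := h3 z hz
      by_cases hzu : z = u
      · subst hzu
        split_ifs <;> linarith
      · by_cases hzt : z = t
        · subst hzt
          split_ifs <;> linarith
        · have c1 : ¬ u = z := fun h => hzu h.symm
          have c2 : ¬ t = z := fun h => hzt h.symm
          simp [c1, c2, this]
    · simp only [Finset.sum_add_distrib]
      rw [hδsum]
      have := h4 X hX
      split_ifs with c
      · have := e3 X hX c.1 c.2
        linarith
      · linarith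
  have := isMaxOn_iff.1 hmax _ hmem
  simp only [Finset.sum_add_distrib] at this
  rw [hδsum] at this
  simp only [Finset.mem_univ, and_self, if_true] at this
  linarith

/-- The cost of a weight function on ordered pairs. -/
def pairCost (c w : V → V → ℝ) : ℝ := ∑ a, ∑ b, c a b * w a b

/-- A pseudometric, presented as a plain function. -/
structure IsPseudoMetric (c : V → V → ℝ) : Prop where
  nonneg : ∀ a b, 0 ≤ c a b
  symm : ∀ a b, c a b = c b a
  self : ∀ a, c a a = 0
  tri : ∀ a b d, c a d ≤ c a b + c b d

variable {v : V} {w s : V → V → ℝ}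

lemma splitWeight_nonneg (hw : ∀ a b, 0 ≤ w a b) (h1 : ∀ a b, 0 ≤ s a b)
    (h3 : ∀ u, u ≠ v → ∑ c, (s u c + s c u) = w v u) (a b : V) : 0 ≤ splitWeight v w s a b := by
  unfold splitWeight
  split_ifs with c1 c2 c3
  · exact le_rfl
  · exact (sub_eq_zero.2 (h3 b c2).symm).ge
  · exact (sub_eq_zero.2 (h3 a c1).symm).ge
  · exact add_nonneg (add_nonneg (hw _ _) (h1 _ _)) (h1 _ _)

lemma splitWeight_eq_zero (h3 : ∀ u, u ≠ v → ∑ c, (s u c + s c u) = w v u) {a b : V}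
    (h : a = v ∨ b = v) : splitWeight v w s a b = 0 := by
  unfold splitWeight
  split_ifs with c1 c2 c3
  · rfl
  · exact sub_eq_zero.2 (h3 b c2).symm
  · exact sub_eq_zero.2 (h3 a c1).symm
  · tauto

lemma splitting_le (h1 : ∀ a b, 0 ≤ s a b)
    (h3 : ∀ u, u ≠ v → ∑ c, (s u c + s c u) = w v u) {a : V} (ha : a ≠ v) (b : V) :
    s a b + s b a ≤ w v a := by
  rw [← h3 a ha]
  exact Finset.single_le_sum (f := fun c => s a c + s c a)
    (fun c _ => add_nonneg (h1 _ _) (h1 _ _)) (Finset.mem_univ b)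

lemma splitWeight_eq_zero_of_isolated (hs : ∀ a b, w a b = w b a) (h1 : ∀ a b, 0 ≤ s a b)
    (h3 : ∀ u, u ≠ v → ∑ c, (s u c + s c u) = w v u) {a : V} (ha : ∀ b, w a b = 0) (b : V) :
    splitWeight v w s a b = 0 := by
  by_cases h : a = v ∨ b = v
  · exact splitWeight_eq_zero h3 h
  · push Not at h
    have := splitting_le h1 h3 h.1 b
    rw [hs v a, ha v] at this
    have h4 := h1 a b
    have h5 := h1 b a
    simp only [splitWeight, h.1, h.2, if_false, ha b]
    linarith

lemma pairCost_splitWeight_le {c : V → V → ℝ} (hc : IsPseudoMetric c)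
    (hs : ∀ a b, w a b = w b a) (h1 : ∀ a b, 0 ≤ s a b)
    (h2 : ∀ a b, a = v ∨ b = v → s a b = 0)
    (h3 : ∀ u, u ≠ v → ∑ c, (s u c + s c u) = w v u) :
    pairCost c (splitWeight v w s) ≤ pairCost c w := by
  have e1 : pairCost c (splitWeight v w s) ≤
      ∑ a, ∑ b, ((if a = v ∨ b = v then 0 else c a b * w a b) +
        (c v a * (s a b + s b a) + c v b * (s a b + s b a))) := by
    refine Finset.sum_le_sum fun a _ => Finset.sum_le_sum fun b _ => ?_
    by_cases h : a = v ∨ b = v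
    · rw [splitWeight_eq_zero h3 h, if_pos h, h2 a b h, h2 b a h.symm]
      simp
    · rw [if_neg h]
      push Not at h
      simp only [splitWeight, h.1, h.2, if_false]
      have := hc.tri a v b
      rw [hc.symm a v] at this
      nlinarith [h1 a b, h1 b a]
  refine e1.trans (le_of_eq ?_)
  have hv : ∑ b, (s v b + s b v) = 0 :=
    Finset.sum_eq_zero fun b _ => by rw [h2 v b (Or.inl rfl), h2 b v (Or.inr rfl), add_zero]
  have e2 : ∑ a, ∑ b, c v a * (s a b + s b a) = ∑ a, c v a * w v a := by
    refine Finset.sum_congr rfl fun a _ => ?_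
    rw [← Finset.mul_sum]
    by_cases ha : a = v
    · subst ha; rw [hc.self]; simp
    · rw [h3 a ha]
  have e3 : ∑ a, ∑ b, c v b * (s a b + s b a) = ∑ a, c v a * w v a := by
    rw [Finset.sum_comm, ← e2]
    exact Finset.sum_congr rfl fun a _ => Finset.sum_congr rfl fun b _ => by ring
  have e4 : pairCost c w = (∑ a, ∑ b, if a = v ∨ b = v then 0 else c a b * w a b) +
      (∑ a, c v a * w v a + ∑ a, c v a * w v a) := by
    have : ∀ a b, c a b * w a b = (if a = v ∨ b = v then 0 else c a b * w a b) +
        ((if a = v then c v b * w v b else 0) + if b = v then c v a * w v a else 0) := by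
      intro a b
      by_cases ha : a = v <;> by_cases hb : b = v
      · subst ha; subst hb; simp [hc.self]
      · subst ha; simp [hb]
      · subst hb; simp [ha, hs a b, hc.symm a b]
      · simp [ha, hb]
    unfold pairCost
    rw [Finset.sum_congr rfl fun a _ => Finset.sum_congr rfl fun b _ => this a b]
    simp only [Finset.sum_add_distrib]
    congr 2
    · rw [Finset.sum_comm]; simp
    · simp
  rw [e4]
  simp only [Finset.sum_add_distrib]
  rw [e2, e3]

end Splitting

section MultiCut
variable {W E : Type*} [Fintype W] [DecidableEq W] [Fintype E] [DecidableEq E]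

/-- The `z`-weight of the edges crossing `S` in the multigraph on `W` whose edge `e` has the
endpoints `a e` and `b e`. -/
def ecut (a b : E → W) (z : E → ℝ) (S : Finset W) : ℝ :=
  ∑ e, if (a e ∈ S ↔ b e ∈ S) then 0 else z e

/-- The indicator function of a set of edges. -/
def ind (M : Finset E) (e : E) : ℝ := if e ∈ M then 1 else 0

variable {a b : E → W} {z : E → ℝ}

lemma ecut_compl (S : Finset W) : ecut a b z Sᶜ = ecut a b z S := by
  unfold ecut
  refine Finset.sum_congr rfl fun e _ => ?_
  simp only [Finset.mem_compl, not_iff_not]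

lemma ecut_add_ecut (X Y : Finset W) :
    ecut a b z X + ecut a b z Y = ecut a b z (X ∩ Y) + ecut a b z (X ∪ Y) +
      2 * ∑ e, if (a e ∈ X \ Y ∧ b e ∈ Y \ X) ∨ (b e ∈ X \ Y ∧ a e ∈ Y \ X) then z e else 0 := by
  unfold ecut
  rw [Finset.mul_sum]
  simp only [← Finset.sum_add_distrib]
  refine Finset.sum_congr rfl fun e _ => ?_
  by_cases h1 : a e ∈ X <;> by_cases h2 : b e ∈ X <;> by_cases h3 : a e ∈ Y <;>
    by_cases h4 : b e ∈ Y <;> simp [h1, h2, h3, h4] <;> ring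

lemma card_add_le_of_disjoint_odd (hz : ∀ e, 0 ≤ z e) (hdeg : ∀ v, ecut a b z {v} = 1)
    (C : Finset (Finset W)) (U : Finset W) (hC : ∀ X ∈ C, 1 ≤ ecut a b z X)
    (hdis : ∀ X ∈ C, ∀ Y ∈ C, ∀ w, w ∈ X → w ∈ Y → X = Y) (hU : ∀ X ∈ C, ∀ w ∈ X, w ∉ U)
    (hadj : ∀ e, 0 < z e → ∀ X ∈ C, ¬ (a e ∈ X ↔ b e ∈ X) → a e ∈ U ∨ b e ∈ U)
    {e₀ : E} (h₀ : a e₀ ∈ U) (h₁ : b e₀ ∈ U) (hne : a e₀ ≠ b e₀) :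
    (C.card : ℝ) + 2 * z e₀ ≤ U.card := by
  have e1 : (C.card : ℝ) ≤ ∑ X ∈ C, ecut a b z X := by
    simpa using Finset.card_nsmul_le_sum C _ 1 hC
  have e2 : (U.card : ℝ) = ∑ u ∈ U, ecut a b z {u} := by simp [hdeg]
  rw [e2]
  refine (add_le_add_left e1 _).trans ?_
  unfold ecut
  rw [Finset.sum_comm, Finset.sum_comm (s := U)]
  have e3 : 2 * z e₀ = ∑ e, if e = e₀ then 2 * z e₀ else 0 := by simp
  rw [e3, ← Finset.sum_add_distrib]
  refine Finset.sum_le_sum fun e _ => ?_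
  have hnn : ∀ u ∈ U, 0 ≤ if (a e ∈ ({u} : Finset W) ↔ b e ∈ ({u} : Finset W)) then 0 else z e := by
    intro u _
    split_ifs
    exacts [le_rfl, hz e]
  by_cases he : e = e₀
  · subst he
    have l0 : (∑ X ∈ C, if (a e ∈ X ↔ b e ∈ X) then 0 else z e) = 0 := by
      refine Finset.sum_eq_zero fun X hX => ?_
      have c1 : a e ∉ X := fun h => hU X hX _ h h₀
      have c2 : b e ∉ X := fun h => hU X hX _ h h₁
      simp [c1, c2]
    rw [l0, if_pos rfl, zero_add]
    have hsub : ({a e, b e} : Finset W) ⊆ U := by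
      intro x hx
      simp only [Finset.mem_insert, Finset.mem_singleton] at hx
      rcases hx with rfl | rfl <;> assumption
    refine le_trans (le_of_eq ?_) (Finset.sum_le_sum_of_subset_of_nonneg hsub fun u hu _ => hnn u hu)
    rw [Finset.sum_pair hne]
    simp [hne, hne.symm]; ring
  · rw [if_neg he, add_zero]
    by_cases hcr : ∃ X ∈ C, 0 < z e ∧ ¬ (a e ∈ X ↔ b e ∈ X)
    · obtain ⟨X, hX, hpos, hx⟩ := hcr
      have hab : a e ≠ b e := by
        intro h; rw [h] at hx; exact hx Iff.rfl
      have hl : (∑ X ∈ C, if (a e ∈ X ↔ b e ∈ X) then 0 else z e) ≤ z e := by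
        rw [Finset.sum_eq_single_of_mem X hX]
        · rw [if_neg hx]
        · intro Y hY hYX
          rw [if_pos]
          by_contra hy
          have := hadj e hpos X hX hx
          have d1 := hdis X hX Y hY
          have u1 := hU X hX
          have u2 := hU Y hY
          have : X = Y := by
            by_cases p1 : a e ∈ X <;> by_cases p2 : b e ∈ X <;> by_cases p3 : a e ∈ Y <;>
              by_cases p4 : b e ∈ Y <;> grind
          exact hYX this.symm
      refine hl.trans ?_
      rcases hadj e hpos X hX hx with h | h
      · refine le_trans (le_of_eq ?_) (Finset.single_le_sum hnn h)
        simp [hab.symm]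
      · refine le_trans (le_of_eq ?_) (Finset.single_le_sum hnn h)
        simp [hab]
    · push Not at hcr
      refine le_trans (le_of_eq ?_) (Finset.sum_nonneg hnn)
      refine Finset.sum_eq_zero fun X hX => ?_
      split_ifs with h
      · rfl
      · by_contra hzne
        exact h (hcr X hX (lt_of_le_of_ne (hz e) (Ne.symm hzne)))

lemma exists_perfectMatching_through (hcard : Even (Fintype.card W)) (hz : ∀ e, 0 ≤ z e)
    (hdeg : ∀ v, ecut a b z {v} = 1) (hodd : ∀ S : Finset W, Odd S.card → 1 ≤ ecut a b z S)
    {e₀ : E} (h₀ : 0 < z e₀) (hne : a e₀ ≠ b e₀) :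
    ∃ M : Finset E, e₀ ∈ M ∧ (∀ e ∈ M, 0 < z e ∧ a e ≠ b e) ∧ ∀ v, ecut a b (ind M) {v} = 1 := by
  classical
  let P := {v : W // v ≠ a e₀ ∧ v ≠ b e₀}
  let H : SimpleGraph P :=
    { Adj := fun u v => u ≠ v ∧ ∃ e, 0 < z e ∧ s(a e, b e) = s((u : W), (v : W))
      symm := ⟨fun u v h => ⟨h.1.symm, by
        obtain ⟨e, he, h'⟩ := h.2
        exact ⟨e, he, by rw [h', Sym2.eq_swap]⟩⟩⟩
      loopless := ⟨fun u h => h.1 rfl⟩ }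
  have hH : ∀ u v : P, H.Adj u v ↔ u ≠ v ∧ ∃ e, 0 < z e ∧ s(a e, b e) = s((u : W), (v : W)) :=
    fun u v => Iff.rfl
  have hP : Fintype.card P + 2 = Fintype.card W := by
    have h1 := Fintype.card_subtype_compl (fun v : W => v = a e₀ ∨ v = b e₀)
    have h2 : Fintype.card {v : W // v = a e₀ ∨ v = b e₀} = 2 := by
      rw [Fintype.card_subtype, ← Finset.card_pair hne]
      congr 1; ext x; simp
    have h3 : Fintype.card P = Fintype.card {v : W // ¬ (v = a e₀ ∨ v = b e₀)} :=
      Fintype.card_congr (Equiv.subtypeEquivRight fun x => by simp)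
    have h4 := Fintype.card_subtype_le (fun v : W => v = a e₀ ∨ v = b e₀)
    omega
  have htutte : ∀ U, ¬ H.IsTutteViolator U := by
    intro U hviol
    unfold SimpleGraph.IsTutteViolator at hviol
    set K := ((⊤ : H.Subgraph).deleteVerts U) with hK
    have hKv : ∀ x : P, x ∈ K.verts ↔ x ∉ U := by intro x; simp [hK]
    let supp : K.coe.ConnectedComponent → Finset W := fun c =>
      Finset.univ.filter fun w => ∃ x : K.verts, x ∈ c.supp ∧ ((x : P) : W) = w
    have hsupp : ∀ c w, w ∈ supp c ↔ ∃ x : K.verts, x ∈ c.supp ∧ ((x : P) : W) = w := by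
      intro c w; simp [supp]
    have hinj : ∀ c d w, w ∈ supp c → w ∈ supp d → c = d := by
      intro c d w hc hd
      obtain ⟨x, hx, rfl⟩ := (hsupp _ _).1 hc
      obtain ⟨y, hy, hxy⟩ := (hsupp _ _).1 hd
      have : y = x := Subtype.ext (Subtype.ext hxy)
      subst this
      rw [SimpleGraph.ConnectedComponent.mem_supp_iff] at hx hy
      rw [← hx, ← hy]
    have hcards : ∀ c, (supp c).card = c.supp.ncard := by
      intro c
      have : (supp c : Set W) = (fun x : K.verts => ((x : P) : W)) '' c.supp := by
        ext w; simp [hsupp]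
      rw [← Set.ncard_coe_finset, this, Set.ncard_image_of_injective]
      intro x y hxy
      exact Subtype.ext (Subtype.ext hxy)
    let U' : Finset W := insert (a e₀) (insert (b e₀) (Finset.univ.filter
      fun w => ∃ x : P, x ∈ U ∧ (x : W) = w))
    have hU' : ∀ w, w ∈ U' ↔ w = a e₀ ∨ w = b e₀ ∨ ∃ x : P, x ∈ U ∧ (x : W) = w := by
      intro w; simp [U']
    have hU'card : U'.card = U.ncard + 2 := by
      have hc : (Finset.univ.filter fun w => ∃ x : P, x ∈ U ∧ (x : W) = w).card = U.ncard := by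
        have : ((Finset.univ.filter fun w => ∃ x : P, x ∈ U ∧ (x : W) = w : Finset W) : Set W) =
            (fun x : P => (x : W)) '' U := by
          ext w; simp
        rw [← Set.ncard_coe_finset, this, Set.ncard_image_of_injective _ Subtype.val_injective]
      rw [Finset.card_insert_of_notMem, Finset.card_insert_of_notMem, hc]
      · simp only [Finset.mem_filter, Finset.mem_univ, true_and, not_exists, not_and]
        intro x _ h; exact x.2.2 h
      · simp only [Finset.mem_insert, Finset.mem_filter, Finset.mem_univ, true_and, not_or,
          not_exists, not_and]
        exact ⟨hne, fun x _ h => x.2.1 h⟩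
    let C : Finset (Finset W) := (K.coe.oddComponents.toFinite.toFinset).image supp
    have hne' : ∀ c : K.coe.ConnectedComponent, ∃ w, w ∈ supp c := by
      intro c
      obtain ⟨x, hx⟩ := c.nonempty_supp
      exact ⟨_, (hsupp _ _).2 ⟨x, hx, rfl⟩⟩
    have hCcard : C.card = K.coe.oddComponents.ncard := by
      rw [Finset.card_image_of_injective, ← Set.ncard_eq_toFinset_card]
      intro c d hcd
      obtain ⟨w, hw⟩ := hne' c
      exact hinj c d w hw (hcd ▸ hw)
    have hCm : ∀ X ∈ C, ∃ c, Odd (supp c).card ∧ supp c = X := by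
      intro X hX
      obtain ⟨c, hc, rfl⟩ := Finset.mem_image.1 hX
      refine ⟨c, ?_, rfl⟩
      rw [hcards]
      simpa using hc
    have hcount := card_add_le_of_disjoint_odd (e₀ := e₀) hz hdeg C U'
      (by
        intro X hX
        obtain ⟨c, hc, rfl⟩ := hCm X hX
        exact hodd _ hc)
      (by
        intro X hX Y hY w hwX hwY
        obtain ⟨c, -, rfl⟩ := hCm X hX
        obtain ⟨d, -, rfl⟩ := hCm Y hY
        rw [hinj c d w hwX hwY])
      (by
        intro X hX w hw hwU
        obtain ⟨c, -, rfl⟩ := hCm X hX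
        obtain ⟨x, hx, rfl⟩ := (hsupp _ _).1 hw
        rcases (hU' _).1 hwU with h | h | ⟨y, hy, h⟩
        · exact (x : P).2.1 h
        · exact (x : P).2.2 h
        · have : y = x := Subtype.ext h
          subst this
          exact (hKv _).1 x.2 hy)
      (by
        intro e hze X hX hcross
        obtain ⟨c, -, rfl⟩ := hCm X hX
        by_contra! hno
        have mk : ∀ w, w ∉ U' → ∃ x : K.verts, ((x : P) : W) = w := by
          intro w hw
          rw [hU'] at hw
          push Not at hw
          exact ⟨⟨⟨w, hw.1, hw.2.1⟩, (hKv _).2 fun h => hw.2.2 _ h rfl⟩, rfl⟩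
        obtain ⟨x, hx⟩ := mk _ hno.1
        obtain ⟨y, hy⟩ := mk _ hno.2
        have hxy : x ≠ y := by
          rintro rfl
          rw [← hx, ← hy] at hcross
          exact hcross Iff.rfl
        have hadj : K.coe.Adj x y := by
          refine SimpleGraph.Subgraph.deleteVerts_adj.2
            ⟨Set.mem_univ _, (hKv _).1 x.2, Set.mem_univ _, (hKv _).1 y.2, ?_⟩
          rw [SimpleGraph.Subgraph.top_adj, hH]
          exact ⟨fun h => hxy (Subtype.ext h), e, hze, by rw [hx, hy]⟩
        apply hcross
        have hr := SimpleGraph.ConnectedComponent.sound hadj.reachable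
        have memiff : ∀ (x : K.verts), ((x : P) : W) ∈ supp c ↔ K.coe.connectedComponentMk x = c := by
          intro x
          rw [hsupp]
          constructor
          · rintro ⟨y, hy, hyx⟩
            have : y = x := Subtype.ext (Subtype.ext hyx)
            subst this
            exact hy
          · intro h; exact ⟨x, h, rfl⟩
        rw [← hx, ← hy, memiff, memiff, hr])
      (by simp [hU']) (by simp [hU']) hne
    rw [hU'card, hCcard] at hcount
    have hlt : K.coe.oddComponents.ncard < U.ncard + 2 := by
      have : (K.coe.oddComponents.ncard : ℝ) < (U.ncard + 2 : ℕ) := by linarith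
      exact_mod_cast this
    have hpar := SimpleGraph.odd_ncard_oddComponents (G := K.coe)
    have hcv : Nat.card K.verts + U.ncard = Fintype.card P := by
      have : K.verts = Uᶜ := by ext x; simp [hKv]
      rw [this, Nat.card_coe_set_eq, ← Nat.card_eq_fintype_card, add_comm]
      exact Set.ncard_add_ncard_compl U
    have : K.coe.oddComponents.ncard = U.ncard + 1 := by omega
    rw [this] at hpar
    rw [Nat.even_iff] at hcard
    rw [Nat.odd_iff, Nat.odd_iff] at hpar
    omega
  obtain ⟨Mt, hMt⟩ := SimpleGraph.tutte.2 htutte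
  rw [SimpleGraph.Subgraph.isPerfectMatching_iff] at hMt
  have hch : ∀ t : Sym2 W, ∃ e, (∃ e', 0 < z e' ∧ s(a e', b e') = t) → 0 < z e ∧ s(a e, b e) = t := by
    intro t
    by_cases h : ∃ e', 0 < z e' ∧ s(a e', b e') = t
    · obtain ⟨e, he⟩ := h
      exact ⟨e, fun _ => he⟩
    · exact ⟨e₀, fun h' => absurd h' h⟩
  choose f hf using hch
  have hf' : ∀ u v : P, Mt.Adj u v →
      0 < z (f s((u : W), (v : W))) ∧
        s(a (f s((u : W), (v : W))), b (f s((u : W), (v : W)))) = s((u : W), (v : W)) :=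
    fun u v h => hf _ ((hH u v).1 (Mt.adj_sub h)).2
  let M : Finset E := Finset.univ.filter fun e =>
    e = e₀ ∨ ∃ u v : P, Mt.Adj u v ∧ e = f s((u : W), (v : W))
  have hM : ∀ e, e ∈ M ↔ e = e₀ ∨ ∃ u v : P, Mt.Adj u v ∧ e = f s((u : W), (v : W)) := by
    intro e; simp [M]
  refine ⟨M, (hM _).2 (Or.inl rfl), ?_, ?_⟩
  · intro e he
    rcases (hM e).1 he with rfl | ⟨u, v, huv, rfl⟩
    · exact ⟨h₀, hne⟩
    · refine ⟨(hf' u v huv).1, fun hab => ?_⟩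
      have h2 := (hf' u v huv).2
      rw [hab, Sym2.eq_iff] at h2
      have : (u : W) = v := h2.elim (fun h => h.1.symm.trans h.2) fun h => h.2.symm.trans h.1
      exact (Mt.adj_sub huv).ne (Subtype.ext this)
  · intro v
    have key : ∃ e₁ ∈ M, (¬ (a e₁ = v ↔ b e₁ = v)) ∧
        ∀ e ∈ M, ¬ (a e = v ↔ b e = v) → e = e₁ := by
      by_cases hv : v = a e₀ ∨ v = b e₀
      · refine ⟨e₀, (hM _).2 (Or.inl rfl), ?_, ?_⟩
        · rcases hv with rfl | rfl
          · simp [hne.symm]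
          · simp [hne]
        · intro e he hcr
          rcases (hM e).1 he with rfl | ⟨x, y, hxy, rfl⟩
          · rfl
          · exfalso
            have h2 := (hf' x y hxy).2
            rw [Sym2.eq_iff] at h2
            have n1 := x.2
            have n2 := y.2
            have n3 : (x : W) ≠ v := by rintro rfl; tauto
            have n4 : (y : W) ≠ v := by rintro rfl; tauto
            apply hcr
            rcases h2 with ⟨h, h'⟩ | ⟨h, h'⟩ <;> rw [h, h'] <;> simp [n3, n4]
      · push Not at hv
        obtain ⟨w, hw, huniq⟩ := hMt ⟨v, hv⟩
        have hvw : v ≠ (w : W) := fun h => (Mt.adj_sub hw).ne (Subtype.ext h)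
        refine ⟨f s(v, (w : W)), (hM _).2 (Or.inr ⟨⟨v, hv⟩, w, hw, rfl⟩), ?_, ?_⟩
        · have h2 := (hf' _ _ hw).2
          rw [Sym2.eq_iff] at h2
          rcases h2 with ⟨h, h'⟩ | ⟨h, h'⟩
          · simp only at h h'
            rw [h, h']; simp [hvw.symm]
          · simp only at h h'
            rw [h, h']; simp [hvw.symm]
        · intro e he hcr
          rcases (hM e).1 he with rfl | ⟨x, y, hxy, rfl⟩
          · exfalso
            apply hcr
            simp [hv.1.symm, hv.2.symm]
          · have h2 := (hf' x y hxy).2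
            have : (x : W) = v ∨ (y : W) = v := by
              by_contra! hcon
              apply hcr
              rw [Sym2.eq_iff] at h2
              rcases h2 with ⟨h, h'⟩ | ⟨h, h'⟩ <;> rw [h, h'] <;> simp [hcon.1, hcon.2]
            rcases this with h | h
            · have hx : x = ⟨v, hv⟩ := Subtype.ext h
              subst hx
              rw [huniq y hxy]
            · have hy : y = ⟨v, hv⟩ := Subtype.ext h
              subst hy
              rw [huniq x hxy.symm, Sym2.eq_swap]
    obtain ⟨e₁, hm, hcr, hu⟩ := key
    unfold ecut ind
    simp only [Finset.mem_singleton]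
    rw [Finset.sum_eq_single e₁]
    · rw [if_neg hcr, if_pos hm]
    · intro e _ hne1
      by_cases h : a e = v ↔ b e = v
      · rw [if_pos h]
      · rw [if_neg h, if_neg fun hm' => hne1 (hu e hm' h)]
    · intro h; exact absurd (Finset.mem_univ _) h

end MultiCut
section TightMatching
universe u
variable {W : Type u} {E : Type*} [Fintype W] [DecidableEq W] [Fintype E] [DecidableEq E]
variable {a b : E → W} {z : E → ℝ}

lemma ecut_ind (M : Finset E) (S : Finset W) :
    ecut a b (ind M) S = (M.filter fun e => ¬ (a e ∈ S ↔ b e ∈ S)).card := by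
  unfold ecut ind
  rw [Finset.card_filter, Nat.cast_sum, ← Finset.sum_subset (Finset.subset_univ M)]
  · refine Finset.sum_congr rfl fun e he => ?_
    by_cases h : a e ∈ S ↔ b e ∈ S <;> simp [h, he]
  · intro e _ he
    simp [he]

lemma exists_unique_crossing {M : Finset E} {S : Finset W} (h : ecut a b (ind M) S = 1) :
    ∃ f ∈ M, ¬ (a f ∈ S ↔ b f ∈ S) ∧ ∀ e ∈ M, ¬ (a e ∈ S ↔ b e ∈ S) → e = f := by
  rw [ecut_ind] at h
  obtain ⟨f, hf⟩ := Finset.card_eq_one.1 (by exact_mod_cast h :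
    (M.filter fun e => ¬ (a e ∈ S ↔ b e ∈ S)).card = 1)
  have hm : ∀ e, (e ∈ M ∧ ¬ (a e ∈ S ↔ b e ∈ S)) ↔ e = f := by
    intro e
    rw [← Finset.mem_singleton, ← hf, Finset.mem_filter]
  exact ⟨f, ((hm f).2 rfl).1, ((hm f).2 rfl).2, fun e h1 h2 => (hm e).1 ⟨h1, h2⟩⟩

/-- Conclusion of the tight matching theorem for a fixed multigraph and edge `e₀`. -/
def HasTightMatching (a b : E → W) (z : E → ℝ) (e₀ : E) : Prop :=
  ∃ M : Finset E, e₀ ∈ M ∧ (∀ e ∈ M, 0 < z e ∧ a e ≠ b e) ∧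
    ∀ S : Finset W, Odd S.card → ecut a b z S = 1 → ecut a b (ind M) S = 1

/-- The map contracting the complement of `S` to a point. -/
def contract (S : Finset W) (x : W) : Option {x // x ∈ S} :=
  if h : x ∈ S then some ⟨x, h⟩ else none

lemma contract_of_mem {S : Finset W} {x : W} (h : x ∈ S) : contract S x = some ⟨x, h⟩ := by
  simp [contract, h]

lemma contract_of_notMem {S : Finset W} {x : W} (h : x ∉ S) : contract S x = none := by
  simp [contract, h]

lemma odd_card_preimage_contract {S : Finset W} (hS : Odd (Sᶜ).card)
    (X : Finset (Option {x // x ∈ S})) (hX : Odd X.card) :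
    Odd (Finset.univ.filter fun x => contract S x ∈ X).card := by
  have h1 : ((Finset.univ.filter fun x => contract S x ∈ X).filter (· ∈ S)).card =
      (X.erase none).card := by
    refine Finset.card_bij (fun x _ => contract S x) ?_ ?_ ?_
    · intro x hx
      simp only [Finset.mem_filter, Finset.mem_univ, true_and] at hx
      rw [Finset.mem_erase]
      refine ⟨?_, hx.1⟩
      rw [contract_of_mem hx.2]; simp
    · intro x hx y hy hxy
      simp only [Finset.mem_filter, Finset.mem_univ, true_and] at hx hy
      rw [contract_of_mem hx.2, contract_of_mem hy.2] at hxy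
      simpa using hxy
    · intro t ht
      rw [Finset.mem_erase] at ht
      obtain ⟨x, rfl⟩ := Option.ne_none_iff_exists'.1 ht.1
      refine ⟨x, ?_, ?_⟩
      · simp only [Finset.mem_filter, Finset.mem_univ, true_and]
        rw [contract_of_mem x.2]
        exact ⟨ht.2, x.2⟩
      · rw [contract_of_mem x.2]
  have h2 : ((Finset.univ.filter fun x => contract S x ∈ X).filter (· ∉ S)).card =
      if none ∈ X then (Sᶜ).card else 0 := by
    split_ifs with h
    · congr 1
      ext x
      simp only [Finset.mem_filter, Finset.mem_univ, true_and, Finset.mem_compl, and_iff_right_iff_imp]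
      intro hx
      rwa [contract_of_notMem hx]
    · rw [Finset.card_eq_zero]
      ext x
      simp only [Finset.mem_filter, Finset.mem_univ, true_and, Finset.notMem_empty, iff_false, not_and]
      intro hx hxS
      rw [contract_of_notMem hxS] at hx
      exact h hx
  rw [← Finset.card_filter_add_card_filter_not (· ∈ S), h1, h2]
  by_cases h : none ∈ X
  · rw [Finset.card_erase_of_mem h, if_pos h]
    have := Finset.card_pos.2 ⟨_, h⟩
    rw [Nat.odd_iff] at *
    omega
  · rw [Finset.erase_eq_of_notMem h, if_neg h]
    exact hX

lemma ecut_contract (S : Finset W) (X : Finset (Option {x // x ∈ S})) (z : E → ℝ) :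
    ecut (contract S ∘ a) (contract S ∘ b) z X =
      ecut a b z (Finset.univ.filter fun x => contract S x ∈ X) := by
  simp [ecut]

lemma exists_matching_of_contract {S : Finset W} (hS' : Odd (Sᶜ).card)
    (hdeg : ∀ v, ecut a b z {v} = 1) (hodd : ∀ S : Finset W, Odd S.card → 1 ≤ ecut a b z S)
    (htight : ecut a b z S = 1) {e₀ : E}
    (ih : ∀ a' b' : E → Option {x // x ∈ S}, (∀ v, ecut a' b' z {v} = 1) →
      (∀ X, Odd X.card → 1 ≤ ecut a' b' z X) → a' e₀ ≠ b' e₀ → HasTightMatching a' b' z e₀)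
    (hne : a e₀ ≠ b e₀) (hmem : a e₀ ∈ S ∨ b e₀ ∈ S) :
    ∃ M : Finset E, e₀ ∈ M ∧ (∀ e ∈ M, 0 < z e ∧ a e ≠ b e ∧ (a e ∈ S ∨ b e ∈ S)) ∧
      ∀ X ⊆ S, Odd X.card → ecut a b z X = 1 → ecut a b (ind M) X = 1 := by
  have hq : ∀ x y, contract S x = contract S y → x = y ∨ (x ∉ S ∧ y ∉ S) := by
    intro x y h
    by_cases hx : x ∈ S <;> by_cases hy : y ∈ S
    · rw [contract_of_mem hx, contract_of_mem hy] at h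
      left; simpa using h
    · rw [contract_of_mem hx, contract_of_notMem hy] at h
      simp at h
    · rw [contract_of_mem hy, contract_of_notMem hx] at h
      simp at h
    · exact Or.inr ⟨hx, hy⟩
  obtain ⟨M, h1, h2, h3⟩ := ih (contract S ∘ a) (contract S ∘ b) (by
      intro v
      rw [ecut_contract]
      cases v with
      | none =>
        rw [← htight, ← ecut_compl S]
        congr 1
        ext x
        by_cases hx : x ∈ S
        · simp [contract_of_mem hx, hx]
        · simp [contract_of_notMem hx, hx]
      | some v =>
        rw [← hdeg (v : W)]
        congr 1
        ext x
        by_cases hx : x ∈ S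
        · simp [contract_of_mem hx, Subtype.ext_iff]
        · have : x ≠ v := fun h => hx (h ▸ v.2)
          simp [contract_of_notMem hx, this])
    (by
      intro X hX
      rw [ecut_contract]
      exact hodd _ (odd_card_preimage_contract hS' X hX))
    (by
      intro h
      rcases hq _ _ h with h | h
      · exact hne h
      · tauto)
  refine ⟨M, h1, ?_, ?_⟩
  · intro e he
    obtain ⟨p1, p2⟩ := h2 e he
    refine ⟨p1, fun h => p2 (by simp [h]), ?_⟩
    by_contra! hcon
    exact p2 (by simp [contract_of_notMem hcon.1, contract_of_notMem hcon.2])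
  · intro X hXS hX hXt
    let X' : Finset (Option {x // x ∈ S}) := X.image (contract S)
    have hpre : (Finset.univ.filter fun x => contract S x ∈ X') = X := by
      ext x
      simp only [Finset.mem_filter, Finset.mem_univ, true_and, X', Finset.mem_image]
      constructor
      · rintro ⟨y, hy, hyx⟩
        rcases hq _ _ hyx with h | h
        · exact h ▸ hy
        · exact absurd (hXS hy) h.1
      · intro hx; exact ⟨x, hx, rfl⟩
    have hc : X'.card = X.card := by
      refine Finset.card_image_of_injOn fun x hx y hy h => ?_
      rcases hq _ _ h with h | h
      · exact h
      · exact absurd (hXS hx) h.1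
    have := h3 X' (hc ▸ hX) (by rw [ecut_contract, hpre, hXt])
    rwa [ecut_contract, hpre] at this

lemma ecut_union_of_subset {S X : Finset W} {M₁ M₂ : Finset E} {f : E}
    (h₂ : ∀ e ∈ M₂, a e ∉ S ∨ b e ∉ S) (hf₁ : f ∈ M₁)
    (hf₂ : ∀ e ∈ M₂, ¬ (a e ∈ S ↔ b e ∈ S) → e = f) (hX : X ⊆ S) :
    ecut a b (ind (M₁ ∪ M₂)) X = ecut a b (ind M₁) X := by
  unfold ecut ind
  refine Finset.sum_congr rfl fun e _ => ?_
  by_cases h : a e ∈ X ↔ b e ∈ X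
  · simp [h]
  · rw [if_neg h, if_neg h]
    congr 1
    rw [Finset.mem_union, eq_iff_iff, or_iff_left_iff_imp]
    intro he
    have : e = f := by
      refine hf₂ e he ?_
      have := h₂ e he
      by_cases h1 : a e ∈ X <;> by_cases h2 : b e ∈ X <;> grind
    exact this ▸ hf₁

lemma hasTightMatching_of_contract {S : Finset W} (hcard : Even (Fintype.card W))
    (hz : ∀ e, 0 ≤ z e) (hS : Odd S.card) (hS' : Odd (Sᶜ).card)
    (hdeg : ∀ v, ecut a b z {v} = 1) (hodd : ∀ S : Finset W, Odd S.card → 1 ≤ ecut a b z S)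
    (htight : ecut a b z S = 1) {e₀ : E}
    (ih₁ : ∀ a' b' : E → Option {x // x ∈ S}, (∀ v, ecut a' b' z {v} = 1) →
      (∀ X, Odd X.card → 1 ≤ ecut a' b' z X) → ∀ e, 0 < z e → a' e ≠ b' e →
        HasTightMatching a' b' z e)
    (ih₂ : ∀ a' b' : E → Option {x // x ∈ Sᶜ}, (∀ v, ecut a' b' z {v} = 1) →
      (∀ X, Odd X.card → 1 ≤ ecut a' b' z X) → ∀ e, 0 < z e → a' e ≠ b' e →
        HasTightMatching a' b' z e)
    (h₀ : 0 < z e₀) (hne : a e₀ ≠ b e₀) (hmem : a e₀ ∈ S ∨ b e₀ ∈ S) :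
    HasTightMatching a b z e₀ := by
  obtain ⟨M₁, m1, m2, m3⟩ := exists_matching_of_contract hS' hdeg hodd htight
    (fun a' b' p q => ih₁ a' b' p q e₀ h₀) hne hmem
  obtain ⟨f, hf, hfc, hfu⟩ := exists_unique_crossing (m3 S subset_rfl hS htight)
  have htight' : ecut a b z Sᶜ = 1 := by rw [ecut_compl, htight]
  obtain ⟨M₂, n1, n2, n3⟩ := exists_matching_of_contract (by rwa [compl_compl]) hdeg hodd
    htight' (fun a' b' p q => ih₂ a' b' p q f (m2 f hf).1) (m2 f hf).2.1 (by
      simp only [Finset.mem_compl]; tauto)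
  obtain ⟨f', hf', hfc', hfu'⟩ := exists_unique_crossing (n3 Sᶜ subset_rfl hS' htight')
  have hff : f = f' := hfu' f n1 (by simp only [Finset.mem_compl]; tauto)
  subst hff
  have c1 : ∀ X ⊆ S, ecut a b (ind (M₁ ∪ M₂)) X = ecut a b (ind M₁) X := fun X hX =>
    ecut_union_of_subset (f := f) (fun e he => by simpa using (n2 e he).2.2) hf
      (fun e he hc => hfu' e he (by simp only [Finset.mem_compl]; tauto)) hX
  have c2 : ∀ X ⊆ Sᶜ, ecut a b (ind (M₁ ∪ M₂)) X = ecut a b (ind M₂) X := fun X hX => by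
    rw [Finset.union_comm]
    exact ecut_union_of_subset (f := f) (fun e he => by simpa using (m2 e he).2.2) n1
      (fun e he hc => hfu e he (by simp only [Finset.mem_compl] at hc; tauto)) hX
  have hpos : ∀ e ∈ M₁ ∪ M₂, 0 < z e ∧ a e ≠ b e := by
    intro e he
    rcases Finset.mem_union.1 he with h | h
    · exact ⟨(m2 e h).1, (m2 e h).2.1⟩
    · exact ⟨(n2 e h).1, (n2 e h).2.1⟩
  have key : ∀ X : Finset W, Odd X.card → Odd (X ∩ S).card → ecut a b z X = 1 →
      ecut a b (ind (M₁ ∪ M₂)) X = 1 := by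
    intro X hX hXS hXt
    have hcu := Finset.card_inter_add_card_union X S
    have hun : Odd (X ∪ S).card := by
      rw [Nat.odd_iff] at *; omega
    have hcc := Finset.card_compl_add_card (X ∪ S)
    have hunc : Odd ((X ∪ S)ᶜ).card := by
      rw [Nat.odd_iff] at *; rw [Nat.even_iff] at hcard; omega
    have e1 := ecut_add_ecut (a := a) (b := b) (z := z) X S
    have e2 := ecut_add_ecut (a := a) (b := b) (z := ind (M₁ ∪ M₂)) X S
    have g1 := hodd _ hXS
    have g2 := hodd _ hun
    have g3 : 0 ≤ ∑ e, if (a e ∈ X \ S ∧ b e ∈ S \ X) ∨ (b e ∈ X \ S ∧ a e ∈ S \ X) then z e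
        else 0 := Finset.sum_nonneg fun e _ => by split_ifs; exacts [hz e, le_rfl]
    have t3 : (∑ e, if (a e ∈ X \ S ∧ b e ∈ S \ X) ∨ (b e ∈ X \ S ∧ a e ∈ S \ X) then z e
        else 0) = 0 := by linarith
    have t1 : ecut a b z (X ∩ S) = 1 := by linarith
    have t2 : ecut a b z (X ∪ S)ᶜ = 1 := by rw [ecut_compl]; linarith
    have i3 : (∑ e, if (a e ∈ X \ S ∧ b e ∈ S \ X) ∨ (b e ∈ X \ S ∧ a e ∈ S \ X) then
        ind (M₁ ∪ M₂) e else 0) = 0 := by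
      refine Finset.sum_eq_zero fun e _ => ?_
      have hx := (Finset.sum_eq_zero_iff_of_nonneg (fun e _ => by
        split_ifs; exacts [hz e, le_rfl])).1 t3 e (Finset.mem_univ _)
      split_ifs with h
      · rw [if_pos h] at hx
        unfold ind
        rw [if_neg]
        intro he
        exact (hpos e he).1.ne' hx
      · rfl
    have i1 := (c1 (X ∩ S) Finset.inter_subset_right).trans (m3 _ Finset.inter_subset_right hXS t1)
    have hsub : (X ∪ S)ᶜ ⊆ Sᶜ := Finset.compl_subset_compl.2 Finset.subset_union_right
    have i2 := (c2 _ hsub).trans (n3 _ hsub hunc t2)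
    rw [ecut_compl] at i2
    have i4 := (c1 S subset_rfl).trans (m3 _ subset_rfl hS htight)
    rw [i1, i2, i3, i4] at e2
    linarith
  refine ⟨M₁ ∪ M₂, Finset.mem_union_left _ m1, hpos, ?_⟩
  intro X hX hXt
  by_cases h : Odd (X ∩ S).card
  · exact key X hX h hXt
  · rw [← ecut_compl]
    have hcc := Finset.card_compl_add_card X
    have h2 : (Xᶜ ∩ S).card + (X ∩ S).card = S.card := by
      rw [← Finset.card_filter_add_card_filter_not (· ∈ X) (s := S), add_comm]
      congr 2 <;> ext <;> simp [and_comm]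
    refine key Xᶜ ?_ ?_ (by rw [ecut_compl, hXt])
    · rw [Nat.odd_iff] at *; rw [Nat.even_iff] at hcard; omega
    · rw [Nat.odd_iff] at *; omega

theorem hasTightMatching (n : ℕ) : ∀ (W : Type u) [Fintype W] [DecidableEq W] (a b : E → W),
    Fintype.card W = n → Even n → (∀ e, 0 ≤ z e) → (∀ v, ecut a b z {v} = 1) →
    (∀ S : Finset W, Odd S.card → 1 ≤ ecut a b z S) → ∀ e₀, 0 < z e₀ → a e₀ ≠ b e₀ →
    HasTightMatching a b z e₀ := by
  induction n using Nat.strong_induction_on with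
  | _ n ih =>
    intro W _ _ a b hn heven hz hdeg hodd e₀ h₀ hne
    subst hn
    by_cases hex : ∃ S : Finset W, Odd S.card ∧ 1 < S.card ∧ 1 < (Sᶜ).card ∧ ecut a b z S = 1
    · have main : ∀ S : Finset W, Odd S.card → 1 < S.card → 1 < (Sᶜ).card → ecut a b z S = 1 →
          (a e₀ ∈ S ∨ b e₀ ∈ S) → HasTightMatching a b z e₀ := by
        intro S hS h1 h2 ht hmem
        have hcc := Finset.card_compl_add_card S
        have hS' : Odd (Sᶜ).card := by
          rw [Nat.odd_iff] at *; rw [Nat.even_iff] at heven; omega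
        refine hasTightMatching_of_contract heven hz hS hS' hdeg hodd ht ?_ ?_ h₀ hne hmem
        · intro a' b' p q e
          refine ih (S.card + 1) (by omega) _ a' b' (by simp) ?_ hz p q e
          exact hS.add_one
        · intro a' b' p q e
          refine ih ((Sᶜ).card + 1) (by omega) _ a' b' (by
            rw [Fintype.card_option, Fintype.card_coe]) ?_ hz p q e
          exact hS'.add_one
      obtain ⟨S, hS, h1, h2, ht⟩ := hex
      by_cases hmem : a e₀ ∈ S ∨ b e₀ ∈ S
      · exact main S hS h1 h2 ht hmem
      · push Not at hmem
        have hcc := Finset.card_compl_add_card S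
        refine main Sᶜ ?_ h2 (by rwa [compl_compl]) (by rw [ecut_compl, ht])
          (Or.inl (Finset.mem_compl.2 hmem.1))
        rw [Nat.odd_iff] at *; rw [Nat.even_iff] at heven; omega
    · obtain ⟨M, m1, m2, m3⟩ := exists_perfectMatching_through heven hz hdeg hodd h₀ hne
      refine ⟨M, m1, m2, fun S hS ht => ?_⟩
      push Not at hex
      by_cases h1 : 1 < S.card
      · have h2 : (Sᶜ).card ≤ 1 := by
          by_contra! h
          exact hex S hS h1 h ht
        have hcc := Finset.card_compl_add_card S
        have h3 : (Sᶜ).card = 1 := by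
          rw [Nat.odd_iff] at hS; rw [Nat.even_iff] at heven; omega
        obtain ⟨v, hv⟩ := Finset.card_eq_one.1 h3
        rw [← ecut_compl, hv, m3]
      · have h3 : S.card = 1 := by
          have := hS.pos; omega
        obtain ⟨v, hv⟩ := Finset.card_eq_one.1 h3
        rw [hv, m3]

end TightMatching
section MatchingPolytope
universe u
variable {U : Type u} [Fintype U] [DecidableEq U]

/-- A cost function on pairs as a function on unordered pairs. -/
noncomputable def symCost (c : U → U → ℝ) : Sym2 U → ℝ :=
  Sym2.lift ⟨fun a b => (c a b + c b a) / 2, fun a b => by ring⟩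

lemma symCost_mk {c : U → U → ℝ} (hc : ∀ a b, c a b = c b a) (a b : U) :
    symCost c s(a, b) = c a b := by
  simp [symCost, hc b a]

lemma ecut_linear {E : Type*} [Fintype E] (a b : E → U) (z₁ z₂ : E → ℝ) (p q : ℝ) (S : Finset U) :
    ecut a b (fun e => p * z₁ e + q * z₂ e) S = p * ecut a b z₁ S + q * ecut a b z₂ S := by
  unfold ecut
  rw [Finset.mul_sum, Finset.mul_sum, ← Finset.sum_add_distrib]
  refine Finset.sum_congr rfl fun e _ => ?_
  split_ifs <;> ring

lemma ecut_prod (w : U → U → ℝ) (hs : ∀ a b, w a b = w b a) (S : Finset U) :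
    ecut (Prod.fst : U × U → U) Prod.snd (fun e => if e.1 = e.2 then 0 else w e.1 e.2 / 2) S =
      wcut w S := by
  have h1 : ecut (Prod.fst : U × U → U) Prod.snd
      (fun e => if e.1 = e.2 then 0 else w e.1 e.2 / 2) S = wcut w S / 2 + wcut w Sᶜ / 2 := by
    unfold ecut wcut
    rw [Fintype.sum_prod_type, Finset.sum_div, Finset.sum_div, ← Finset.sum_add_distrib]
    refine Finset.sum_congr rfl fun a _ => ?_
    rw [Finset.sum_div, Finset.sum_div, ← Finset.sum_add_distrib]
    refine Finset.sum_congr rfl fun b _ => ?_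
    by_cases h1 : a ∈ S <;> by_cases h2 : b ∈ S <;> simp [h1, h2]
    · rintro rfl; exact absurd h1 h2
    · rintro rfl; exact absurd h2 h1
  rw [h1, wcut_compl hs]; ring

/-- The perfect matching polytope, over all ordered pairs. -/
def matchingPolytope (U : Type u) [Fintype U] [DecidableEq U] : Set (U × U → ℝ) :=
  {z | (∀ e, 0 ≤ z e) ∧ (∀ e, e.1 = e.2 → z e = 0) ∧
    (∀ v, ecut Prod.fst Prod.snd z {v} = 1) ∧
    ∀ S : Finset U, Odd S.card → 1 ≤ ecut Prod.fst Prod.snd z S}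

lemma continuous_ecut {E : Type*} [Fintype E] (a b : E → U) (S : Finset U) :
    Continuous fun z : E → ℝ => ecut a b z S := by
  unfold ecut
  refine continuous_finsetSum _ fun e _ => ?_
  split_ifs
  exacts [continuous_const, continuous_apply e]

lemma isCompact_matchingPolytope : IsCompact (matchingPolytope U) := by
  refine (isCompact_univ_pi (fun _ : U × U => isCompact_Icc (a := (0 : ℝ)) (b := 1))).of_isClosed_subset
    ?_ ?_
  · have e1 : IsClosed {z : U × U → ℝ | ∀ e, 0 ≤ z e} := by
      simp only [Set.ofPred_forall]
      exact isClosed_iInter fun e => isClosed_le continuous_const (continuous_apply e)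
    have e2 : IsClosed {z : U × U → ℝ | ∀ e : U × U, e.1 = e.2 → z e = 0} := by
      simp only [Set.ofPred_forall]
      exact isClosed_iInter fun e => isClosed_iInter fun _ =>
        isClosed_eq (continuous_apply e) continuous_const
    have e3 : IsClosed {z : U × U → ℝ | ∀ v, ecut Prod.fst Prod.snd z {v} = 1} := by
      simp only [Set.ofPred_forall]
      exact isClosed_iInter fun v => isClosed_eq (continuous_ecut _ _ _) continuous_const
    have e4 : IsClosed {z : U × U → ℝ | ∀ S : Finset U, Odd S.card →
        1 ≤ ecut Prod.fst Prod.snd z S} := by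
      simp only [Set.ofPred_forall]
      exact isClosed_iInter fun S => isClosed_iInter fun _ =>
        isClosed_le continuous_const (continuous_ecut _ _ _)
    exact e1.inter (e2.inter (e3.inter e4))
  · rintro z ⟨h1, h2, h3, -⟩ e -
    refine ⟨h1 e, ?_⟩
    by_cases he : e.1 = e.2
    · rw [h2 e he]; exact zero_le_one
    · rw [← h3 e.1]
      unfold ecut
      refine le_trans (le_of_eq ?_) (Finset.single_le_sum (fun e' _ => ?_) (Finset.mem_univ e))
      · simp [Ne.symm he]
      · split_ifs
        exacts [le_rfl, h1 e']

theorem exists_matching_le (hcard : Even (Fintype.card U)) {z : U × U → ℝ}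
    (hz : z ∈ matchingPolytope U) (κ : U × U → ℝ) :
    ∃ M : Finset (U × U), (∀ e ∈ M, e.1 ≠ e.2) ∧
      (∀ v, ecut Prod.fst Prod.snd (ind M) {v} = 1) ∧ ∑ e ∈ M, κ e ≤ ∑ e, κ e * z e := by
  classical
  rcases isEmpty_or_nonempty U with hU | ⟨⟨u⟩⟩
  · exact ⟨∅, by simp, fun v => (hU.false v).elim, by simp⟩
  obtain ⟨y, hy, hmin⟩ := isCompact_matchingPolytope.exists_isMinOn ⟨z, hz⟩
    (f := fun z => ∑ e, κ e * z e) (by fun_prop)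
  obtain ⟨y1, y2, y3, y4⟩ := hy
  have hex : ∃ e₀, 0 < y e₀ ∧ e₀.1 ≠ e₀.2 := by
    by_contra! hcon
    have h := y3 u
    have : ecut Prod.fst Prod.snd y {u} = 0 := by
      refine Finset.sum_eq_zero fun e _ => ?_
      split_ifs with h
      · rfl
      · by_contra hne
        exact h (by rw [hcon e (lt_of_le_of_ne (y1 e) (Ne.symm hne))])
    rw [this] at h
    exact zero_ne_one h
  obtain ⟨e₀, p0, q0⟩ := hex
  obtain ⟨M, m1, m2, m3⟩ := hasTightMatching _ U Prod.fst Prod.snd rfl hcard y1 y3 y4 e₀ p0 q0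
  have hdegM : ∀ v, ecut Prod.fst Prod.snd (ind M) {v} = 1 := fun v => m3 {v} (by simp) (y3 v)
  refine ⟨M, fun e he => (m2 e he).2, hdegM, ?_⟩
  refine le_trans ?_ (hmin hz)
  change ∑ e ∈ M, κ e ≤ ∑ e, κ e * y e
  have hκ : ∑ e ∈ M, κ e = ∑ e, κ e * ind M e := by
    simp [ind]
  rw [hκ]
  by_contra! hlt
  let g : ℝ → U × U → ℝ := fun ε e => (1 + ε) * y e + (-ε) * ind M e
  have hev : ∀ᶠ ε in nhdsWithin (0 : ℝ) (Set.Ioi 0), g ε ∈ matchingPolytope U := by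
    have k1 : ∀ᶠ ε in nhdsWithin (0 : ℝ) (Set.Ioi 0), ∀ e, 0 ≤ g ε e := by
      rw [Filter.eventually_all]
      intro e
      by_cases he : e ∈ M
      · have hc : Filter.Tendsto (fun ε => g ε e) (nhdsWithin 0 (Set.Ioi 0)) (nhds (y e)) := by
          have : Continuous fun ε => g ε e := by fun_prop
          have h := (this.tendsto 0).mono_left (nhdsWithin_le_nhds (s := Set.Ioi 0))
          simpa [g] using h
        exact (hc.eventually (lt_mem_nhds (m2 e he).1)).mono fun ε h => h.le
      · filter_upwards [self_mem_nhdsWithin] with ε hε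
        simp only [g, ind, he, if_false, mul_zero, add_zero]
        exact mul_nonneg (by linarith [Set.mem_Ioi.1 hε]) (y1 e)
    have k4 : ∀ᶠ ε in nhdsWithin (0 : ℝ) (Set.Ioi 0), ∀ S : Finset U, Odd S.card →
        1 ≤ ecut Prod.fst Prod.snd (g ε) S := by
      rw [Filter.eventually_all]
      intro S
      by_cases hS : Odd S.card
      · rcases (y4 S hS).eq_or_lt with h | h
        · refine Filter.Eventually.of_forall fun ε _ => ?_
          rw [ecut_linear, m3 S hS h.symm, ← h]
          linarith
        · have hc : Filter.Tendsto (fun ε => ecut Prod.fst Prod.snd (g ε) S)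
              (nhdsWithin 0 (Set.Ioi 0)) (nhds (ecut Prod.fst Prod.snd y S)) := by
            have : Continuous fun ε => ecut Prod.fst Prod.snd (g ε) S := by
              simp only [g, ecut_linear]
              fun_prop
            have h := (this.tendsto 0).mono_left (nhdsWithin_le_nhds (s := Set.Ioi 0))
            simpa [g] using h
          exact (hc.eventually (lt_mem_nhds h)).mono fun ε h _ => h.le
      · exact Filter.Eventually.of_forall fun ε h => absurd h hS
    filter_upwards [k1, k4] with ε h1 h4
    refine ⟨h1, ?_, ?_, h4⟩
    · intro e he
      have : e ∉ M := fun h => (m2 e h).2 he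
      simp [g, ind, this, y2 e he]
    · intro v
      rw [ecut_linear, y3, hdegM]; ring
  obtain ⟨ε, hε, hpos⟩ := (hev.and self_mem_nhdsWithin).exists
  have hle := hmin hε
  change ∑ e, κ e * y e ≤ ∑ e, κ e * g ε e at hle
  have : ∑ e, κ e * g ε e = (1 + ε) * ∑ e, κ e * y e + (-ε) * ∑ e, κ e * ind M e := by
    rw [Finset.mul_sum, Finset.mul_sum, ← Finset.sum_add_distrib]
    refine Finset.sum_congr rfl fun e _ => ?_
    simp only [g]; ring
  rw [this] at hle
  have hpos' : 0 < ε := hpos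
  nlinarith

/-- A complete graph whose odd cuts have weight at least one and whose degrees are at most one
has a perfect matching of cost at most its own cost. -/
theorem exists_sym2_matching_le (hcard : Even (Fintype.card U)) {c w : U → U → ℝ}
    (hc : IsPseudoMetric c) (hw : ∀ a b, 0 ≤ w a b) (hs : ∀ a b, w a b = w b a)
    (hdeg : ∀ v, wcut w {v} ≤ 1) (hodd : ∀ S : Finset U, Odd S.card → 1 ≤ wcut w S) :
    ∃ M : Finset (Sym2 U), (∀ e ∈ M, ¬ e.IsDiag) ∧ (∀ v, (M.filter (v ∈ ·)).card = 1) ∧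
      2 * ∑ e ∈ M, symCost c e ≤ pairCost c w := by
  obtain ⟨M, m1, m2, m3⟩ := exists_matching_le hcard
    (z := fun e => if e.1 = e.2 then 0 else w e.1 e.2 / 2) (by
      refine ⟨?_, ?_, ?_, ?_⟩
      · intro e
        dsimp only
        split_ifs
        exacts [le_rfl, div_nonneg (hw _ _) zero_le_two]
      · intro e he
        simp [he]
      · intro v
        rw [ecut_prod w hs]
        exact le_antisymm (hdeg v) (hodd _ (by simp))
      · intro S hS
        rw [ecut_prod w hs]
        exact hodd S hS) (fun e => c e.1 e.2)
  have hinj : Set.InjOn (fun e : U × U => s(e.1, e.2)) M := by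
    intro e he f hf hef
    obtain ⟨k, -, -, hk⟩ := exists_unique_crossing (m2 e.1)
    have e1 := hk e he (by simpa using (m1 e he).symm)
    have hd := m1 e he
    have e2 := hk f hf (by
      simp only [Finset.mem_singleton]
      rcases Sym2.eq_iff.1 hef with ⟨h, h'⟩ | ⟨h, h'⟩ <;> rw [← h, ← h'] <;> simp [hd.symm])
    rw [e1, e2]
  refine ⟨M.image fun e => s(e.1, e.2), ?_, ?_, ?_⟩
  · intro e he
    obtain ⟨f, hf, rfl⟩ := Finset.mem_image.1 he
    simpa using m1 f hf
  · intro v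
    have h := m2 v
    rw [ecut_ind] at h
    rw [Finset.filter_image, Finset.card_image_of_injOn]
    · rw [← (by exact_mod_cast h : (M.filter fun e => ¬ (e.1 ∈ ({v} : Finset U) ↔
        e.2 ∈ ({v} : Finset U))).card = 1)]
      congr 1
      refine Finset.filter_congr fun e he => ?_
      have := m1 e he
      simp only [Sym2.mem_iff, Finset.mem_singleton]
      constructor
      · rintro (rfl | rfl) <;> simp [this, this.symm]
      · intro h; by_contra! hcon
        exact h ⟨fun h => absurd h.symm hcon.1, fun h => absurd h.symm hcon.2⟩
    · exact hinj.mono (by intro e he; exact (Finset.mem_filter.1 he).1)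
  · rw [Finset.sum_image hinj]
    have e1 : ∑ e ∈ M, symCost c s(e.1, e.2) = ∑ e ∈ M, c e.1 e.2 :=
      Finset.sum_congr rfl fun e _ => symCost_mk hc.symm _ _
    rw [e1]
    have e2 : 2 * ∑ e : U × U, c e.1 e.2 * (if e.1 = e.2 then 0 else w e.1 e.2 / 2) =
        pairCost c w := by
      unfold pairCost
      rw [Fintype.sum_prod_type, Finset.mul_sum]
      refine Finset.sum_congr rfl fun a _ => ?_
      rw [Finset.mul_sum]
      refine Finset.sum_congr rfl fun b _ => ?_
      by_cases h : a = b
      · simp [h, hc.self]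
      · simp only [h, if_false]; ring
    linarith

end MatchingPolytope
section TJoin
universe u
variable {V : Type u} [Fintype V] [DecidableEq V]

lemma requirement_odd {D : Finset V} (hD : Even D.card) {v : V} (hv : v ∉ D) :
    Requirement v fun X => if Odd (X ∩ D).card then 1 else 0 := by
  have hun : ∀ X Y : Finset V, ((X ∩ Y) ∩ D).card + ((X ∪ Y) ∩ D).card =
      (X ∩ D).card + (Y ∩ D).card := by
    intro X Y
    rw [Finset.inter_inter_distrib_right, Finset.union_inter_distrib_right,
      Finset.card_inter_add_card_union]
  have hsd : ∀ X Y : Finset V, ((X \ Y) ∩ D).card + ((X ∩ Y) ∩ D).card = (X ∩ D).card := by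
    intro X Y
    rw [← Finset.card_union_of_disjoint, ← Finset.union_inter_distrib_right, Finset.sdiff_union_inter]
    rw [Finset.disjoint_left]
    intro a h1 h2
    simp only [Finset.mem_inter, Finset.mem_sdiff] at h1 h2
    exact h1.1.2 h2.1.2
  constructor
  · intro X _
    have h1 : (insert v X)ᶜ ∩ D = D \ X := by
      ext a
      simp only [Finset.mem_inter, Finset.mem_compl, Finset.mem_insert, Finset.mem_sdiff, not_or]
      constructor
      · rintro ⟨⟨_, h⟩, h'⟩; exact ⟨h', h⟩
      · rintro ⟨h, h'⟩; exact ⟨⟨fun e => hv (e ▸ h), h'⟩, h⟩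
    have h2 := Finset.card_sdiff_add_card_inter D X
    rw [h1]
    congr 1
    rw [Finset.inter_comm, Nat.odd_iff, Nat.odd_iff]
    rw [Nat.even_iff] at hD
    rw [eq_iff_iff]
    omega
  · intro X Y _ _
    have e1 := hun X Y
    have e2 := hsd X Y
    have e3 := hsd Y X
    rw [Finset.inter_comm Y X] at e3
    simp only [Nat.odd_iff]
    by_cases h1 : (X ∩ D).card % 2 = 1 <;> by_cases h2 : (Y ∩ D).card % 2 = 1
    · by_cases h3 : ((X ∩ Y) ∩ D).card % 2 = 1
      · left
        have : ((X ∪ Y) ∩ D).card % 2 = 1 := by omega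
        rw [if_pos h1, if_pos h2, if_pos h3, if_pos this]
      · right
        have p1 : ((X \ Y) ∩ D).card % 2 = 1 := by omega
        have p2 : ((Y \ X) ∩ D).card % 2 = 1 := by omega
        simp only [h1, h2, p1, p2]; norm_num
    · left
      by_cases h3 : ((X ∩ Y) ∩ D).card % 2 = 1
      · rw [if_pos h1, if_neg h2, if_pos h3]; split_ifs <;> simp
      · have : ((X ∪ Y) ∩ D).card % 2 = 1 := by omega
        rw [if_pos h1, if_neg h2, if_neg h3, if_pos this]; simp
    · left
      by_cases h3 : ((X ∩ Y) ∩ D).card % 2 = 1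
      · rw [if_neg h1, if_pos h2, if_pos h3]; split_ifs <;> simp
      · have : ((X ∪ Y) ∩ D).card % 2 = 1 := by omega
        rw [if_neg h1, if_pos h2, if_neg h3, if_pos this]
    · left
      rw [if_neg h1, if_neg h2]
      split_ifs <;> norm_num

/-- Splitting off all vertices of `N` while keeping all `D`-odd cuts above one. -/
lemma exists_split_nonterminals {D : Finset V} (hD : Even D.card) {c w : V → V → ℝ}
    (hc : IsPseudoMetric c) (hw : ∀ a b, 0 ≤ w a b) (hs : ∀ a b, w a b = w b a)
    (hcut : ∀ X : Finset V, Odd (X ∩ D).card → 1 ≤ wcut w X) (N : Finset V) (hN : Disjoint N D) :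
    ∃ w' : V → V → ℝ, (∀ a b, 0 ≤ w' a b) ∧ (∀ a b, w' a b = w' b a) ∧
      (∀ X : Finset V, Odd (X ∩ D).card → 1 ≤ wcut w' X) ∧ (∀ a ∈ N, ∀ b, w' a b = 0) ∧
      (∀ a ∈ D, wcut w' {a} ≤ wcut w {a}) ∧ pairCost c w' ≤ pairCost c w := by
  induction N using Finset.induction_on with
  | empty => exact ⟨w, hw, hs, hcut, by simp, fun _ _ => le_rfl, le_rfl⟩
  | insert v N hvN ih =>
    rw [Finset.disjoint_insert_left] at hN
    obtain ⟨w₁, p1, p2, p3, p4, p5, p6⟩ := ih hN.2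
    obtain ⟨s, s1, s2, s3, s4⟩ := exists_splitting (requirement_odd hD hN.1) p1 p2 (by
      intro X _
      split_ifs with h
      exacts [p3 X h, wcut_nonneg p1 X])
    have hsym := splitWeight_symm (v := v) (s := s) p2
    refine ⟨splitWeight v w₁ s, splitWeight_nonneg p1 s1 s3, hsym, ?_, ?_, ?_, ?_⟩
    · have key : ∀ X : Finset V, v ∉ X → Odd (X ∩ D).card → 1 ≤ wcut (splitWeight v w₁ s) X := by
        intro X hX ho
        have := s4 X hX
        rw [if_pos ho] at this
        rwa [wcut_splitWeight p2 s2 hX]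
      intro X ho
      by_cases hX : v ∈ X
      · rw [← wcut_compl hsym]
        refine key _ (by simpa using hX) ?_
        have h1 : Xᶜ ∩ D = D \ X := by ext; simp [and_comm]
        have h2 := Finset.card_sdiff_add_card_inter D X
        rw [h1]
        rw [Finset.inter_comm] at ho
        rw [Nat.odd_iff] at *; rw [Nat.even_iff] at hD; omega
      · exact key X hX ho
    · intro a ha b
      rcases Finset.mem_insert.1 ha with rfl | ha
      · exact splitWeight_eq_zero s3 (Or.inl rfl)
      · exact splitWeight_eq_zero_of_isolated p2 s1 s3 (p4 a ha) b
    · intro a ha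
      have hav : v ∉ ({a} : Finset V) := by
        rw [Finset.mem_singleton]; rintro rfl; exact hN.1 ha
      rw [wcut_splitWeight p2 s2 hav]
      have := p5 a ha
      have := s1 a a
      simp only [Finset.sum_singleton]
      linarith
    · exact (pairCost_splitWeight_le hc p2 s1 s2 s3).trans p6

/-- Every fractional `T`-join dominates the cost of a matching of `T`. -/
theorem exists_tjoin {T : Finset V} (hT : Even T.card) {c z : V → V → ℝ}
    (hc : IsPseudoMetric c) (hz : ∀ a b, 0 ≤ z a b) (hs : ∀ a b, z a b = z b a)
    (hcut : ∀ S : Finset V, Odd (S ∩ T).card → 1 ≤ wcut z S) :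
    ∃ M : Finset (Sym2 V), (∀ e ∈ M, ¬ e.IsDiag) ∧
      (∀ v, Odd (M.filter (v ∈ ·)).card ↔ v ∈ T) ∧ 2 * ∑ e ∈ M, symCost c e ≤ pairCost c z := by
  let q : V ⊕ {t // t ∈ T} → V := Sum.elim id Subtype.val
  let w : V ⊕ {t // t ∈ T} → V ⊕ {t // t ∈ T} → ℝ := fun a b =>
    match a, b with
    | .inl a, .inl b => z a b
    | .inl a, .inr t => if a = t then 1 else 0
    | .inr t, .inl a => if a = t then 1 else 0
    | .inr _, .inr _ => 0
  let c' : V ⊕ {t // t ∈ T} → V ⊕ {t // t ∈ T} → ℝ := fun a b => c (q a) (q b)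
  let D : Finset (V ⊕ {t // t ∈ T}) := Finset.univ.map Function.Embedding.inr
  let N : Finset (V ⊕ {t // t ∈ T}) := Finset.univ.map Function.Embedding.inl
  have hw : ∀ a b, 0 ≤ w a b := by
    rintro (a | a) (b | b)
    · exact hz a b
    · simp only [w]; split_ifs <;> norm_num
    · simp only [w]; split_ifs <;> norm_num
    · simp [w]
  have hws : ∀ a b, w a b = w b a := by
    rintro (a | a) (b | b)
    · exact hs a b
    · rfl
    · rfl
    · rfl
  have hc' : IsPseudoMetric c' :=
    ⟨fun _ _ => hc.nonneg _ _, fun _ _ => hc.symm _ _, fun _ => hc.self _, fun _ _ _ => hc.tri _ _ _⟩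
  have hDc : Even D.card := by simpa [D] using hT
  have hpc : pairCost c' w = pairCost c z := by
    unfold pairCost
    have h : ∀ (a : V) (t : {t // t ∈ T}), (if a = t then c a t else 0) = 0 := by
      intro a t
      split_ifs with h
      exacts [h ▸ hc.self a, rfl]
    have h' : ∀ (a : V) (t : {t // t ∈ T}), (if a = t then c t a else 0) = 0 := by
      intro a t
      rw [hc.symm, h]
    simp [Fintype.sum_sum_type, c', w, q, h, h']
  have hwcut : ∀ X, Odd (X ∩ D).card → 1 ≤ wcut w X := by
    intro X hX
    by_cases hsep : ∃ t : {t // t ∈ T}, ¬ (Sum.inr t ∈ X ↔ Sum.inl (t : V) ∈ X)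
    · obtain ⟨t, ht⟩ := hsep
      have key : ∀ X : Finset (V ⊕ {t // t ∈ T}), Sum.inr t ∈ X → Sum.inl (t : V) ∉ X →
          1 ≤ wcut w X := by
        intro X h1 h2
        have hnn : ∀ a b, 0 ≤ if a ∈ X ∧ b ∉ X then w a b else 0 := by
          intro a b; split_ifs; exacts [hw a b, le_rfl]
        unfold wcut
        refine le_trans (le_trans (le_of_eq ?_) (Finset.single_le_sum (fun b _ => hnn (Sum.inr t) b)
          (Finset.mem_univ (Sum.inl (t : V))))) (Finset.single_le_sum (f := fun a => ∑ b, if a ∈ X ∧ b ∉ X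
          then w a b else 0) (fun a _ => Finset.sum_nonneg fun b _ => hnn a b)
          (Finset.mem_univ (Sum.inr t)))
        simp [h1, h2, w]
      by_cases h1 : Sum.inr t ∈ X
      · exact key X h1 (by tauto)
      · rw [← wcut_compl hws]
        refine key _ (by simpa using h1) (by simp only [Finset.mem_compl]; tauto)
    · push Not at hsep
      let S : Finset V := Finset.univ.filter fun a => Sum.inl a ∈ X
      have hST : (S ∩ T).card = (X ∩ D).card := by
        refine Finset.card_bij (fun a ha => Sum.inr ⟨a, (Finset.mem_inter.1 ha).2⟩) ?_ ?_ ?_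
        · intro a ha
          have ha' := Finset.mem_inter.1 ha
          simp only [D, Finset.mem_inter, Finset.mem_map, Finset.mem_univ, true_and]
          refine ⟨(hsep _).2 ?_, _, rfl⟩
          simpa [S] using ha'.1
        · intro a ha b hb hab
          simpa using hab
        · intro t ht
          simp only [D, Finset.mem_inter, Finset.mem_map, Finset.mem_univ, true_and] at ht
          obtain ⟨h1, t', rfl⟩ := ht
          refine ⟨t', ?_, rfl⟩
          simp only [S, Finset.mem_inter, Finset.mem_filter, Finset.mem_univ, true_and]
          exact ⟨(hsep t').1 h1, t'.2⟩
      refine (hcut S (hST ▸ hX)).trans ?_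
      unfold wcut
      rw [Fintype.sum_sum_type]
      have h2 : 0 ≤ ∑ t : {t // t ∈ T}, ∑ b, if Sum.inr t ∈ X ∧ b ∉ X then w (Sum.inr t) b else 0 := by
        refine Finset.sum_nonneg fun a _ => Finset.sum_nonneg fun b _ => ?_
        split_ifs; exacts [hw _ b, le_rfl]
      refine le_add_of_le_of_nonneg ?_ h2
      refine Finset.sum_le_sum fun a _ => ?_
      rw [Fintype.sum_sum_type]
      refine le_add_of_le_of_nonneg (le_of_eq ?_) ?_
      · simp [S, w]
      · refine Finset.sum_nonneg fun b _ => ?_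
        split_ifs; exacts [hw (Sum.inl a) (Sum.inr b), le_rfl]
  obtain ⟨w', p1, p2, p3, p4, p5, p6⟩ := exists_split_nonterminals hDc hc' hw hws hwcut N (by
    rw [Finset.disjoint_left]
    intro a h1 h2
    simp only [N, D, Finset.mem_map, Finset.mem_univ, true_and] at h1 h2
    obtain ⟨b, rfl⟩ := h1
    obtain ⟨t, h⟩ := h2
    cases h)
  have hzl : ∀ a b, w' (Sum.inl a) b = 0 := fun a b => p4 _ (by simp [N]) b
  have hzr : ∀ a b, w' b (Sum.inl a) = 0 := fun a b => by rw [p2, hzl]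
  let w₂ : {t // t ∈ T} → {t // t ∈ T} → ℝ := fun a b => w' (Sum.inr a) (Sum.inr b)
  have hcut2 : ∀ S, wcut w₂ S = wcut w' (S.map Function.Embedding.inr) := by
    intro S
    have hm : ∀ t : {t // t ∈ T}, Sum.inr t ∈ S.map (Function.Embedding.inr (α := V)) ↔ t ∈ S :=
      fun t => Finset.mem_map' Function.Embedding.inr
    unfold wcut
    simp [-Finset.mem_map, Fintype.sum_sum_type, w₂, hzl, hzr, hm]
  obtain ⟨M, m1, m2, m3⟩ := exists_sym2_matching_le (U := {t // t ∈ T}) (c := fun a b => c (a : V) b) (w := w₂) (by simpa using hT)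
    ⟨fun _ _ => hc.nonneg _ _, fun _ _ => hc.symm _ _, fun _ => hc.self _, fun _ _ _ => hc.tri _ _ _⟩
    (fun a b => p1 _ _) (fun a b => p2 _ _) (by
      intro t
      rw [hcut2, Finset.map_singleton]
      refine (p5 _ (by simp [D])).trans (le_of_eq ?_)
      rw [Function.Embedding.inr_apply, wcut_singleton]
      simp [Fintype.sum_sum_type, w]) (by
      intro S hS
      rw [hcut2]
      refine p3 _ ?_
      have : S.map Function.Embedding.inr ∩ D = S.map Function.Embedding.inr :=
        Finset.inter_eq_left.2 (Finset.map_subset_map.2 (Finset.subset_univ S))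
      rw [this, Finset.card_map]
      exact hS)
  have hinj : Function.Injective (Sym2.map (Subtype.val : {t // t ∈ T} → V)) :=
    Sym2.map.injective Subtype.val_injective
  refine ⟨M.map ⟨_, hinj⟩, ?_, ?_, ?_⟩
  · intro e he
    obtain ⟨f, hf, rfl⟩ := Finset.mem_map.1 he
    have h := m1 f hf
    induction f with | _ a b =>
    rw [Sym2.mk_isDiag_iff] at h
    intro h'
    exact h (Subtype.ext h')
  · intro v
    rw [Finset.filter_map, Finset.card_map]
    by_cases hv : v ∈ T
    · have : (M.filter ((v ∈ ·) ∘ (⟨_, hinj⟩ : Sym2 {t // t ∈ T} ↪ Sym2 V))) =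
          M.filter ((⟨v, hv⟩ : {t // t ∈ T}) ∈ ·) := by
        refine Finset.filter_congr fun e _ => ?_
        simp [Sym2.mem_map, hv]
      rw [this, m2]
      simp [hv]
    · have : (M.filter ((v ∈ ·) ∘ (⟨_, hinj⟩ : Sym2 {t // t ∈ T} ↪ Sym2 V))) = ∅ := by
        refine Finset.filter_eq_empty_iff.2 fun e _ => ?_
        simp only [Function.comp_apply, Function.Embedding.coeFn_mk, Sym2.mem_map, not_exists, not_and]
        rintro t - rfl
        exact hv t.2
      rw [this]
      simp [hv]
  · rw [← hpc, Finset.sum_map]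
    refine le_trans (le_trans (le_of_eq ?_) (m3.trans (le_of_eq ?_))) p6
    · congr 1
      refine Finset.sum_congr rfl fun e _ => ?_
      induction e with | _ a b =>
      simp [symCost]
    · unfold pairCost
      simp [Fintype.sum_sum_type, hzl, hzr, c', q, w₂]

end TJoin
section Euler
variable {V : Type*} [Fintype V] [DecidableEq V]

/-- The multiset of edges of the walk that starts at `a` and then visits the list. -/
def walkEdges (a : V) : List V → Multiset (Sym2 V)
  | [] => 0
  | b :: l => s(a, b) ::ₘ walkEdges b l

/-- The last vertex of the walk that starts at `a` and then visits the list. -/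
def walkEnd (a : V) : List V → V
  | [] => a
  | b :: l => walkEnd b l

lemma walkEnd_append (a : V) (l₁ l₂ : List V) :
    walkEnd a (l₁ ++ l₂) = walkEnd (walkEnd a l₁) l₂ := by
  induction l₁ generalizing a with
  | nil => rfl
  | cons b l ih => exact ih b

lemma walkEdges_append (a : V) (l₁ l₂ : List V) :
    walkEdges a (l₁ ++ l₂) = walkEdges a l₁ + walkEdges (walkEnd a l₁) l₂ := by
  induction l₁ generalizing a with
  | nil => simp [walkEdges, walkEnd]
  | cons b l ih => simp [walkEdges, walkEnd, ih b]

lemma mem_of_mem_walkEdges {a v : V} {l : List V} {e : Sym2 V} (he : e ∈ walkEdges a l)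
    (hv : v ∈ e) : v = a ∨ v ∈ l := by
  induction l generalizing a with
  | nil => simp [walkEdges] at he
  | cons b l ih =>
    rcases Multiset.mem_cons.1 he with rfl | h
    · rcases Sym2.mem_iff.1 hv with rfl | rfl <;> simp
    · rcases ih h with rfl | h' <;> simp [*]

lemma exists_append_of_mem {a p : V} {l : List V} (hp : p = a ∨ p ∈ l) :
    ∃ l₁ l₂, l = l₁ ++ l₂ ∧ walkEnd a l₁ = p := by
  induction l generalizing a with
  | nil => exact ⟨[], [], rfl, by simpa [walkEnd, eq_comm] using hp⟩
  | cons b l ih =>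
    rcases hp with rfl | hp
    · exact ⟨[], b :: l, rfl, rfl⟩
    · obtain ⟨l₁, l₂, h1, h2⟩ := ih (List.mem_cons.1 hp)
      exact ⟨b :: l₁, l₂, by simp [h1], h2⟩

/-- The degree of a vertex in a loopless multigraph. -/
def mdeg (G : Multiset (Sym2 V)) (v : V) : ℕ := G.countP (v ∈ ·)

lemma mdeg_cons {a b : V} (hab : a ≠ b) (G : Multiset (Sym2 V)) (v : V) :
    mdeg (s(a, b) ::ₘ G) v = mdeg G v + ((if v = a then 1 else 0) + if v = b then 1 else 0) := by
  unfold mdeg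
  rw [Multiset.countP_cons]
  congr 1
  by_cases h1 : v = a <;> by_cases h2 : v = b
  · exact absurd (h1.symm.trans h2) hab
  all_goals simp [h1, h2, hab, hab.symm]

lemma mdeg_walkEdges {a : V} {l : List V} (h : ∀ e ∈ walkEdges a l, ¬ e.IsDiag) (v : V) :
    Even (mdeg (walkEdges a l) v + ((if v = a then 1 else 0) + if v = walkEnd a l then 1 else 0)) := by
  induction l generalizing a with
  | nil =>
    simp only [walkEdges, walkEnd, mdeg, Multiset.countP_zero, zero_add]
    exact ⟨_, rfl⟩
  | cons b l ih =>
    have hab : a ≠ b := by simpa using h s(a, b) (by simp [walkEdges])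
    have := ih (a := b) fun e he => h e (by simp [walkEdges, he])
    rw [walkEdges, mdeg_cons hab, walkEnd]
    rw [Nat.even_iff] at *
    omega

lemma exists_trail (n : ℕ) : ∀ (G : Multiset (Sym2 V)), G.card = n → (∀ e ∈ G, ¬ e.IsDiag) →
    ∀ a b : V, a ≠ b → (∀ v, Odd (mdeg G v) ↔ v = a ∨ v = b) →
    ∃ l, walkEdges a l ≤ G ∧ walkEnd a l = b := by
  induction n with
  | zero =>
    intro G hG _ a b _ h
    rw [Multiset.card_eq_zero] at hG
    subst hG
    have := (h a).2 (Or.inl rfl)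
    simp [mdeg] at this
  | succ n ih =>
    intro G hG hd a b hab h
    have ha := ((h a).2 (Or.inl rfl)).pos
    obtain ⟨e, he, hae⟩ := Multiset.countP_pos.1 ha
    obtain ⟨c, rfl⟩ := hae
    have hac : a ≠ c := by simpa using hd _ he
    obtain ⟨G', rfl⟩ := Multiset.exists_cons_of_mem he
    by_cases hcb : c = b
    · subst hcb
      exact ⟨[c], by simp [walkEdges], rfl⟩
    · obtain ⟨l, h1, h2⟩ := ih G' (by simpa using hG) (fun e he => hd e (by simp [he])) c b hcb (by
        intro v
        have := h v
        rw [mdeg_cons hac] at this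
        rw [Nat.odd_iff] at *
        by_cases v1 : v = a <;> by_cases v2 : v = c <;> by_cases v3 : v = b <;>
          simp_all <;> omega)
      exact ⟨c :: l, by simpa [walkEdges] using h1, h2⟩

lemma exists_crossing_edge {G : Multiset (Sym2 V)} {r v : V} (S : Set V)
    (h : (SimpleGraph.fromEdgeSet {e | e ∈ G}).Reachable r v) (hr : r ∈ S) (hv : v ∉ S) :
    ∃ p q, p ∈ S ∧ q ∉ S ∧ s(p, q) ∈ G := by
  obtain ⟨w⟩ := h
  induction w with
  | nil => exact absurd hr hv
  | @cons a b d hab w ih =>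
    by_cases hb : b ∈ S
    · exact ih hb hv
    · rw [SimpleGraph.fromEdgeSet_adj] at hab
      exact ⟨a, b, hr, hb, hab.1⟩

theorem exists_closed_trail {G : Multiset (Sym2 V)} (hd : ∀ e ∈ G, ¬ e.IsDiag)
    (heven : ∀ v, Even (mdeg G v)) (r : V) :
    ∃ l, walkEdges r l ≤ G ∧ walkEnd r l = r ∧
      ∀ v, (SimpleGraph.fromEdgeSet {e | e ∈ G}).Reachable r v → v = r ∨ v ∈ l := by
  have hlen : ∀ (a : V) (l : List V), (walkEdges a l).card = l.length := by
    intro a l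
    induction l generalizing a with
    | nil => rfl
    | cons b l ih => simp [walkEdges, ih]
  have hmax : ∃ l, (walkEdges r l ≤ G ∧ walkEnd r l = r) ∧
      ∀ l', walkEdges r l' ≤ G ∧ walkEnd r l' = r → l'.length ≤ l.length := by
    let P : ℕ → Prop := fun n => ∃ l, (walkEdges r l ≤ G ∧ walkEnd r l = r) ∧ l.length = n
    classical
    have hb : ∀ n, P n → n ≤ G.card := by
      rintro n ⟨l, h, rfl⟩
      rw [← hlen r]
      exact Multiset.card_le_card h.1
    have h0 : P 0 := ⟨[], by simp [walkEdges, walkEnd], rfl⟩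
    obtain ⟨l, hl, hn⟩ := Nat.findGreatest_spec (P := P) (Nat.zero_le G.card) h0
    refine ⟨l, hl, fun l' hl' => ?_⟩
    rw [hn]
    exact Nat.le_findGreatest (hb _ ⟨l', hl', rfl⟩) ⟨l', hl', rfl⟩
  obtain ⟨l, ⟨h1, h2⟩, h3⟩ := hmax
  refine ⟨l, h1, h2, ?_⟩
  by_contra! hcon
  obtain ⟨v, hv, hvr, hvl⟩ := hcon
  obtain ⟨p, q, hp, hq, hpq⟩ := exists_crossing_edge {x | x = r ∨ x ∈ l} hv (Or.inl rfl)
    (by simp [hvr, hvl])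
  obtain ⟨H, rfl⟩ := Multiset.le_iff_exists_add.1 h1
  have hpqH : s(p, q) ∈ H := by
    rcases Multiset.mem_add.1 hpq with h | h
    · exact absurd (mem_of_mem_walkEdges h (Sym2.mem_mk_right p q)) hq
    · exact h
  have hne : p ≠ q := by simpa using hd _ hpq
  have hHeven : ∀ v, Even (mdeg H v) := by
    intro v
    have e1 := mdeg_walkEdges (a := r) (l := l) (fun e he => hd e (by simp [he])) v
    have e2 := heven v
    rw [h2] at e1
    unfold mdeg at *
    rw [Multiset.countP_add] at e2
    rw [Nat.even_iff] at *
    omega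
  obtain ⟨H', rfl⟩ := Multiset.exists_cons_of_mem hpqH
  obtain ⟨t, t1, t2⟩ := exists_trail _ H' rfl (fun e he => hd e (by simp [he])) q p hne.symm (by
    intro v
    have := hHeven v
    rw [mdeg_cons hne] at this
    rw [Nat.odd_iff]
    rw [Nat.even_iff] at this
    by_cases v1 : v = p <;> by_cases v2 : v = q <;> simp_all <;> omega)
  obtain ⟨l₁, l₂, rfl, hl⟩ := exists_append_of_mem hp
  rw [walkEnd_append, hl] at h2
  have := h3 (l₁ ++ (q :: t) ++ l₂) ⟨by
      rw [walkEdges_append, walkEdges_append, walkEdges_append, walkEnd_append, hl]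
      simp only [walkEdges, walkEnd, t2]
      rw [add_right_comm]
      exact add_le_add le_rfl (Multiset.cons_le_cons _ t1), by
      rw [walkEnd_append, walkEnd_append, hl]
      simp only [walkEnd, t2]
      exact h2⟩
  simp at this

variable {c : V → V → ℝ}

/-- The cost of the walk that starts at `a` and then visits the list. -/
def walkCost (c : V → V → ℝ) (a : V) : List V → ℝ
  | [] => 0
  | b :: l => c a b + walkCost c b l

lemma walkCost_eq (hs : ∀ a b, c a b = c b a) (a : V) (l : List V) :
    walkCost c a l = ((walkEdges a l).map (symCost c)).sum := by
  induction l generalizing a with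
  | nil => simp [walkCost, walkEdges]
  | cons b l ih => simp [walkCost, walkEdges, ih, symCost_mk hs]

lemma walkCost_append (a : V) (l₁ l₂ : List V) :
    walkCost c a (l₁ ++ l₂) = walkCost c a l₁ + walkCost c (walkEnd a l₁) l₂ := by
  induction l₁ generalizing a with
  | nil => simp [walkCost, walkEnd]
  | cons b l ih => simp [walkCost, walkEnd, ih b, add_assoc]

lemma walkCost_le_add (hc : IsPseudoMetric c) (a x : V) (l : List V) :
    walkCost c a l ≤ c a x + walkCost c x l := by
  cases l with
  | nil => simpa [walkCost] using hc.nonneg a x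
  | cons b l =>
    simp only [walkCost]
    linarith [hc.tri a x b]

lemma walkCost_le_of_sublist (hc : IsPseudoMetric c) {l₁ l₂ : List V} (h : l₁.Sublist l₂) (a b : V) :
    walkCost c a (l₁ ++ [b]) ≤ walkCost c a (l₂ ++ [b]) := by
  induction h generalizing a with
  | slnil => rfl
  | cons x h ih =>
    exact (walkCost_le_add hc a x _).trans (by simpa [walkCost] using ih x)
  | cons_cons x h ih => simpa [walkCost] using ih x

/-- An even multigraph contains, up to shortcutting, a tour through the component of `r`. -/
theorem exists_tour_of_even (hc : IsPseudoMetric c) {G : Multiset (Sym2 V)}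
    (hd : ∀ e ∈ G, ¬ e.IsDiag) (heven : ∀ v, Even (mdeg G v)) (r : V) :
    ∃ l : List V, (r :: l).Nodup ∧ walkCost c r (l ++ [r]) ≤ (G.map (symCost c)).sum ∧
      ∀ v, (SimpleGraph.fromEdgeSet {e | e ∈ G}).Reachable r v → v ∈ r :: l := by
  obtain ⟨l, h1, h2, h3⟩ := exists_closed_trail hd heven r
  refine ⟨(l.filter (· ≠ r)).dedup, ?_, ?_, ?_⟩
  · rw [List.nodup_cons]
    exact ⟨by simp, List.nodup_dedup _⟩
  · refine (walkCost_le_of_sublist hc ((List.dedup_sublist _).trans List.filter_sublist) r r).trans ?_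
    rw [walkCost_append, h2, walkCost_eq hc.symm]
    simp only [walkCost, hc.self, add_zero]
    obtain ⟨H, rfl⟩ := Multiset.le_iff_exists_add.1 h1
    rw [Multiset.map_add, Multiset.sum_add]
    refine le_add_of_nonneg_right (Multiset.sum_nonneg ?_)
    intro x hx
    obtain ⟨e, -, rfl⟩ := Multiset.mem_map.1 hx
    induction e with | _ a b =>
    rw [symCost_mk hc.symm]
    exact hc.nonneg a b
  · intro v hv
    by_cases hvr : v = r
    · simp [hvr]
    · have := (h3 v hv).resolve_left hvr
      simp [this, hvr]

end Euler
section Parity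
universe u
variable {V : Type u} [Fintype V] [DecidableEq V]

/-- The edge `e` has exactly one endpoint in `S`. -/
def Crosses (S : Finset V) (e : Sym2 V) : Prop := ∃ a ∈ S, ∃ b ∉ S, e = s(a, b)

lemma crosses_mk {S : Finset V} {a b : V} : Crosses S s(a, b) ↔ ¬ (a ∈ S ↔ b ∈ S) := by
  constructor
  · rintro ⟨p, hp, q, hq, h⟩
    rcases Sym2.eq_iff.1 h with ⟨rfl, rfl⟩ | ⟨rfl, rfl⟩ <;> tauto
  · intro h
    by_cases ha : a ∈ S
    · exact ⟨a, ha, b, by tauto, rfl⟩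
    · exact ⟨b, by tauto, a, ha, Sym2.eq_swap⟩

open scoped Classical in
lemma odd_card_inter_iff {E : Finset (Sym2 V)} (hE : ∀ e ∈ E, ¬ e.IsDiag) (S : Finset V) :
    Odd (S ∩ Finset.univ.filter fun v => Odd (E.filter (v ∈ ·)).card).card ↔
      Odd (E.filter (Crosses S)).card := by
  have h1 : S ∩ (Finset.univ.filter fun v => Odd (E.filter (v ∈ ·)).card) =
      S.filter fun v => Odd (E.filter (v ∈ ·)).card := by ext; simp
  rw [h1, ← Finset.odd_sum_iff_odd_card_odd]
  have h2 : ∑ v ∈ S, (E.filter (v ∈ ·)).card = ∑ e ∈ E, (S.filter (· ∈ e)).card := by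
    simp only [Finset.card_filter]
    rw [Finset.sum_comm]
  rw [h2, Finset.odd_sum_iff_odd_card_odd]
  have h3 : E.filter (fun e => Odd (S.filter (· ∈ e)).card) = E.filter (Crosses S) := by
    refine Finset.filter_congr fun e he => ?_
    have hd := hE e he
    induction e with | _ a b =>
    rw [Sym2.mk_isDiag_iff] at hd
    rw [crosses_mk]
    have h : S.filter (· ∈ s(a, b)) = (if a ∈ S then {a} else ∅) ∪ (if b ∈ S then {b} else ∅) := by
      ext v
      simp only [Finset.mem_filter, Sym2.mem_iff, Finset.mem_union]
      by_cases ha : a ∈ S <;> by_cases hb : b ∈ S <;> simp [ha, hb]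
      · rintro (rfl | rfl) <;> assumption
      · constructor
        · rintro ⟨h, rfl | rfl⟩ <;> simp_all
        · rintro rfl; simp [ha]
      · constructor
        · rintro ⟨h, rfl | rfl⟩ <;> simp_all
        · rintro rfl; simp [hb]
      · intro h; constructor <;> rintro rfl <;> contradiction
    rw [h]
    by_cases ha : a ∈ S <;> by_cases hb : b ∈ S <;> simp [ha, hb]
    rw [Finset.card_pair hd]
    decide
  rw [h3]

/-- A connected edge set together with a fractional parity correction yields a tour. -/
theorem exists_tour_of_parity_correction {E : Finset (Sym2 V)} (hE : ∀ e ∈ E, ¬ e.IsDiag)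
    {c z : V → V → ℝ} (hc : IsPseudoMetric c) (hz : ∀ a b, 0 ≤ z a b) (hs : ∀ a b, z a b = z b a)
    (r : V) (hcut : ∀ S : Finset V, r ∉ S → (∃ n, Odd n ∧ ∃ C : Finset (Sym2 V), C.card = n ∧
      ∀ e, e ∈ C ↔ e ∈ E ∧ Crosses S e) → 1 ≤ wcut z S) :
    ∃ l : List V, (r :: l).Nodup ∧
      walkCost c r (l ++ [r]) ≤ ∑ e ∈ E, symCost c e + pairCost c z / 2 ∧
      ∀ v, (SimpleGraph.fromEdgeSet (E : Set (Sym2 V))).Reachable r v → v ∈ r :: l := by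
  classical
  set T : Finset V := Finset.univ.filter fun v => Odd (E.filter (v ∈ ·)).card with hTdef
  have hcr : ∀ S : Finset V, ∀ e, Crosses Sᶜ e ↔ Crosses S e := by
    intro S e
    induction e with | _ a b =>
    rw [crosses_mk, crosses_mk]; simp only [Finset.mem_compl]; tauto
  have hTeven : Even T.card := by
    have h := odd_card_inter_iff hE Finset.univ
    rw [Finset.univ_inter, ← hTdef] at h
    rw [← Nat.not_odd_iff_even, h]
    have : E.filter (Crosses Finset.univ) = ∅ := by
      refine Finset.filter_eq_empty_iff.2 fun e _ => ?_
      rintro ⟨a, -, b, hb, -⟩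
      exact hb (Finset.mem_univ b)
    simp [this]
  obtain ⟨M, m1, m2, m3⟩ := exists_tjoin hTeven hc hz hs (by
    intro S hS
    rw [odd_card_inter_iff hE] at hS
    by_cases hr : r ∈ S
    · rw [← wcut_compl hs]
      exact hcut _ (by simpa using hr) ⟨_, hS, _, rfl, fun e => by simp [hcr]⟩
    · exact hcut S hr ⟨_, hS, _, rfl, fun e => by simp⟩)
  obtain ⟨l, l1, l2, l3⟩ := exists_tour_of_even hc (G := E.val + M.val) (by
      intro e he
      rcases Multiset.mem_add.1 he with h | h
      exacts [hE e h, m1 e h]) (by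
      intro v
      have h := m2 v
      have e1 : mdeg (E.val + M.val) v = (E.filter (v ∈ ·)).card + (M.filter (v ∈ ·)).card := by
        unfold mdeg
        rw [Multiset.countP_add, Multiset.countP_eq_card_filter, Multiset.countP_eq_card_filter]
        rfl
      rw [e1, Nat.even_add, ← not_iff_not, Nat.not_even_iff_odd, Nat.not_even_iff_odd, h]
      simp [T]) r
  refine ⟨l, l1, ?_, ?_⟩
  · refine l2.trans ?_
    rw [Multiset.map_add, Multiset.sum_add]
    change ∑ e ∈ E, symCost c e + ∑ e ∈ M, symCost c e ≤ _
    linarith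
  · intro v hv
    refine l3 v (hv.mono (SimpleGraph.fromEdgeSet_mono ?_))
    intro e he
    exact Multiset.mem_add.2 (Or.inl he)

lemma wcut_indicator (E : Finset (Sym2 V)) (g : Sym2 V → ℝ) (S : Finset V) (C : Finset (Sym2 V))
    (hC : ∀ e, e ∈ C ↔ e ∈ E ∧ Crosses S e) :
    wcut (fun a b => if s(a, b) ∈ E then g s(a, b) else 0) S = ∑ e ∈ C, g e := by
  unfold wcut
  rw [← Fintype.sum_prod_type' (f := fun a b => if a ∈ S ∧ b ∉ S then
    (if s(a, b) ∈ E then g s(a, b) else 0) else 0)]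
  have h1 : C = ((Finset.univ : Finset (V × V)).filter
      fun p => (p.1 ∈ S ∧ p.2 ∉ S) ∧ s(p.1, p.2) ∈ E).image fun p => s(p.1, p.2) := by
    ext e
    rw [hC]
    simp only [Finset.mem_image, Finset.mem_filter, Finset.mem_univ, true_and]
    constructor
    · rintro ⟨he, a, ha, b, hb, rfl⟩
      exact ⟨(a, b), ⟨⟨ha, hb⟩, he⟩, rfl⟩
    · rintro ⟨p, ⟨⟨ha, hb⟩, he⟩, rfl⟩
      exact ⟨he, p.1, ha, p.2, hb, rfl⟩
  rw [h1, Finset.sum_image, Finset.sum_filter]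
  · refine Finset.sum_congr rfl fun p _ => ?_
    simp only [ite_and]
  · intro p hp q hq h
    simp only [Finset.coe_filter, Finset.mem_univ, true_and, Set.mem_ofPred_eq] at hp hq
    rcases Sym2.eq_iff.1 h with ⟨h1, h2⟩ | ⟨h1, h2⟩
    · exact Prod.ext h1 h2
    · exact absurd hp.1.1 (h1 ▸ hq.1.2)

lemma pairCost_indicator {E : Finset (Sym2 V)} (hE : ∀ e ∈ E, ¬ e.IsDiag) (g : Sym2 V → ℝ)
    {c : V → V → ℝ} (hc : ∀ a b, c a b = c b a) :
    pairCost c (fun a b => if s(a, b) ∈ E then g s(a, b) else 0) =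
      2 * ∑ e ∈ E, symCost c e * g e := by
  unfold pairCost
  rw [← Fintype.sum_prod_type' (f := fun a b => c a b * if s(a, b) ∈ E then g s(a, b) else 0)]
  have h1 : ∑ p : V × V, c p.1 p.2 * (if s(p.1, p.2) ∈ E then g s(p.1, p.2) else 0) =
      ∑ p : V × V, ∑ e ∈ E, if s(p.1, p.2) = e then symCost c e * g e else 0 := by
    refine Finset.sum_congr rfl fun p _ => ?_
    rw [Finset.sum_ite_eq, mul_ite, mul_zero, symCost_mk hc]
  rw [h1, Finset.sum_comm, Finset.mul_sum]
  refine Finset.sum_congr rfl fun e he => ?_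
  have hd := hE e he
  induction e with | _ a b =>
  rw [Sym2.mk_isDiag_iff] at hd
  rw [← Finset.sum_filter]
  have h2 : ((Finset.univ : Finset (V × V)).filter fun p => s(p.1, p.2) = s(a, b)) =
      {(a, b), (b, a)} := by
    ext ⟨p, q⟩
    simp
  rw [h2, Finset.sum_pair]
  · ring
  · intro h
    exact hd (Prod.ext_iff.1 h).1

end Parity

section Prune
variable {V : Type*} [Fintype V] [DecidableEq V]

lemma reachable_deleteEdges_of_unique_crossing {H : SimpleGraph V} {S : Finset V} {a b : V}
    (ha : a ∉ S) (hb : b ∈ S)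
    (huniq : ∀ p q, H.Adj p q → p ∈ S → q ∉ S → s(p, q) = s(a, b)) {x u : V} (h : H.Reachable x u)
    (hu : u ∉ S) :
    (x ∉ S → (H.deleteEdges {s(a, b)}).Reachable x u) ∧
      (x ∈ S → (H.deleteEdges {s(a, b)}).Reachable a u) := by
  obtain ⟨w⟩ := h
  induction w with
  | nil => exact ⟨fun _ => SimpleGraph.Reachable.refl _, fun h => absurd h hu⟩
  | @cons x x' u hadj w ih =>
    obtain ⟨i1, i2⟩ := ih hu
    have hstep : ¬ Crosses S s(x, x') → (H.deleteEdges {s(a, b)}).Reachable x x' := by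
      intro hcr
      refine SimpleGraph.Adj.reachable ?_
      rw [SimpleGraph.deleteEdges_adj]
      refine ⟨hadj, fun h => hcr ?_⟩
      rw [Set.mem_singleton_iff] at h
      rw [h, crosses_mk]
      tauto
    have hout : ∀ p q, H.Adj p q → p ∈ S → q ∉ S → q = a := by
      intro p q h hp hq
      rcases Sym2.eq_iff.1 (huniq p q h hp hq) with ⟨h1, h2⟩ | ⟨h1, h2⟩
      · exact absurd (h1 ▸ hp) ha
      · exact h2
    constructor
    · intro hx
      by_cases hx' : x' ∈ S
      · rw [hout x' x hadj.symm hx' hx]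
        exact i2 hx'
      · exact (hstep (by rw [crosses_mk]; tauto)).trans (i1 hx')
    · intro hx
      by_cases hx' : x' ∈ S
      · exact i2 hx'
      · have h := i1 hx'
        rwa [show (H.deleteEdges {s(a, b)}).Reachable x' u =
          (H.deleteEdges {s(a, b)}).Reachable a u from
            congrArg (fun p => (H.deleteEdges {s(a, b)}).Reachable p u) (hout x x' hadj hx hx')] at h

/-- Pruning a spanning forest: every edge gets the level of the most valuable vertex it carries. -/
theorem exists_pruning (F : Finset (Sym2 V)) (r : V) (y : V → ℝ) :
    ∃ (F' : Finset (Sym2 V)) (t : Sym2 V → ℝ), F' ⊆ F ∧ (∀ e ∈ F', ¬ e.IsDiag) ∧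
      (∀ e ∈ F', ∃ u, u ≠ r ∧ (SimpleGraph.fromEdgeSet (F : Set (Sym2 V))).Reachable r u ∧ t e = y u) ∧
      (∀ γ v, (SimpleGraph.fromEdgeSet (F : Set (Sym2 V))).Reachable r v → γ ≤ y v →
        (SimpleGraph.fromEdgeSet ((F'.filter fun e => γ ≤ t e : Finset _) : Set (Sym2 V))).Reachable
          r v) ∧
      ∀ γ (S : Finset V), r ∉ S → ∀ e ∈ F', γ ≤ t e → Crosses S e →
        (∀ e' ∈ F', γ ≤ t e' → Crosses S e' → e' = e) → ∃ u ∈ S, t e = y u := by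
  classical
  obtain ⟨H, hHF, hac, hreach⟩ :=
    (SimpleGraph.fromEdgeSet (F : Set (Sym2 V))).exists_isAcyclic_reachable_eq_le
  have hr : ∀ u, H.Reachable r u ↔ (SimpleGraph.fromEdgeSet (F : Set (Sym2 V))).Reachable r u := by
    intro u; rw [hreach]
  let Dn : Sym2 V → Finset V := fun e => Finset.univ.filter fun v =>
    H.Reachable r v ∧ ¬ (H.deleteEdges {e}).Reachable r v
  have hDn : ∀ e v, v ∈ Dn e ↔ H.Reachable r v ∧ ¬ (H.deleteEdges {e}).Reachable r v := by
    intro e v; simp [Dn]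
  have hch : ∀ e, ∃ u, (Dn e).Nonempty → u ∈ Dn e ∧ ∀ v ∈ Dn e, y v ≤ y u := by
    intro e
    by_cases h : (Dn e).Nonempty
    · obtain ⟨u, hu, hm⟩ := Finset.exists_max_image (Dn e) y h
      exact ⟨u, fun _ => ⟨hu, hm⟩⟩
    · exact ⟨r, fun h' => absurd h' h⟩
  choose top htop using hch
  let F' : Finset (Sym2 V) := F.filter fun e => e ∈ H.edgeSet ∧ (Dn e).Nonempty
  have hF' : ∀ e, e ∈ F' ↔ e ∈ H.edgeSet ∧ (Dn e).Nonempty := by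
    intro e
    simp only [F', Finset.mem_filter, and_iff_right_iff_imp]
    rintro ⟨he, -⟩
    have := SimpleGraph.edgeSet_mono hHF he
    rw [SimpleGraph.edgeSet_fromEdgeSet] at this
    exact this.1
  have hpath : ∀ v (p : H.Walk r v), p.IsPath → ∀ e ∈ p.edges, v ∈ Dn e := by
    intro v p hp e he
    rw [hDn]
    refine ⟨⟨p⟩, fun hre => ?_⟩
    obtain ⟨q, hq⟩ := hre.exists_isPath
    have hle := H.deleteEdges_le {e}
    have hq' : (q.mapLe hle).IsPath := hq.mapLe hle
    have := (hac.subsingleton_path _ _).elim ⟨p, hp⟩ ⟨_, hq'⟩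
    have hpq : p = q.mapLe hle := congrArg Subtype.val this
    rw [hpq, SimpleGraph.Walk.edges_mapLe_eq_edges] at he
    have := SimpleGraph.Walk.edges_subset_edgeSet q he
    rw [SimpleGraph.edgeSet_deleteEdges] at this
    exact this.2 rfl
  have hcov : ∀ γ v, (SimpleGraph.fromEdgeSet (F : Set (Sym2 V))).Reachable r v → γ ≤ y v →
        (SimpleGraph.fromEdgeSet ((F'.filter fun e => γ ≤ y (top e) : Finset _) :
          Set (Sym2 V))).Reachable r v := by
    intro γ v hv hγ
    rw [← hr] at hv
    obtain ⟨p, hp⟩ := hv.exists_isPath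
    refine ⟨p.transfer _ fun e he => ?_⟩
    have hmem := hpath v p hp e he
    have heH := SimpleGraph.Walk.edges_subset_edgeSet p he
    rw [SimpleGraph.edgeSet_fromEdgeSet]
    refine ⟨?_, SimpleGraph.not_isDiag_of_mem_edgeSet _ heH⟩
    simp only [Finset.coe_filter, Set.mem_ofPred_eq]
    exact ⟨(hF' e).2 ⟨heH, _, hmem⟩, hγ.trans ((htop e ⟨_, hmem⟩).2 v hmem)⟩
  refine ⟨F', fun e => y (top e), Finset.filter_subset _ _, ?_, ?_, hcov, ?_⟩
  · intro e he
    exact SimpleGraph.not_isDiag_of_mem_edgeSet _ ((hF' e).1 he).1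
  · intro e he
    have h := (htop e ((hF' e).1 he).2).1
    rw [hDn] at h
    refine ⟨top e, ?_, (hr _).1 h.1, rfl⟩
    intro heq
    rw [heq] at h
    exact h.2 (SimpleGraph.Reachable.refl _)
  · intro γ S hrS e he hγ hcr huniq
    refine ⟨top e, ?_, rfl⟩
    by_contra hu
    have h := (htop e ((hF' e).1 he).2).1
    rw [hDn] at h
    obtain ⟨b, hb, a, ha, rfl⟩ := hcr
    have h1 := hcov γ (top s(b, a)) ((hr _).1 h.1) hγ
    have h2 := (reachable_deleteEdges_of_unique_crossing (a := a) (b := b) ha hb (by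
      intro p q hpq hp hq
      rw [SimpleGraph.fromEdgeSet_adj] at hpq
      have hm := hpq.1
      simp only [Finset.coe_filter, Set.mem_ofPred_eq] at hm
      rw [huniq _ hm.1 hm.2 ⟨p, hp, q, hq, rfl⟩, Sym2.eq_swap]) h1 hu).1 hrS
    have hswap : s(a, b) = s(b, a) := Sym2.eq_swap
    rw [hswap] at h2
    refine h.2 (h2.mono ?_)
    refine SimpleGraph.deleteEdges_mono ?_
    intro p q hpq
    rw [SimpleGraph.fromEdgeSet_adj] at hpq
    have hm := hpq.1
    simp only [Finset.coe_filter, Set.mem_ofPred_eq] at hm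
    exact ((hF' _).1 hm.1).1

end Prune
section Level
universe u
variable {V : Type u} [Fintype V] [DecidableEq V]

lemma wcut_linear (p : ℝ) (w z : V → V → ℝ) (S : Finset V) :
    wcut (fun a b => p * w a b + z a b) S = p * wcut w S + wcut z S := by
  unfold wcut
  simp only [Finset.mul_sum, ← Finset.sum_add_distrib]
  refine Finset.sum_congr rfl fun a _ => Finset.sum_congr rfl fun b _ => ?_
  split_ifs <;> ring

lemma pairCost_linear (c : V → V → ℝ) (p : ℝ) (w z : V → V → ℝ) :
    pairCost c (fun a b => p * w a b + z a b) = p * pairCost c w + pairCost c z := by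
  unfold pairCost
  simp only [Finset.mul_sum, ← Finset.sum_add_distrib]
  refine Finset.sum_congr rfl fun a _ => Finset.sum_congr rfl fun b _ => ?_
  ring

/-- Tours from an edge set all of whose edges carry a level, corrected by a fraction of `w`. -/
theorem exists_level_tour {c w : V → V → ℝ} {y : V → ℝ} {r : V} {σ α φ : ℝ}
    (hc : IsPseudoMetric c) (hw : ∀ a b, 0 ≤ w a b) (hs : ∀ a b, w a b = w b a) (hα : 0 ≤ α)
    (hφ : 0 ≤ φ) (hσ : 1 ≤ 2 * α * σ + 3 * φ)
    (hcut : ∀ S : Finset V, r ∉ S → ∀ u ∈ S, σ ≤ y u → 2 * y u ≤ wcut w S)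
    {E : Finset (Sym2 V)} (hE : ∀ e ∈ E, ¬ e.IsDiag) {t : Sym2 V → ℝ}
    (hEσ : ∀ e ∈ E, ∀ v ∈ e, σ ≤ y v)
    (huniq : ∀ S : Finset V, r ∉ S → ∀ e ∈ E, Crosses S e →
      (∀ e' ∈ E, Crosses S e' → e' = e) → ∃ u ∈ S, σ ≤ y u ∧ t e = y u) :
    ∃ l : List V, (r :: l).Nodup ∧
      walkCost c r (l ++ [r]) ≤ ∑ e ∈ E, (1 + max (1 - 2 * α * t e) φ) * symCost c e +
        α * pairCost c w / 2 ∧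
      ∀ v, (SimpleGraph.fromEdgeSet (E : Set (Sym2 V))).Reachable r v → v ∈ r :: l := by
  set β : Sym2 V → ℝ := fun e => max (1 - 2 * α * t e) φ with hβ
  set z : V → V → ℝ := fun a b => α * w a b +
    (fun a b => if s(a, b) ∈ E then β s(a, b) else 0) a b with hz
  obtain ⟨l, l1, l2, l3⟩ := exists_tour_of_parity_correction hE hc (z := z) (by
      intro a b
      have h1 : 0 ≤ α * w a b := mul_nonneg hα (hw a b)
      simp only [hz]
      split_ifs with h
      · exact add_nonneg h1 (hφ.trans (le_max_right _ _))
      · simpa using h1) (by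
      intro a b
      have hswap : s(a, b) = s(b, a) := Sym2.eq_swap
      simp only [hz, hs a b, hswap]) r (by
      rintro S hr ⟨n, hn, C, rfl, hC⟩
      rw [hz, wcut_linear, wcut_indicator E β S C hC]
      by_cases h1 : C.card = 1
      · obtain ⟨e, rfl⟩ := Finset.card_eq_one.1 h1
        obtain ⟨heE, hecr⟩ := (hC e).1 (Finset.mem_singleton_self e)
        obtain ⟨u, huS, hu, htu⟩ := huniq S hr e heE hecr fun e' h1 h2 =>
          Finset.mem_singleton.1 ((hC e').2 ⟨h1, h2⟩)
        have hcu := hcut S hr u huS hu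
        rw [Finset.sum_singleton]
        calc (1 : ℝ) = α * (2 * y u) + (1 - 2 * α * t e) := by rw [htu]; ring
          _ ≤ _ := by gcongr; exact le_max_left _ _
      · have h3c : 3 ≤ C.card := by
          obtain ⟨k, hk⟩ := hn
          omega
        have hne : C.Nonempty := Finset.card_pos.1 (by omega)
        obtain ⟨e, he⟩ := hne
        obtain ⟨heE, a, ha, b, hb, rfl⟩ := (hC e).1 he
        have hya := hEσ _ heE a (Sym2.mem_mk_left a b)
        have hcu := hcut S hr a ha hya
        have hsum : C.card • φ ≤ ∑ e ∈ C, β e :=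
          Finset.card_nsmul_le_sum _ _ _ fun e _ => le_max_right _ _
        rw [nsmul_eq_mul] at hsum
        have h3r : (3 : ℝ) ≤ C.card := by exact_mod_cast h3c
        calc (1 : ℝ) ≤ α * (2 * σ) + 3 * φ := by linarith
          _ ≤ α * wcut w S + C.card * φ := by
              gcongr
              linarith
          _ ≤ _ := by gcongr)
  refine ⟨l, l1, l2.trans ?_, l3⟩
  rw [hz, pairCost_linear, pairCost_indicator hE β hc.symm]
  simp only [add_mul, one_mul, Finset.sum_add_distrib]
  apply le_of_eq
  simp only [hβ, mul_comm (max _ _)]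
  ring

/-- A nonnegative monotone function is the distribution function of a measure on a finite set. -/
lemma exists_distribution (Y : Finset ℝ) (K : ℝ → ℝ) (h0 : ∀ t ∈ Y, 0 ≤ K t)
    (hmono : ∀ s ∈ Y, ∀ t ∈ Y, s ≤ t → K s ≤ K t) :
    ∃ p : ℝ → ℝ, (∀ t ∈ Y, 0 ≤ p t) ∧ ∀ t ∈ Y, ∑ g ∈ Y.filter (· ≤ t), p g = K t := by
  induction Y using Finset.induction_on_max with
  | empty => exact ⟨0, by simp, by simp⟩
  | insert m Y hm ih =>
    obtain ⟨p, p1, p2⟩ := ih (fun t ht => h0 t (Finset.mem_insert_of_mem ht))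
      (fun s hs t ht => hmono s (Finset.mem_insert_of_mem hs) t (Finset.mem_insert_of_mem ht))
    have hmY : m ∉ Y := fun h => lt_irrefl _ (hm m h)
    have hsum : 0 ≤ K m - ∑ g ∈ Y, p g := by
      rcases Y.eq_empty_or_nonempty with rfl | hne
      · simpa using h0 m (by simp)
      · have h := p2 _ (Y.max'_mem hne)
        rw [Finset.filter_true_of_mem fun g hg => Y.le_max' g hg] at h
        rw [h, sub_nonneg]
        exact hmono _ (Finset.mem_insert_of_mem (Y.max'_mem hne)) m (Finset.mem_insert_self _ _)
          (hm _ (Y.max'_mem hne)).le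
    refine ⟨fun g => if g = m then K m - ∑ g ∈ Y, p g else p g, ?_, ?_⟩
    · intro t ht
      dsimp only
      split_ifs with h
      · exact hsum
      · exact p1 t ((Finset.mem_insert.1 ht).resolve_left h)
    · have hcongr : ∀ Z ⊆ Y, ∑ g ∈ Z, (if g = m then K m - ∑ g ∈ Y, p g else p g) =
          ∑ g ∈ Z, p g := fun Z hZ => Finset.sum_congr rfl fun g hg =>
        if_neg (by rintro rfl; exact hmY (hZ hg))
      intro t ht
      rcases Finset.mem_insert.1 ht with rfl | ht
      · rw [Finset.filter_true_of_mem fun g hg => (Finset.mem_insert.1 hg).elim (fun h => h.le)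
          fun h => (hm g h).le, Finset.sum_insert hmY, hcongr _ subset_rfl]
        simp
      · rw [Finset.filter_insert, if_neg (not_le.2 (hm t ht)), hcongr _ (Finset.filter_subset _ _),
          p2 t ht]

/-- The averaged bound obtained from one forest. -/
theorem le_of_forest {c w : V → V → ℝ} {π y : V → ℝ} {r : V} {σ α φ B : ℝ}
    (hc : IsPseudoMetric c) (hw : ∀ a b, 0 ≤ w a b) (hs : ∀ a b, w a b = w b a) (hα : 0 ≤ α)
    (hφ : 0 ≤ φ) (hσ : 1 ≤ 2 * α * σ + 3 * φ) (hαφ : 1 - 2 * α ≤ φ) (hσ1 : σ < 1)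
    (hπ : ∀ v, 0 ≤ π v) (hyr : y r = 1) (hy1 : ∀ v, y v ≤ 1)
    (hcut : ∀ S : Finset V, r ∉ S → ∀ u ∈ S, σ ≤ y u → 2 * y u ≤ wcut w S)
    (hB : ∀ l : List V, (r :: l).Nodup →
      B ≤ walkCost c r (l ++ [r]) + ∑ v ∈ Finset.univ \ (r :: l).toFinset, π v)
    (F : Finset (Sym2 V)) (hF : ∀ e ∈ F, ∀ v ∈ e, σ ≤ y v) (R : Finset V)
    (hR : ∀ v, v ∈ R ↔ (SimpleGraph.fromEdgeSet (F : Set (Sym2 V))).Reachable r v) :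
    B ≤ (1 + φ) * ∑ e ∈ F, symCost c e + α * pairCost c w / 2 +
      ∑ v, π v * (1 - if v ∈ R then (1 + φ) / max (2 - 2 * α * y v) (1 + φ) else 0) := by
  classical
  obtain ⟨F', t, f1, f2, f3, f4, f5⟩ := exists_pruning F r y
  have hφ1 : 0 < 1 + φ := by linarith
  have hmax : ∀ t, 0 < max (2 - 2 * α * t) (1 + φ) := fun t => lt_max_of_lt_right hφ1
  have hsc : ∀ e, 0 ≤ symCost c e := by
    intro e
    induction e with | _ a b =>
    rw [symCost_mk hc.symm]; exact hc.nonneg a b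
  have hrR : r ∈ R := (hR r).2 (SimpleGraph.Reachable.refl _)
  have hRσ : ∀ v ∈ R, σ ≤ y v := by
    intro v hv
    rw [hR] at hv
    obtain ⟨q⟩ := hv.symm
    cases q with
    | nil => rw [hyr]; exact hσ1.le
    | cons h q =>
      rw [SimpleGraph.fromEdgeSet_adj] at h
      exact hF _ h.1 v (Sym2.mem_mk_left _ _)
  have htR : ∀ e ∈ F', ∃ u ∈ R, t e = y u := by
    intro e he
    obtain ⟨u, -, hu, hte⟩ := f3 e he
    exact ⟨u, (hR u).2 hu, hte⟩
  let Y : Finset ℝ := R.image y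
  have hY1 : ∀ g ∈ Y, g ≤ 1 := by
    intro g hg
    obtain ⟨v, -, rfl⟩ := Finset.mem_image.1 hg
    exact hy1 v
  have h1Y : (1 : ℝ) ∈ Y := Finset.mem_image.2 ⟨r, hrR, hyr⟩
  obtain ⟨p, p1, p2⟩ := exists_distribution Y (fun t => (1 + φ) / max (2 - 2 * α * t) (1 + φ))
    (fun t _ => (div_pos hφ1 (hmax t)).le) (fun s _ t _ hst =>
      div_le_div_of_nonneg_left hφ1.le (hmax t) (by gcongr))
  have htour : ∀ g ∈ Y, B ≤ ∑ e ∈ F'.filter (fun e => g ≤ t e),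
      (1 + max (1 - 2 * α * t e) φ) * symCost c e + α * pairCost c w / 2 +
        ∑ v, π v * (1 - if v ∈ R ∧ g ≤ y v then 1 else 0) := by
    intro g hg
    obtain ⟨l, l1, l2, l3⟩ := exists_level_tour hc hw hs hα hφ hσ hcut
      (E := F'.filter fun e => g ≤ t e) (t := t)
      (fun e he => f2 e (Finset.mem_filter.1 he).1)
      (fun e he => hF e (f1 (Finset.mem_filter.1 he).1)) (by
        intro S hr e he hcr hun
        obtain ⟨he1, he2⟩ := Finset.mem_filter.1 he
        obtain ⟨u, hu, htu⟩ := f5 g S hr e he1 he2 hcr fun e' h1 h2 h3 =>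
          hun e' (Finset.mem_filter.2 ⟨h1, h2⟩) h3
        obtain ⟨u', hu', htu'⟩ := htR e he1
        exact ⟨u, hu, by rw [← htu, htu']; exact hRσ u' hu', htu⟩)
    refine (hB l l1).trans (add_le_add l2 ?_)
    rw [← Finset.sum_filter_add_sum_filter_not Finset.univ (fun v => v ∈ R ∧ g ≤ y v)
      (fun v => π v * (1 - if v ∈ R ∧ g ≤ y v then (1 : ℝ) else 0))]
    refine le_trans ?_ (le_add_of_nonneg_left (Finset.sum_nonneg fun v hv => ?_))
    · have e1 : ∑ v ∈ Finset.univ.filter (fun v => ¬ (v ∈ R ∧ g ≤ y v)),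
          π v * (1 - if v ∈ R ∧ g ≤ y v then (1 : ℝ) else 0) =
          ∑ v ∈ Finset.univ.filter (fun v => ¬ (v ∈ R ∧ g ≤ y v)), π v :=
        Finset.sum_congr rfl fun v hv => by rw [if_neg (Finset.mem_filter.1 hv).2]; ring
      rw [e1]
      refine Finset.sum_le_sum_of_subset_of_nonneg ?_ fun v _ _ => hπ v
      intro v hv
      refine Finset.mem_filter.2 ⟨Finset.mem_univ v, fun h => ?_⟩
      refine (Finset.mem_sdiff.1 hv).2 (List.mem_toFinset.2 (l3 v ?_))
      exact f4 g v ((hR v).1 h.1) h.2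
    · rw [if_pos (Finset.mem_filter.1 hv).2]; simp
  have htot : ∑ g ∈ Y, p g = 1 := by
    have := p2 1 h1Y
    rw [Finset.filter_true_of_mem hY1] at this
    rw [this, max_eq_right (by linarith), div_self hφ1.ne']
  have hlev : ∀ u ∈ R, ∑ g ∈ Y, (if g ≤ y u then p g else 0) =
      (1 + φ) / max (2 - 2 * α * y u) (1 + φ) := by
    intro u hu
    rw [← Finset.sum_filter]
    exact p2 _ (Finset.mem_image_of_mem y hu)
  calc B = ∑ g ∈ Y, p g * B := by rw [← Finset.sum_mul, htot, one_mul]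
    _ ≤ ∑ g ∈ Y, p g * (∑ e ∈ F'.filter (fun e => g ≤ t e),
      (1 + max (1 - 2 * α * t e) φ) * symCost c e + α * pairCost c w / 2 +
        ∑ v, π v * (1 - if v ∈ R ∧ g ≤ y v then 1 else 0)) :=
      Finset.sum_le_sum fun g hg => mul_le_mul_of_nonneg_left (htour g hg) (p1 g hg)
    _ = ∑ e ∈ F', (1 + max (1 - 2 * α * t e) φ) * symCost c e *
          (∑ g ∈ Y, if g ≤ t e then p g else 0) + α * pairCost c w / 2 +
        ∑ v, π v * (1 - ∑ g ∈ Y, if v ∈ R ∧ g ≤ y v then p g else 0) := by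
      simp only [mul_add, Finset.sum_add_distrib]
      congr 1
      · congr 1
        · simp only [Finset.sum_filter, Finset.mul_sum]
          rw [Finset.sum_comm]
          refine Finset.sum_congr rfl fun e _ => Finset.sum_congr rfl fun g _ => ?_
          split_ifs <;> ring
        · rw [← Finset.sum_mul, htot, one_mul]
      · have : ∀ v, π v * (1 - ∑ g ∈ Y, if v ∈ R ∧ g ≤ y v then p g else 0) =
            ∑ g ∈ Y, p g * (π v * (1 - if v ∈ R ∧ g ≤ y v then 1 else 0)) := by
          intro v
          rw [← htot, ← Finset.sum_sub_distrib, Finset.mul_sum, htot]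
          refine Finset.sum_congr rfl fun g _ => ?_
          split_ifs <;> ring
        simp only [this, Finset.mul_sum]
        rw [Finset.sum_comm]
    _ ≤ _ := by
      gcongr ?_ + _ + ?_
      · rw [Finset.mul_sum]
        refine (Finset.sum_le_sum fun e he => ?_).trans
          (Finset.sum_le_sum_of_subset_of_nonneg f1 fun e _ _ => ?_)
        · obtain ⟨u, hu, htu⟩ := htR e he
          rw [htu, hlev u hu]
          have h1 : 1 + max (1 - 2 * α * y u) φ = max (2 - 2 * α * y u) (1 + φ) := by
            rw [← max_add_add_left]; ring_nf
          have h2 := (hmax (y u)).ne'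
          rw [h1]
          apply le_of_eq
          field_simp
        · exact mul_nonneg (by positivity) (hsc e)
      · refine Finset.sum_le_sum fun v _ => ?_
        by_cases hv : v ∈ R
        · simp only [hv, true_and, if_true]
          rw [hlev v hv]
        · simp [hv]

end Level
section LevelWeight
variable {V : Type*} [Fintype V] [DecidableEq V]

open scoped NNReal in
lemma sup_uncross (g : V → ℝ≥0) (X Y : Finset V) :
    ((X.sup g : ℝ≥0) : ℝ) + (Y.sup g : ℝ≥0) ≤
        ((X ∩ Y).sup g : ℝ≥0) + ((X ∪ Y).sup g : ℝ≥0) ∨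
      ((X.sup g : ℝ≥0) : ℝ) + (Y.sup g : ℝ≥0) ≤
        ((X \ Y).sup g : ℝ≥0) + ((Y \ X).sup g : ℝ≥0) := by
  norm_cast
  wlog hXY : X.sup g ≤ Y.sup g generalizing X Y
  · have := this Y X (le_of_not_ge hXY)
    rwa [add_comm, Finset.inter_comm, Finset.union_comm, add_comm ((Y \ X).sup g)] at this
  have hY : Y.sup g ≤ (X ∪ Y).sup g := Finset.sup_mono Finset.subset_union_right
  rcases X.eq_empty_or_nonempty with rfl | hX
  · left; simp
  have hYne : Y.Nonempty ∨ Y.sup g = 0 := by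
    rcases Y.eq_empty_or_nonempty with rfl | h
    · right; simp
    · exact Or.inl h
  rcases hYne with hYne | h0
  · obtain ⟨a, ha, hga⟩ := Finset.exists_mem_eq_sup X hX g
    obtain ⟨b, hb, hgb⟩ := Finset.exists_mem_eq_sup Y hYne g
    by_cases haY : a ∈ Y
    · left
      refine add_le_add ?_ hY
      rw [hga]
      exact Finset.le_sup (f := g) (Finset.mem_inter.2 ⟨ha, haY⟩)
    · by_cases hbX : b ∈ X
      · left
        refine add_le_add (hXY.trans ?_) hY
        rw [hgb]
        exact Finset.le_sup (f := g) (Finset.mem_inter.2 ⟨hbX, hb⟩)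
      · right
        refine add_le_add ?_ ?_
        · rw [hga]; exact Finset.le_sup (f := g) (Finset.mem_sdiff.2 ⟨ha, haY⟩)
        · rw [hgb]; exact Finset.le_sup (f := g) (Finset.mem_sdiff.2 ⟨hb, hbX⟩)
  · left
    rw [h0] at hXY ⊢
    rw [le_antisymm hXY bot_le]
    simp

open scoped NNReal in
/-- The requirement asking each cut to be at least the largest demand it separates from `r`. -/
lemma requirement_sup (g : V → ℝ≥0) {r v : V} (hrv : r ≠ v) :
    Requirement v fun X => ((if r ∈ X then (insert v X)ᶜ.sup g else X.sup g : ℝ≥0) : ℝ) := by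
  constructor
  · intro X hv
    by_cases hr : r ∈ X
    · simp [hr]
    · have h1 : r ∈ (insert v X)ᶜ := by simp [hr, hrv]
      have h2 : (insert v (insert v X)ᶜ)ᶜ = X := by
        ext a
        by_cases h : a = v
        · subst h; simp [hv]
        · simp [h]
      simp only [h1, if_true, hr, if_false, h2]
  · intro X Y hX hY
    by_cases hrX : r ∈ X <;> by_cases hrY : r ∈ Y
    · have e1 : (insert v (X ∩ Y))ᶜ = (insert v X)ᶜ ∪ (insert v Y)ᶜ := by
        ext a; simp; tauto
      have e2 : (insert v (X ∪ Y))ᶜ = (insert v X)ᶜ ∩ (insert v Y)ᶜ := by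
        ext a; simp; tauto
      have e3 : X \ Y = (insert v Y)ᶜ \ (insert v X)ᶜ := by
        ext a
        by_cases h : a = v
        · subst h; simp [hX]
        · simp [h]; tauto
      have e4 : Y \ X = (insert v X)ᶜ \ (insert v Y)ᶜ := by
        ext a
        by_cases h : a = v
        · subst h; simp [hY]
        · simp [h]; tauto
      have := sup_uncross g (insert v X)ᶜ (insert v Y)ᶜ
      rw [← e1, ← e2, ← e3, ← e4] at this
      simp only [hrX, hrY, if_true, Finset.mem_inter, Finset.mem_union, Finset.mem_sdiff, and_self,
        or_self, not_true, and_false, if_false]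
      rw [add_comm _ ((((insert v (X ∪ Y))ᶜ.sup g : ℝ≥0)) : ℝ), add_comm (((X \ Y).sup g : ℝ≥0) : ℝ)]
      exact this
    · have e1 : (insert v (X ∪ Y))ᶜ = (insert v X)ᶜ \ Y := by
        ext a; simp; tauto
      have e2 : (insert v (X \ Y))ᶜ = (insert v X)ᶜ ∪ Y := by
        ext a
        by_cases h : a = v
        · subst h; simp [hY]
        · simp [h]; tauto
      have e3 : X ∩ Y = Y \ (insert v X)ᶜ := by
        ext a
        by_cases h : a = v
        · subst h; simp [hX, hY]
        · simp [h]; tauto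
      have e4 : Y \ X = (insert v X)ᶜ ∩ Y := by
        ext a
        by_cases h : a = v
        · subst h; simp [hY]
        · simp [h]; tauto
      have := sup_uncross g (insert v X)ᶜ Y
      rw [← e1, ← e2, ← e3, ← e4] at this
      simp only [hrX, hrY, if_true, Finset.mem_inter, Finset.mem_union, Finset.mem_sdiff, and_true,
        or_false, not_true, and_false, not_false_eq_true, if_false]
      rw [add_comm (((X ∩ Y).sup g : ℝ≥0) : ℝ), add_comm ((((insert v (X \ Y))ᶜ.sup g : ℝ≥0)) : ℝ)]
      exact this.symm
    · have e1 : (insert v (X ∪ Y))ᶜ = (insert v Y)ᶜ \ X := by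
        ext a; simp; tauto
      have e2 : (insert v (Y \ X))ᶜ = X ∪ (insert v Y)ᶜ := by
        ext a
        by_cases h : a = v
        · subst h; simp [hX]
        · simp [h]; tauto
      have e3 : X ∩ Y = X \ (insert v Y)ᶜ := by
        ext a
        by_cases h : a = v
        · subst h; simp [hX, hY]
        · simp [h]
      have e4 : X \ Y = X ∩ (insert v Y)ᶜ := by
        ext a
        by_cases h : a = v
        · subst h; simp [hX]
        · simp [h]
      have := sup_uncross g X (insert v Y)ᶜ
      rw [← e1, ← e2, ← e3, ← e4] at this
      simp only [hrX, hrY, if_true, Finset.mem_inter, Finset.mem_union, Finset.mem_sdiff, and_true,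
        or_true, not_false_eq_true, if_false]
      exact this.symm
    · have := sup_uncross g X Y
      simpa [hrX, hrY] using this

/-- Edge weights supported on `A` whose cuts dominate the demands `2 * y` of the vertices of `A`. -/
structure IsLevelWeight (r : V) (y : V → ℝ) (A : Finset V) (w : V → V → ℝ) : Prop where
  symm : ∀ a b, w a b = w b a
  nonneg : ∀ a b, 0 ≤ w a b
  supp : ∀ a b, a ∉ A → w a b = 0
  cut : ∀ S : Finset V, r ∉ S → ∀ u ∈ S, u ∈ A → 2 * y u ≤ wcut w S
  deg : ∀ u ∈ A, u ≠ r → wcut w {u} ≤ 2 * y u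

theorem IsLevelWeight.exists_split {r v : V} {y : V → ℝ} {A : Finset V} {w : V → V → ℝ}
    (h : IsLevelWeight r y A w) (hy : ∀ u, 0 ≤ y u) (hvr : v ≠ r) :
    ∃ s : V → V → ℝ, (∀ a b, 0 ≤ s a b) ∧ (∀ a b, a = v ∨ b = v → s a b = 0) ∧
      (∀ u, u ≠ v → ∑ c, (s u c + s c u) = w v u) ∧
      IsLevelWeight r y (A.erase v) (splitWeight v w s) := by
  obtain ⟨g, hg1, hg0⟩ : ∃ g : V → NNReal, (∀ u ∈ A, u ≠ v → (g u : ℝ) = 2 * y u) ∧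
      ∀ u, ¬ (u ∈ A ∧ u ≠ v) → g u = 0 := by
    refine ⟨fun u => if u ∈ A ∧ u ≠ v then (2 * y u).toNNReal else 0, fun u h1 h2 => ?_,
      fun u hu => if_neg hu⟩
    have := hy u
    simp only [h1, h2, and_true, ne_eq, not_false_eq_true, if_true]
    exact Real.coe_toNNReal _ (by positivity)
  have hsup : ∀ X : Finset V, r ∉ X → ((X.sup g : NNReal) : ℝ) ≤ wcut w X := by
    intro X hr
    have h0 := wcut_nonneg h.nonneg X
    have : X.sup g ≤ ⟨wcut w X, h0⟩ := by
      refine Finset.sup_le fun u hu => ?_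
      by_cases hc : u ∈ A ∧ u ≠ v
      · have h1 := h.cut X hr u hu hc.1
        rw [← hg1 u hc.1 hc.2] at h1
        exact_mod_cast h1
      · rw [hg0 u hc]; exact bot_le
    exact_mod_cast this
  obtain ⟨s, s1, s2, s3, s4⟩ := exists_splitting (requirement_sup g hvr.symm) h.nonneg h.symm (by
    intro X hX
    split_ifs with hr
    · rw [← wcut_compl h.symm X]
      refine le_trans ?_ (hsup Xᶜ (by simpa using hr))
      norm_cast
      exact Finset.sup_mono (Finset.compl_subset_compl.2 (Finset.subset_insert _ _))
    · exact hsup X hr)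
  refine ⟨s, s1, s2, s3, splitWeight_symm h.symm, splitWeight_nonneg h.nonneg s1 s3, ?_, ?_, ?_⟩
  · intro a b ha
    by_cases hav : a = v
    · exact splitWeight_eq_zero s3 (Or.inl hav)
    · refine splitWeight_eq_zero_of_isolated h.symm s1 s3 (fun b => h.supp a b ?_) b
      exact fun h => ha (Finset.mem_erase.2 ⟨hav, h⟩)
  · intro S hr u hu huA
    obtain ⟨huv, huA⟩ := Finset.mem_erase.1 huA
    rw [← hg1 u huA huv]
    by_cases hv : v ∈ S
    · have hv' : v ∉ Sᶜ := by simpa using hv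
      have h4 := s4 Sᶜ hv'
      rw [← wcut_splitWeight h.symm s2 hv', wcut_compl (splitWeight_symm h.symm)] at h4
      refine le_trans ?_ h4
      rw [if_pos (by simpa using hr)]
      norm_cast
      refine Finset.le_sup (f := g) ?_
      simp [hu, huv]
    · have h4 := s4 S hv
      rw [← wcut_splitWeight h.symm s2 hv, if_neg hr] at h4
      refine le_trans ?_ h4
      norm_cast
      exact Finset.le_sup (f := g) hu
  · intro u huA hur
    obtain ⟨huv, huA⟩ := Finset.mem_erase.1 huA
    rw [wcut_splitWeight h.symm s2 (by simpa using huv.symm)]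
    have := h.deg u huA hur
    simp only [Finset.sum_singleton]
    have := s1 u u
    linarith

/-- All vertices of low demand can be split off. -/
theorem IsLevelWeight.exists_restrict {r : V} {y : V → ℝ} {A : Finset V} {w : V → V → ℝ}
    {c : V → V → ℝ} (hc : IsPseudoMetric c) (h : IsLevelWeight r y A w) (hy : ∀ u, 0 ≤ y u) {σ : ℝ}
    (hr : σ ≤ y r) :
    ∃ w', IsLevelWeight r y (A.filter fun u => σ ≤ y u) w' ∧ pairCost c w' ≤ pairCost c w := by
  by_cases hall : ∀ u ∈ A, σ ≤ y u
  · exact ⟨w, by rwa [Finset.filter_true_of_mem hall], le_rfl⟩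
  · push Not at hall
    obtain ⟨v, hvA, hv⟩ := hall
    have hvr : v ≠ r := by rintro rfl; linarith
    obtain ⟨s, s1, s2, s3, s4⟩ := h.exists_split hy hvr
    have hlt : (A.erase v).card < A.card := Finset.card_erase_lt_of_mem hvA
    obtain ⟨w', w1, w2⟩ := IsLevelWeight.exists_restrict hc s4 hy hr
    refine ⟨w', ?_, w2.trans (pairCost_splitWeight_le hc h.symm s1 s2 s3)⟩
    convert w1 using 1
    ext u
    simp only [Finset.mem_filter, Finset.mem_erase]
    constructor
    · rintro ⟨h1, h2⟩
      exact ⟨⟨by rintro rfl; linarith, h1⟩, h2⟩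
    · rintro ⟨⟨-, h1⟩, h2⟩
      exact ⟨h1, h2⟩
termination_by A.card

end LevelWeight
section Forest
variable {V : Type*} [Fintype V] [DecidableEq V]

/-- `u` is reachable from `r` using the edges of `F`. -/
def Conn (F : Finset (Sym2 V)) (r u : V) : Prop :=
  (SimpleGraph.fromEdgeSet (F : Set (Sym2 V))).Reachable r u

lemma Conn.mono {F G : Finset (Sym2 V)} (h : F ⊆ G) {a b : V} (hab : Conn F a b) : Conn G a b :=
  SimpleGraph.Reachable.mono (SimpleGraph.fromEdgeSet_mono (by exact_mod_cast h)) hab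

lemma Conn.edge {F : Finset (Sym2 V)} {a b : V} (h : s(a, b) ∈ F) : Conn F a b := by
  by_cases hab : a = b
  · subst hab; exact SimpleGraph.Reachable.refl _
  · exact SimpleGraph.Adj.reachable ((SimpleGraph.fromEdgeSet_adj _).2 ⟨by exact_mod_cast h, hab⟩)

lemma Conn.symm {F : Finset (Sym2 V)} {a b : V} (h : Conn F a b) : Conn F b a :=
  SimpleGraph.Reachable.symm h

lemma Conn.trans {F : Finset (Sym2 V)} {a b d : V} (h : Conn F a b) (h' : Conn F b d) :
    Conn F a d :=
  SimpleGraph.Reachable.trans h h'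

lemma Conn.refl (F : Finset (Sym2 V)) (a : V) : Conn F a a := SimpleGraph.Reachable.refl _

lemma Conn.cases_erase {F : Finset (Sym2 V)} {a b r u : V} (h : Conn F r u) :
    Conn (F.erase s(a, b)) r u ∨
      (Conn (F.erase s(a, b)) r a ∧ Conn (F.erase s(a, b)) b u) ∨
      (Conn (F.erase s(a, b)) r b ∧ Conn (F.erase s(a, b)) a u) := by
  obtain ⟨w⟩ := h
  induction w with
  | nil => exact Or.inl (Conn.refl _ _)
  | @cons x x' u hadj w ih =>
    rw [SimpleGraph.fromEdgeSet_adj] at hadj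
    by_cases he : s(x, x') = s(a, b)
    · rcases Sym2.eq_iff.1 he with ⟨rfl, rfl⟩ | ⟨rfl, rfl⟩
      · rcases ih with h | ⟨-, h⟩ | ⟨-, h⟩
        · exact Or.inr (Or.inl ⟨Conn.refl _ _, h⟩)
        · exact Or.inr (Or.inl ⟨Conn.refl _ _, h⟩)
        · exact Or.inl h
      · rcases ih with h | ⟨-, h⟩ | ⟨-, h⟩
        · exact Or.inr (Or.inr ⟨Conn.refl _ _, h⟩)
        · exact Or.inl h
        · exact Or.inr (Or.inr ⟨Conn.refl _ _, h⟩)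
    · have hx : Conn (F.erase s(a, b)) x x' :=
        Conn.edge (Finset.mem_erase.2 ⟨he, by exact_mod_cast hadj.1⟩)
      rcases ih with h | ⟨h, h'⟩ | ⟨h, h'⟩
      · exact Or.inl (hx.trans h)
      · exact Or.inr (Or.inl ⟨hx.trans h, h'⟩)
      · exact Or.inr (Or.inr ⟨hx.trans h, h'⟩)

/-- The number of edges of `F` joining `v` to another vertex. -/
def starDeg (v : V) (F : Finset (Sym2 V)) : ℝ :=
  ∑ u ∈ Finset.univ.erase v, if s(v, u) ∈ F then 1 else 0

lemma starDeg_mono {F G : Finset (Sym2 V)} (h : F ⊆ G) (v : V) : starDeg v F ≤ starDeg v G := by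
  refine Finset.sum_le_sum fun u _ => ?_
  by_cases h1 : s(v, u) ∈ F
  · rw [if_pos h1, if_pos (h h1)]
  · rw [if_neg h1]; split_ifs <;> norm_num

lemma starDeg_insert_le (F : Finset (Sym2 V)) (v a : V) :
    starDeg v (insert s(v, a) F) ≤ starDeg v F + 1 := by
  have h : ∀ u ∈ Finset.univ.erase v, (if s(v, u) ∈ insert s(v, a) F then (1 : ℝ) else 0) ≤
      (if s(v, u) ∈ F then 1 else 0) + if u = a then 1 else 0 := by
    intro u _
    by_cases hu : u = a
    · subst hu
      simp only [Finset.mem_insert_self, if_true]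
      split_ifs <;> norm_num
    · have : s(v, u) ∈ insert s(v, a) F ↔ s(v, u) ∈ F := by
        rw [Finset.mem_insert]
        refine or_iff_right fun h => hu ?_
        rcases Sym2.eq_iff.1 h with ⟨-, h⟩ | ⟨h, h'⟩
        · exact h
        · rw [h', h]
      simp [this, hu]
  refine (Finset.sum_le_sum h).trans ?_
  rw [Finset.sum_add_distrib]
  refine add_le_add le_rfl ?_
  rw [Finset.sum_ite_eq']
  split_ifs <;> norm_num

open scoped Classical in
/-- Rerouting the edge `ab` through `v` while keeping everything connected to `r`. -/
lemma exists_detour (F : Finset (Sym2 V)) (r : V) {v a b : V} (hav : a ≠ v) (hbv : b ≠ v) :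
    ∃ F' : Finset (Sym2 V), (∀ u, Conn F r u → Conn F' r u) ∧ s(a, b) ∉ F' ∧
      (∀ e ∈ F', e ∈ F ∨ e = s(v, a) ∨ e = s(v, b)) ∧
      starDeg v F' - (if Conn F' r v then 1 else 0) ≤
        starDeg v F - (if Conn F r v then 1 else 0) + 1 := by
  set F0 := F.erase s(a, b) with hF0
  have hsub : ∀ G : Finset (Sym2 V), F0 ⊆ insert s(v, a) F0 := fun _ => Finset.subset_insert _ _
  have ha0 : ∀ e, e ∈ F0 → e ∈ F := fun e he => Finset.mem_of_mem_erase he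
  have hne1 : s(a, b) ≠ s(v, a) := by
    intro h
    rcases Sym2.eq_iff.1 h with ⟨h, -⟩ | ⟨-, h⟩
    exacts [hav h, hbv h]
  have hne2 : s(a, b) ≠ s(v, b) := by
    intro h
    rcases Sym2.eq_iff.1 h with ⟨h, -⟩ | ⟨h, h'⟩
    exacts [hav h, hbv h']
  have hd0 : starDeg v F0 ≤ starDeg v F := starDeg_mono (Finset.erase_subset _ _) v
  have key : ∀ d, d = a ∨ d = b → Conn F r v →
      (∀ u, Conn F r u → Conn (insert s(v, d) F0) r u) →
      ∃ F' : Finset (Sym2 V), (∀ u, Conn F r u → Conn F' r u) ∧ s(a, b) ∉ F' ∧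
      (∀ e ∈ F', e ∈ F ∨ e = s(v, a) ∨ e = s(v, b)) ∧
      starDeg v F' - (if Conn F' r v then 1 else 0) ≤
        starDeg v F - (if Conn F r v then 1 else 0) + 1 := by
    intro d hd hv hall
    refine ⟨insert s(v, d) F0, hall, ?_, ?_, ?_⟩
    · rw [Finset.mem_insert, not_or]
      refine ⟨?_, Finset.notMem_erase _ _⟩
      rcases hd with rfl | rfl
      exacts [hne1, hne2]
    · intro e he
      rcases Finset.mem_insert.1 he with rfl | he
      · right; rcases hd with rfl | rfl <;> simp
      · exact Or.inl (ha0 e he)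
    · rw [if_pos (hall v hv), if_pos hv]
      have := starDeg_insert_le F0 v d
      linarith
  have hins : ∀ d x z, Conn F0 x z → Conn (insert s(v, d) F0) x z := fun d x z h =>
    h.mono (Finset.subset_insert _ _)
  have hvd : ∀ d, Conn (insert s(v, d) F0) v d := fun d => Conn.edge (Finset.mem_insert_self _ _)
  by_cases hv : Conn F r v
  · have hc := Conn.cases_erase (a := a) (b := b) hv
    rw [← hF0] at hc
    rcases hc with h | ⟨h1, h2⟩ | ⟨h1, h2⟩
    · by_cases hra : Conn F0 r a
      · refine key b (Or.inr rfl) hv fun u hu => ?_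
        rcases Conn.cases_erase (a := a) (b := b) hu with h' | ⟨h', h''⟩ | ⟨h', h''⟩
        · exact hins _ _ _ h'
        · exact (hins _ _ _ h).trans ((hvd b).trans (hins _ _ _ h''))
        · exact hins _ _ _ (hra.trans h'')
      · refine key a (Or.inl rfl) hv fun u hu => ?_
        rcases Conn.cases_erase (a := a) (b := b) hu with h' | ⟨h', h''⟩ | ⟨h', h''⟩
        · exact hins _ _ _ h'
        · exact absurd h' hra
        · exact (hins _ _ _ h).trans ((hvd a).trans (hins _ _ _ h''))
    · refine key a (Or.inl rfl) hv fun u hu => ?_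
      rcases Conn.cases_erase (a := a) (b := b) hu with h' | ⟨h', h''⟩ | ⟨h', h''⟩
      · exact hins _ _ _ h'
      · exact (hins _ _ _ h1).trans ((hvd a).symm.trans (hins _ _ _ (h2.symm.trans h'')))
      · exact hins _ _ _ (h1.trans h'')
    · refine key b (Or.inr rfl) hv fun u hu => ?_
      rcases Conn.cases_erase (a := a) (b := b) hu with h' | ⟨h', h''⟩ | ⟨h', h''⟩
      · exact hins _ _ _ h'
      · exact hins _ _ _ (h1.trans h'')
      · exact (hins _ _ _ h1).trans ((hvd b).symm.trans (hins _ _ _ (h2.symm.trans h'')))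
  · by_cases hab : Conn F0 r a ∨ Conn F0 r b
    · refine ⟨insert s(v, a) (insert s(v, b) F0), ?_, ?_, ?_, ?_⟩
      · have h1 : Conn (insert s(v, a) (insert s(v, b) F0)) a b :=
          (Conn.edge (Finset.mem_insert_self _ _)).symm.trans
            (Conn.edge (Finset.mem_insert_of_mem (Finset.mem_insert_self _ _)))
        have h2 : ∀ x z, Conn F0 x z → Conn (insert s(v, a) (insert s(v, b) F0)) x z :=
          fun x z h => h.mono ((Finset.subset_insert _ _).trans (Finset.subset_insert _ _))
        intro u hu
        rcases Conn.cases_erase (a := a) (b := b) hu with h' | ⟨h', h''⟩ | ⟨h', h''⟩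
        · exact h2 _ _ h'
        · exact (h2 _ _ h').trans (h1.trans (h2 _ _ h''))
        · exact (h2 _ _ h').trans (h1.symm.trans (h2 _ _ h''))
      · simp [hne1, hne2, hF0]
      · intro e he
        rcases Finset.mem_insert.1 he with rfl | he
        · simp
        · rcases Finset.mem_insert.1 he with rfl | he
          · simp
          · exact Or.inl (ha0 e he)
      · have hcv : Conn (insert s(v, a) (insert s(v, b) F0)) r v := by
          rcases hab with h | h
          · exact (h.mono ((Finset.subset_insert _ _).trans (Finset.subset_insert _ _))).trans
              (Conn.edge (Finset.mem_insert_self _ _)).symm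
          · exact (h.mono ((Finset.subset_insert _ _).trans (Finset.subset_insert _ _))).trans
              (Conn.edge (Finset.mem_insert_of_mem (Finset.mem_insert_self _ _))).symm
        rw [if_pos hcv, if_neg hv]
        have h1 := starDeg_insert_le (insert s(v, b) F0) v a
        have h2 := starDeg_insert_le F0 v b
        linarith
    · push Not at hab
      refine ⟨F0, ?_, Finset.notMem_erase _ _, fun e he => Or.inl (ha0 e he), ?_⟩
      · intro u hu
        rcases Conn.cases_erase (a := a) (b := b) hu with h' | ⟨h', h''⟩ | ⟨h', h''⟩
        · exact h'
        · exact absurd h' hab.1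
        · exact absurd h' hab.2
      · rw [if_neg hv]
        split_ifs <;> linarith

/-- A probability distribution on edge sets. -/
structure IsDist (p : Finset (Sym2 V) → ℝ) : Prop where
  nonneg : ∀ F, 0 ≤ p F
  total : ∑ F, p F = 1

/-- Expectation with respect to a weight on edge sets. -/
def expect (p g : Finset (Sym2 V) → ℝ) : ℝ := ∑ F, p F * g F

lemma expect_mono {p g h : Finset (Sym2 V) → ℝ} (hp : IsDist p) (hgh : ∀ F, g F ≤ h F) :
    expect p g ≤ expect p h :=
  Finset.sum_le_sum fun F _ => mul_le_mul_of_nonneg_left (hgh F) (hp.nonneg F)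

lemma expect_sub (p g h : Finset (Sym2 V) → ℝ) :
    expect p (fun F => g F - h F) = expect p g - expect p h := by
  simp only [expect, mul_sub, Finset.sum_sub_distrib]

lemma expect_neg (p g : Finset (Sym2 V) → ℝ) : expect p (fun F => - g F) = - expect p g := by
  simp only [expect, mul_neg, Finset.sum_neg_distrib]

open scoped Classical in
/-- Moving mass `m` from edge sets `F` satisfying `Q` to `φ F`. -/
lemma IsDist.exists_move {p : Finset (Sym2 V) → ℝ} (hp : IsDist p)
    (φ : Finset (Sym2 V) → Finset (Sym2 V)) (Q : Finset (Sym2 V) → Prop) {m : ℝ} (hm0 : 0 ≤ m)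
    (hm : m ≤ expect p fun F => if Q F then 1 else 0) :
    ∃ p', IsDist p' ∧ ∀ (g : Finset (Sym2 V) → ℝ) (k : ℝ), (∀ F, Q F → g (φ F) ≤ g F + k) →
      expect p' g ≤ expect p g + k * m := by
  set μ := expect p fun F => if Q F then 1 else 0 with hμ
  have hμ0 : 0 ≤ μ := hm0.trans hm
  set θ := m / μ with hθ
  have hθ0 : 0 ≤ θ := by positivity
  have hθ1 : θ ≤ 1 := div_le_one_of_le₀ hm hμ0
  have hθm : θ * μ = m := by
    rcases hμ0.eq_or_lt with h | h
    · rw [← h, mul_zero]; linarith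
    · exact div_mul_cancel₀ _ h.ne'
  let p' : Finset (Sym2 V) → ℝ := fun G => ∑ F, p F *
    (if Q F then (1 - θ) * (if G = F then 1 else 0) + θ * (if G = φ F then 1 else 0)
      else if G = F then 1 else 0)
  have hE : ∀ g, expect p' g = expect p fun F => if Q F then (1 - θ) * g F + θ * g (φ F) else g F := by
    intro g
    simp only [expect, p', Finset.sum_mul]
    rw [Finset.sum_comm]
    refine Finset.sum_congr rfl fun F _ => ?_
    simp only [mul_assoc, ← Finset.mul_sum]
    congr 1
    split_ifs with h
    · simp only [add_mul, mul_assoc, Finset.sum_add_distrib, ← Finset.mul_sum, ite_mul, one_mul,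
        zero_mul, Finset.sum_ite_eq', Finset.mem_univ, if_true]
    · simp only [ite_mul, one_mul, zero_mul, Finset.sum_ite_eq', Finset.mem_univ, if_true]
  refine ⟨p', ⟨?_, ?_⟩, ?_⟩
  · intro G
    refine Finset.sum_nonneg fun F _ => mul_nonneg (hp.nonneg F) ?_
    have : 0 ≤ 1 - θ := by linarith
    split_ifs <;> positivity
  · have := hE fun _ => 1
    simp only [expect, mul_one] at this
    rw [this]
    refine (Finset.sum_congr rfl fun F _ => ?_).trans hp.total
    split_ifs <;> ring
  · intro g k hk
    rw [hE, ← hθm, hμ]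
    have : expect p g + k * (θ * expect p fun F => if Q F then 1 else 0) =
        expect p fun F => g F + k * θ * if Q F then 1 else 0 := by
      simp only [expect, mul_add, Finset.sum_add_distrib, Finset.mul_sum]
      congr 1
      exact Finset.sum_congr rfl fun F _ => by ring
    rw [this]
    refine expect_mono hp fun F => ?_
    split_ifs with h
    · have := mul_le_mul_of_nonneg_left (hk F h) hθ0
      linarith
    · simp

open scoped Classical in
/-- The probability that `e` is used. -/
noncomputable def usage (p : Finset (Sym2 V) → ℝ) (e : Sym2 V) : ℝ :=
  expect p fun F => if e ∈ F then 1 else 0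

open scoped Classical in
/-- The probability that `u` is connected to `r`. -/
noncomputable def cover (r : V) (p : Finset (Sym2 V) → ℝ) (u : V) : ℝ :=
  expect p fun F => if Conn F r u then 1 else 0

lemma usage_nonneg {p : Finset (Sym2 V) → ℝ} (hp : IsDist p) (e : Sym2 V) : 0 ≤ usage p e := by
  refine Finset.sum_nonneg fun F _ => mul_nonneg (hp.nonneg F) ?_
  beta_reduce
  split_ifs <;> norm_num

lemma cover_nonneg (r : V) {p : Finset (Sym2 V) → ℝ} (hp : IsDist p) (u : V) : 0 ≤ cover r p u := by
  refine Finset.sum_nonneg fun F _ => mul_nonneg (hp.nonneg F) ?_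
  beta_reduce
  split_ifs <;> norm_num

lemma cover_self (r : V) {p : Finset (Sym2 V) → ℝ} (hp : IsDist p) : cover r p r = 1 := by
  unfold cover expect
  simp only [Conn.refl, if_true, mul_one, hp.total]

lemma expect_starDeg (p : Finset (Sym2 V) → ℝ) (v : V) :
    expect p (starDeg v) = ∑ u ∈ Finset.univ.erase v, usage p s(v, u) := by
  simp only [expect, starDeg, usage, Finset.mul_sum]
  rw [Finset.sum_comm]

lemma move_detour {p : Finset (Sym2 V) → ℝ} (hp : IsDist p) (r : V) {v a b : V} (hav : a ≠ v)
    (hbv : b ≠ v) {m : ℝ} (hm0 : 0 ≤ m) (hm : m ≤ usage p s(a, b)) :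
    ∃ p', IsDist p' ∧ (∀ u, cover r p u ≤ cover r p' u) ∧
      usage p' s(a, b) ≤ usage p s(a, b) - m ∧
      (∀ e, usage p' e ≤ usage p e + m) ∧
      (∀ e, e ≠ s(v, a) → e ≠ s(v, b) → usage p' e ≤ usage p e) ∧
      expect p' (starDeg v) - cover r p' v ≤ expect p (starDeg v) - cover r p v + m := by
  classical
  choose φ f1 f2 f3 f4 using fun F => exists_detour F r hav hbv
  obtain ⟨p', hp', hmove⟩ := hp.exists_move φ (fun F => s(a, b) ∈ F) hm0 (by unfold usage at hm; convert hm)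
  refine ⟨p', hp', ?_, ?_, ?_, ?_, ?_⟩
  · intro u
    have := hmove (fun F => - if Conn F r u then 1 else 0) 0 (by
      intro F _
      rw [add_zero, neg_le_neg_iff]
      by_cases h : Conn F r u
      · rw [if_pos h, if_pos (f1 F u h)]
      · rw [if_neg h]; split_ifs <;> norm_num)
    rw [expect_neg, expect_neg] at this
    change - cover r p' u ≤ - cover r p u + _ at this
    linarith
  · have := hmove (fun F => if s(a, b) ∈ F then 1 else 0) (-1) (by
      intro F h
      rw [if_pos h, if_neg (f2 F)]; norm_num)
    change usage p' _ ≤ usage p _ + _ at this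
    linarith
  · intro e
    have := hmove (fun F => if e ∈ F then 1 else 0) 1 (by
      intro F _
      split_ifs <;> norm_num)
    change usage p' _ ≤ usage p _ + _ at this
    linarith
  · intro e h1 h2
    have := hmove (fun F => if e ∈ F then 1 else 0) 0 (by
      intro F _
      by_cases h : e ∈ φ F
      · have := ((f3 F e h).resolve_right (by tauto))
        rw [if_pos h, if_pos this]; norm_num
      · rw [if_neg h]; split_ifs <;> norm_num)
    change usage p' _ ≤ usage p _ + _ at this
    linarith
  · have := hmove (fun F => starDeg v F - if Conn F r v then 1 else 0) 1 (fun F _ => f4 F)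
    rw [expect_sub, expect_sub, one_mul] at this
    exact this

lemma move_leaf {p : Finset (Sym2 V) → ℝ} (hp : IsDist p) (r : V) {v u : V} {m : ℝ}
    (hm0 : 0 ≤ m) (hm : m ≤ cover r p u - cover r p v) :
    ∃ p', IsDist p' ∧ (∀ x, cover r p x ≤ cover r p' x) ∧ cover r p v + m ≤ cover r p' v ∧
      usage p' s(v, u) = usage p s(v, u) + m ∧
      (∀ e, e ≠ s(v, u) → usage p' e = usage p e) ∧
      expect p' (starDeg v) ≤ expect p (starDeg v) + m := by
  classical
  obtain ⟨p', hp', hmove⟩ := hp.exists_move (fun F => insert s(v, u) F)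
    (fun F => Conn F r u ∧ ¬ Conn F r v) hm0 (by
      refine hm.trans ?_
      unfold cover
      rw [← expect_sub]
      refine expect_mono hp fun F => ?_
      by_cases h1 : Conn F r u <;> by_cases h2 : Conn F r v <;> simp [h1, h2])
  have hnot : ∀ F, Conn F r u ∧ ¬ Conn F r v → s(v, u) ∉ F := fun F h h' =>
    h.2 (h.1.trans (Conn.edge h').symm)
  refine ⟨p', hp', ?_, ?_, ?_, ?_, ?_⟩
  · intro x
    have := hmove (fun F => - if Conn F r x then 1 else 0) 0 (by
      intro F _
      rw [add_zero, neg_le_neg_iff]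
      by_cases h : Conn F r x
      · rw [if_pos h, if_pos (h.mono (Finset.subset_insert _ _))]
      · rw [if_neg h]; split_ifs <;> norm_num)
    rw [expect_neg, expect_neg] at this
    change - cover r p' x ≤ - cover r p x + _ at this
    linarith
  · have := hmove (fun F => - if Conn F r v then 1 else 0) (-1) (by
      intro F h
      have h' : Conn (insert s(v, u) F) r v := (h.1.mono (Finset.subset_insert _ _)).trans
        (Conn.edge (Finset.mem_insert_self _ _)).symm
      rw [if_pos h', if_neg h.2]; norm_num)
    rw [expect_neg, expect_neg] at this
    change - cover r p' v ≤ - cover r p v + _ at this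
    linarith
  · have h1 := hmove (fun F => if s(v, u) ∈ F then 1 else 0) 1 (by
      intro F h
      rw [if_pos (Finset.mem_insert_self _ _)]
      split_ifs <;> norm_num)
    have h2 := hmove (fun F => - if s(v, u) ∈ F then 1 else 0) (-1) (by
      intro F h
      rw [if_pos (Finset.mem_insert_self _ _), if_neg (hnot F h)]
      norm_num)
    rw [expect_neg, expect_neg] at h2
    change usage p' _ ≤ usage p _ + _ at h1
    change - usage p' _ ≤ - usage p _ + _ at h2
    linarith
  · intro e he
    have hmem : ∀ F, e ∈ insert s(v, u) F ↔ e ∈ F := fun F => by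
      rw [Finset.mem_insert, or_iff_right he]
    have h1 := hmove (fun F => if e ∈ F then 1 else 0) 0 (by
      intro F h
      simp only [hmem, add_zero, le_refl])
    have h2 := hmove (fun F => - if e ∈ F then 1 else 0) 0 (by
      intro F h
      simp only [hmem, add_zero, le_refl])
    rw [expect_neg, expect_neg] at h2
    change usage p' _ ≤ usage p _ + _ at h1
    change - usage p' _ ≤ - usage p _ + _ at h2
    linarith
  · have := hmove (starDeg v) 1 (fun F _ => starDeg_insert_le F v u)
    linarith

end Forest
section ForestDistribution
variable {V : Type*} [Fintype V] [DecidableEq V]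

lemma sym2_ne_star {v a b d : V} (ha : a ≠ v) (hb : b ≠ v) : s(a, b) ≠ s(v, d) := by
  intro h
  rcases Sym2.eq_iff.1 h with ⟨h, -⟩ | ⟨-, h⟩
  exacts [ha h, hb h]

lemma star_ne_star {v a d : V} (h : a ≠ d) : s(v, a) ≠ s(v, d) := by
  intro h'
  rcases Sym2.eq_iff.1 h' with ⟨-, h'⟩ | ⟨h1, h2⟩
  · exact h h'
  · exact h (h2.trans h1)

/-- Undoing the splitting `s` at `v`, pair by pair. -/
lemma exists_unsplit {r v : V} {w s : V → V → ℝ} (hw : ∀ a b, 0 ≤ w a b)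
    (hws : ∀ a b, w a b = w b a) (hs : ∀ a b, 0 ≤ s a b) {p : Finset (Sym2 V) → ℝ} (hp : IsDist p)
    (hp1 : ∀ a b, a ≠ b → a ≠ v → b ≠ v → usage p s(a, b) ≤ w a b + s a b + s b a)
    (hp2 : ∀ u, u ≠ v → usage p s(v, u) ≤ 0) (P : Finset (V × V))
    (hP : ∀ q ∈ P, q.1 ≠ q.2 ∧ q.1 ≠ v ∧ q.2 ≠ v) :
    ∃ p', IsDist p' ∧ (∀ u, cover r p u ≤ cover r p' u) ∧
      (∀ a b, a ≠ b → a ≠ v → b ≠ v → usage p' s(a, b) ≤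
        w a b + (if (a, b) ∈ P then 0 else s a b) + (if (b, a) ∈ P then 0 else s b a)) ∧
      (∀ u, u ≠ v → usage p' s(v, u) ≤
        ∑ q ∈ P, ((if q.1 = u then s q.1 q.2 else 0) + if q.2 = u then s q.1 q.2 else 0)) ∧
      expect p' (starDeg v) - cover r p' v ≤ ∑ q ∈ P, s q.1 q.2 := by
  induction P using Finset.induction_on with
  | empty =>
    refine ⟨p, hp, fun _ => le_rfl, ?_, ?_, ?_⟩
    · simpa using hp1
    · simpa using hp2
    · rw [expect_starDeg, Finset.sum_empty]
      have h1 := Finset.sum_nonpos fun u (hu : u ∈ Finset.univ.erase v) =>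
        hp2 u (Finset.ne_of_mem_erase hu)
      have h2 := cover_nonneg r hp v
      linarith
  | insert q P hq ih =>
    obtain ⟨a, b⟩ := q
    obtain ⟨p₁, i1, i2, i3, i4, i5⟩ := ih fun q h => hP q (Finset.mem_insert_of_mem h)
    obtain ⟨hab, hav, hbv⟩ := hP (a, b) (Finset.mem_insert_self _ _)
    dsimp only at hab hav hbv
    set T := w a b + (if (b, a) ∈ P then 0 else s b a) with hT
    have hT0 : 0 ≤ T := by
      have := hw a b
      have := hs b a
      rw [hT]; split_ifs <;> positivity
    have hu0 := usage_nonneg i1 s(a, b)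
    have huT : usage p₁ s(a, b) ≤ T + s a b := by
      have := i3 a b hab hav hbv
      rw [if_neg hq] at this
      linarith
    obtain ⟨m, m0, m1, m2, m3⟩ : ∃ m, 0 ≤ m ∧ m ≤ usage p₁ s(a, b) ∧ m ≤ s a b ∧
        usage p₁ s(a, b) - m ≤ T := by
      have := hs a b
      refine ⟨max 0 (usage p₁ s(a, b) - T), le_max_left _ _, max_le hu0 (by linarith),
        max_le this (by linarith), ?_⟩
      have := le_max_right 0 (usage p₁ s(a, b) - T)
      linarith
    obtain ⟨p₂, j1, j2, j3, j4, j5, j6⟩ := move_detour i1 r hav hbv m0 m1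
    refine ⟨p₂, j1, fun u => (i2 u).trans (j2 u), ?_, ?_, ?_⟩
    · intro a' b' hab' hav' hbv'
      by_cases he : s(a', b') = s(a, b)
      · rw [he]
        refine (j3.trans m3).trans ?_
        rcases Sym2.eq_iff.1 he with ⟨rfl, rfl⟩ | ⟨rfl, rfl⟩
        · have h1 : (b', a') ∈ insert (a', b') P ↔ (b', a') ∈ P := by
            simp [Ne.symm hab]
          simp only [Finset.mem_insert_self, if_true, h1, hT]
          linarith
        · have h1 : (a', b') ∈ insert (b', a') P ↔ (a', b') ∈ P := by
            simp [Ne.symm hab]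
          simp only [Finset.mem_insert_self, if_true, h1, hT, hws b' a']
          linarith
      · have h1 : (a', b') ∈ insert (a, b) P ↔ (a', b') ∈ P := by
          rw [Finset.mem_insert, or_iff_right]
          intro h
          obtain ⟨h1, h2⟩ := Prod.mk.inj h
          exact he (by rw [h1, h2])
        have h2 : (b', a') ∈ insert (a, b) P ↔ (b', a') ∈ P := by
          rw [Finset.mem_insert, or_iff_right]
          intro h
          obtain ⟨h1, h2⟩ := Prod.mk.inj h
          exact he (by rw [h1, h2]; exact Sym2.eq_swap)
        simp only [h1, h2]
        exact (j5 _ (sym2_ne_star hav' hbv') (sym2_ne_star hav' hbv')).trans (i3 a' b' hab' hav' hbv')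
    · intro u hu
      rw [Finset.sum_insert hq]
      have hi := i4 u hu
      have hs' := hs a b
      by_cases h : u = a ∨ u = b
      · have h1 := j4 s(v, u)
        have h2 : s a b ≤ (if a = u then s a b else 0) + if b = u then s a b else 0 := by
          rcases h with rfl | rfl
          · rw [if_pos rfl]; split_ifs <;> linarith
          · rw [if_pos rfl (c := u = u)]; split_ifs <;> linarith
        dsimp only
        linarith
      · push Not at h
        have h1 := j5 s(v, u) (star_ne_star h.1) (star_ne_star h.2)
        rw [if_neg h.1.symm, if_neg h.2.symm]
        linarith
    · rw [Finset.sum_insert hq]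
      dsimp only
      linarith

/-- Attaching `v` as a leaf until it is covered often enough. -/
lemma exists_attach {r v : V} {w : V → V → ℝ} {y : V → ℝ} {A : Finset V}
    (hA : ∀ u, u ∉ A → w v u = 0)
    {p : Finset (Sym2 V) → ℝ} (hp : IsDist p) (hcov : ∀ u ∈ A, u ≠ v → y v ≤ cover r p u)
    (hp1 : ∀ a b, a ≠ b → a ≠ v → b ≠ v → usage p s(a, b) ≤ w a b)
    (hp2 : ∀ u, u ≠ v → usage p s(v, u) ≤ w v u)
    (hp3 : expect p (starDeg v) ≤ cover r p v + y v)
    (P : Finset V) (hP : v ∉ P) :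
    ∃ p', IsDist p' ∧ (∀ u, cover r p u ≤ cover r p' u) ∧
      (∀ a b, a ≠ b → a ≠ v → b ≠ v → usage p' s(a, b) ≤ w a b) ∧
      (∀ u, u ≠ v → usage p' s(v, u) ≤ w v u) ∧
      expect p' (starDeg v) ≤ cover r p' v + y v ∧
      (y v ≤ cover r p' v ∨ ∀ u ∈ P, w v u ≤ usage p' s(v, u)) := by
  induction P using Finset.induction_on with
  | empty => exact ⟨p, hp, fun _ => le_rfl, hp1, hp2, hp3, Or.inr (by simp)⟩
  | insert u P hu ih =>
    obtain ⟨p₁, i1, i2, i3, i4, i5, i6⟩ := ih fun h => hP (Finset.mem_insert_of_mem h)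
    have huv : u ≠ v := by rintro rfl; exact hP (Finset.mem_insert_self _ _)
    rcases i6 with i6 | i6
    · exact ⟨p₁, i1, i2, i3, i4, i5, Or.inl i6⟩
    by_cases huA : u ∈ A
    · by_cases hyv : y v ≤ cover r p₁ v
      · exact ⟨p₁, i1, i2, i3, i4, i5, Or.inl hyv⟩
      push Not at hyv
      have hcu := (hcov u huA huv).trans (i2 u)
      have hwu := i4 u huv
      obtain ⟨m, m0, m1, m2, m3⟩ : ∃ m, 0 ≤ m ∧ m ≤ w v u - usage p₁ s(v, u) ∧
          m ≤ y v - cover r p₁ v ∧ (m = w v u - usage p₁ s(v, u) ∨ m = y v - cover r p₁ v) :=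
        ⟨min (w v u - usage p₁ s(v, u)) (y v - cover r p₁ v), le_min (by linarith) (by linarith),
          min_le_left _ _, min_le_right _ _, min_choice _ _⟩
      obtain ⟨p₂, j1, j2, j3, j4, j5, j6⟩ := move_leaf i1 r (v := v) (u := u) m0 (by linarith)
      have hne : ∀ u' ∈ P, usage p₂ s(v, u') = usage p₁ s(v, u') := fun u' h' =>
        j5 _ (star_ne_star (by rintro rfl; exact hu h'))
      refine ⟨p₂, j1, fun x => (i2 x).trans (j2 x), ?_, ?_, by linarith, ?_⟩
      · intro a b hab hav hbv
        rw [j5 _ (sym2_ne_star hav hbv)]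
        exact i3 a b hab hav hbv
      · intro u' hu'
        by_cases h : u' = u
        · subst h; rw [j4]; linarith
        · rw [j5 _ (star_ne_star h)]; exact i4 u' hu'
      · rcases m3 with m3 | m3
        · right
          intro u' hu'
          rcases Finset.mem_insert.1 hu' with rfl | hu'
          · rw [j4]; linarith
          · rw [hne u' hu']; exact i6 u' hu'
        · left; linarith
    · refine ⟨p₁, i1, i2, i3, i4, i5, Or.inr fun u' hu' => ?_⟩
      rcases Finset.mem_insert.1 hu' with rfl | hu'
      · rw [hA _ huA]; exact usage_nonneg i1 _
      · exact i6 u' hu'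

/-- A level weight dominates a distribution of edge sets covering each vertex as demanded. -/
theorem IsLevelWeight.exists_forest_distribution {r : V} {y : V → ℝ} {A : Finset V}
    {w : V → V → ℝ} (h : IsLevelWeight r y A w) (hy : ∀ u, 0 ≤ y u) (hyr : y r = 1)
    (hy1 : ∀ u, y u ≤ 1) (hr : r ∈ A) :
    ∃ p, IsDist p ∧ (∀ a b, a ≠ b → usage p s(a, b) ≤ w a b) ∧ ∀ u ∈ A, y u ≤ cover r p u := by
  rcases (A.erase r).eq_empty_or_nonempty with hA | hA
  · have hp : IsDist (Pi.single (∅ : Finset (Sym2 V)) (1 : ℝ)) := by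
      refine ⟨fun F => ?_, by simp⟩
      by_cases hF : F = ∅
      · subst hF; simp
      · simp [hF]
    refine ⟨_, hp, ?_, ?_⟩
    · intro a b _
      have : usage (Pi.single (∅ : Finset (Sym2 V)) (1 : ℝ)) s(a, b) = 0 := by
        refine Finset.sum_eq_zero fun F _ => ?_
        by_cases hF : F = ∅
        · subst hF; simp
        · simp [hF]
      rw [this]
      exact h.nonneg a b
    · intro u hu
      have hur : u = r := by
        by_contra hne
        have : u ∈ A.erase r := Finset.mem_erase.2 ⟨hne, hu⟩
        rw [hA] at this
        simp at this
      rw [hur, cover_self r hp, hyr]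
  · obtain ⟨v, hv, hmin⟩ := Finset.exists_min_image (A.erase r) y hA
    obtain ⟨hvr, hvA⟩ := Finset.mem_erase.1 hv
    obtain ⟨s, s1, s2, s3, s4⟩ := h.exists_split hy hvr
    have hlt : (A.erase v).card < A.card := Finset.card_erase_lt_of_mem hvA
    obtain ⟨p, p1, p2, p3⟩ := IsLevelWeight.exists_forest_distribution s4 hy hyr hy1
      (Finset.mem_erase.2 ⟨hvr.symm, hr⟩)
    have hdeg : ∑ u ∈ Finset.univ.erase v, w v u = wcut w {v} := by
      rw [wcut_singleton, ← Finset.sum_filter]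
      refine Finset.sum_congr ?_ fun _ _ => rfl
      ext; simp
    have hdeg1 := h.deg v hvA hvr
    have hdeg2 := h.cut {v} (by simpa using hvr.symm) v (by simp) hvA
    obtain ⟨q, q1, q2, q3, q4, q5⟩ := exists_unsplit (r := r) h.nonneg h.symm s1 p1 (by
        intro a b hab hav hbv
        have := p2 a b hab
        rwa [splitWeight, if_neg hav, if_neg hbv] at this) (by
        intro u hu
        have := p2 v u hu.symm
        rwa [splitWeight_eq_zero s3 (Or.inl rfl)] at this)
      (Finset.univ.filter fun q : V × V => q.1 ≠ q.2 ∧ q.1 ≠ v ∧ q.2 ≠ v)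
      (fun q hq => (Finset.mem_filter.1 hq).2)
    have hsum : ∑ q ∈ Finset.univ.filter (fun q : V × V => q.1 ≠ q.2 ∧ q.1 ≠ v ∧ q.2 ≠ v),
        s q.1 q.2 ≤ y v := by
      have e1 : ∑ u, ∑ c, (s u c + s c u) = ∑ u ∈ Finset.univ.erase v, w v u := by
        rw [← Finset.add_sum_erase _ _ (Finset.mem_univ v), Finset.sum_eq_zero, zero_add]
        · exact Finset.sum_congr rfl fun u hu => s3 u (Finset.ne_of_mem_erase hu)
        · intro c _
          rw [s2 v c (Or.inl rfl), s2 c v (Or.inr rfl), zero_add]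
      have e2 : ∑ u, ∑ c, (s u c + s c u) = 2 * ∑ q : V × V, s q.1 q.2 := by
        rw [Fintype.sum_prod_type, two_mul]
        simp only [Finset.sum_add_distrib]
        congr 1
        exact Finset.sum_comm
      have e3 := Finset.sum_le_sum_of_subset_of_nonneg
        (Finset.filter_subset (fun q : V × V => q.1 ≠ q.2 ∧ q.1 ≠ v ∧ q.2 ≠ v) Finset.univ)
        (f := fun q => s q.1 q.2) fun q _ _ => s1 q.1 q.2
      linarith
    obtain ⟨t, t1, t2, t3, t4, t5, t6⟩ := exists_attach (r := r) (w := w) (y := y) (A := A) (v := v)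
      (fun u hu => by rw [h.symm]; exact h.supp u v hu) q1 (by
        intro u huA huv
        refine le_trans ?_ ((p3 u (Finset.mem_erase.2 ⟨huv, huA⟩)).trans (q2 u))
        by_cases hur : u = r
        · rw [hur, hyr]; exact hy1 v
        · exact hmin u (Finset.mem_erase.2 ⟨hur, huA⟩)) (by
        intro a b hab hav hbv
        have := q3 a b hab hav hbv
        simpa [hab, hab.symm, hav, hbv] using this) (by
        intro u hu
        refine (q4 u hu).trans ?_
        rw [← s3 u hu]
        refine (Finset.sum_le_sum_of_subset_of_nonneg (Finset.filter_subset _ _) fun q _ _ => ?_).trans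
          (le_of_eq ?_)
        · have := s1 q.1 q.2
          split_ifs <;> positivity
        · rw [Finset.sum_add_distrib, Finset.sum_add_distrib, Fintype.sum_prod_type,
            Fintype.sum_prod_type]
          congr 1
          · rw [Finset.sum_eq_single u (fun a _ ha => by simp [ha]) (by simp)]
            simp
          · simp) (by linarith)
      (Finset.univ.erase v) (Finset.notMem_erase _ _)
    refine ⟨t, t1, ?_, ?_⟩
    · intro a b hab
      by_cases hav : a = v
      · subst hav; exact t4 b hab.symm
      · by_cases hbv : b = v
        · subst hbv
          rw [Sym2.eq_swap, h.symm]
          exact t4 a hab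
        · exact t3 a b hab hav hbv
    · intro u hu
      by_cases huv : u = v
      · subst huv
        rcases t6 with t6 | t6
        · exact t6
        · have := Finset.sum_le_sum t6
          rw [← expect_starDeg] at this
          linarith
      · exact (p3 u (Finset.mem_erase.2 ⟨huv, hu⟩)).trans ((q2 u).trans (t2 u))
termination_by A.card

end ForestDistribution
section LevelBound
variable {V : Type*} [Fintype V] [DecidableEq V]

/-- The expected cost of a random edge set is at most the cost of a weight dominating its usage. -/
lemma expect_cost_le {c w : V → V → ℝ} (hc : IsPseudoMetric c) (p : Finset (Sym2 V) → ℝ)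
    (hp : ∀ a b, a ≠ b → usage p s(a, b) ≤ w a b) :
    expect p (fun F => ∑ e ∈ F with ¬ e.IsDiag, symCost c e) ≤ pairCost c w / 2 := by
  have h1 : ∀ F : Finset (Sym2 V), ∑ e ∈ F with ¬ e.IsDiag, symCost c e =
      (∑ a, ∑ b, c a b * if s(a, b) ∈ F then 1 else 0) / 2 := by
    intro F
    have := pairCost_indicator (E := F.filter fun e => ¬ e.IsDiag)
      (fun e he => (Finset.mem_filter.1 he).2) (fun _ => 1) hc.symm
    simp only [mul_one] at this
    rw [eq_div_iff two_ne_zero, mul_comm, ← this]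
    refine Finset.sum_congr rfl fun a _ => Finset.sum_congr rfl fun b _ => ?_
    by_cases hab : a = b
    · subst hab; simp [hc.self]
    · simp [Finset.mem_filter, hab]
  have h2 : expect p (fun F => ∑ e ∈ F with ¬ e.IsDiag, symCost c e) =
      pairCost c (fun a b => usage p s(a, b)) / 2 := by
    unfold expect pairCost usage expect
    simp only [h1, ← mul_div_assoc]
    rw [← Finset.sum_div]
    congr 1
    simp only [Finset.mul_sum]
    rw [Finset.sum_comm]
    refine Finset.sum_congr rfl fun a _ => ?_
    rw [Finset.sum_comm]
    refine Finset.sum_congr rfl fun b _ => Finset.sum_congr rfl fun F _ => ?_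
    ring
  rw [h2]
  refine div_le_div_of_nonneg_right (Finset.sum_le_sum fun a _ => Finset.sum_le_sum fun b _ => ?_)
    two_pos.le
  by_cases hab : a = b
  · subst hab; simp [hc.self]
  · exact mul_le_mul_of_nonneg_left (hp a b hab) (hc.nonneg a b)

/-- The bound on the best tour obtained from a single threshold `σ`. -/
theorem IsLevelWeight.le_of_threshold {c w : V → V → ℝ} {π y : V → ℝ} {r : V} {σ α φ B : ℝ}
    (h : IsLevelWeight r y Finset.univ w) (hc : IsPseudoMetric c) (hα : 0 ≤ α) (hφ : 0 ≤ φ)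
    (hσ : 1 ≤ 2 * α * σ + 3 * φ) (hαφ : 1 - 2 * α ≤ φ) (hσ1 : σ < 1)
    (hπ : ∀ v, 0 ≤ π v) (hy : ∀ v, 0 ≤ y v) (hyr : y r = 1) (hy1 : ∀ v, y v ≤ 1)
    (hB : ∀ l : List V, (r :: l).Nodup →
      B ≤ walkCost c r (l ++ [r]) + ∑ v ∈ Finset.univ \ (r :: l).toFinset, π v) :
    B ≤ (1 + φ + α) * (pairCost c w / 2) + ∑ v, π v *
      (1 - if σ ≤ y v then y v * (1 + φ) / max (2 - 2 * α * y v) (1 + φ) else 0) := by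
  classical
  obtain ⟨w', h', hw'⟩ := h.exists_restrict hc hy (σ := σ) (by rw [hyr]; exact hσ1.le)
  obtain ⟨p, hp, hp1, hp2⟩ := h'.exists_forest_distribution hy hyr hy1
    (by simp [hyr, hσ1.le])
  have hcost := (expect_cost_le hc p hp1).trans (div_le_div_of_nonneg_right hw' two_pos.le)
  set K := 1 + φ with hK
  have hK0 : 0 ≤ K := by positivity
  set k : V → ℝ := fun v => K / max (2 - 2 * α * y v) K with hk
  have hk0 : ∀ v, 0 ≤ k v := fun v => div_nonneg hK0 (le_max_of_le_right hK0)
  have key : ∀ F, p F * B ≤ p F * (K * (∑ e ∈ F with ¬ e.IsDiag, symCost c e) +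
      α * pairCost c w / 2 + ∑ v, π v * (1 - k v * if Conn F r v then 1 else 0)) := by
    intro F
    rcases (hp.nonneg F).eq_or_lt with h0 | h0
    · simp [← h0]
    refine mul_le_mul_of_nonneg_left ?_ h0.le
    have hF : ∀ e ∈ F.filter (fun e => ¬ e.IsDiag), ∀ v ∈ e, σ ≤ y v := by
      intro e he v hv
      obtain ⟨he1, he2⟩ := Finset.mem_filter.1 he
      obtain ⟨b, rfl⟩ := hv
      have hvb : v ≠ b := by simpa using he2
      by_contra hlt
      have hw0 : w' v b = 0 := h'.supp v b (by simpa using hlt)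
      have hu := hp1 v b hvb
      have : p F ≤ usage p s(v, b) := by
        have := Finset.single_le_sum (f := fun F => p F * if s(v, b) ∈ F then (1 : ℝ) else 0)
          (fun F _ => mul_nonneg (hp.nonneg F) (by split_ifs <;> norm_num)) (Finset.mem_univ F)
        beta_reduce at this
        rwa [if_pos he1, mul_one] at this
      linarith
    have hgr : SimpleGraph.fromEdgeSet ((F.filter fun e => ¬ e.IsDiag : Finset (Sym2 V)) :
        Set (Sym2 V)) = SimpleGraph.fromEdgeSet (F : Set (Sym2 V)) := by
      ext a b
      simp only [SimpleGraph.fromEdgeSet_adj, Finset.coe_filter, Set.mem_ofPred_eq, Finset.mem_coe,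
        Sym2.mk_isDiag_iff]
      tauto
    have := le_of_forest (B := B) hc h.nonneg h.symm hα hφ hσ hαφ hσ1 hπ hyr hy1
      (fun S hS u hu _ => h.cut S hS u hu (Finset.mem_univ _)) hB _ hF
      (Finset.univ.filter fun v => Conn F r v) (by intro v; rw [hgr, Finset.mem_filter_univ]; rfl)
    refine this.trans (add_le_add le_rfl (Finset.sum_le_sum fun v _ => ?_))
    refine mul_le_mul_of_nonneg_left ?_ (hπ v)
    simp [hk, hK]
  have hsum := Finset.sum_le_sum fun F (_ : F ∈ Finset.univ) => key F
  rw [← Finset.sum_mul, hp.total, one_mul] at hsum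
  have hexp : ∑ F, p F * (K * (∑ e ∈ F with ¬ e.IsDiag, symCost c e) +
      α * pairCost c w / 2 + ∑ v, π v * (1 - k v * if Conn F r v then 1 else 0)) =
      K * expect p (fun F => ∑ e ∈ F with ¬ e.IsDiag, symCost c e) +
        α * pairCost c w / 2 + ∑ v, π v * (1 - k v * cover r p v) := by
    have e1 : ∑ v, π v * (1 - k v * cover r p v) =
        ∑ F, p F * ∑ v, π v * (1 - k v * if Conn F r v then 1 else 0) := by
      simp only [Finset.mul_sum]
      rw [Finset.sum_comm]
      refine Finset.sum_congr rfl fun v _ => ?_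
      unfold cover expect
      have : (1 : ℝ) = ∑ F, p F := hp.total.symm
      rw [Finset.mul_sum]
      nth_rewrite 1 [this]
      rw [← Finset.sum_sub_distrib, Finset.mul_sum]
      refine Finset.sum_congr rfl fun F _ => ?_
      ring
    have e2 : α * pairCost c w / 2 = ∑ F, p F * (α * pairCost c w / 2) := by
      rw [← Finset.sum_mul, hp.total, one_mul]
    have e3 : K * expect p (fun F => ∑ e ∈ F with ¬ e.IsDiag, symCost c e) =
        ∑ F, p F * (K * (∑ e ∈ F with ¬ e.IsDiag, symCost c e)) := by
      unfold expect
      rw [Finset.mul_sum]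
      exact Finset.sum_congr rfl fun F _ => by ring
    simp only [mul_add, Finset.sum_add_distrib]
    rw [← e1, ← e2, ← e3]
  rw [hexp] at hsum
  have h4 := mul_le_mul_of_nonneg_left hcost hK0
  have h5 : ∑ v, π v * (1 - k v * cover r p v) ≤
      ∑ v, π v * (1 - if σ ≤ y v then y v * K / max (2 - 2 * α * y v) K else 0) := by
    refine Finset.sum_le_sum fun v _ => mul_le_mul_of_nonneg_left ?_ (hπ v)
    split_ifs with hv
    · have := mul_le_mul_of_nonneg_left (hp2 v (by simpa using hv)) (hk0 v)
      have e : y v * K / max (2 - 2 * α * y v) K = k v * y v := by simp only [hk]; ring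
      rw [e]; linarith
    · have := mul_nonneg (hk0 v) (cover_nonneg r hp v)
      linarith
  have h6 : (K + α) * (pairCost c w / 2) = K * (pairCost c w / 2) + α * pairCost c w / 2 := by ring
  linarith

end LevelBound
section Mixture

/-- Parameters of a single-threshold rounding: the threshold, the multiplier of the fractional
solution, the least multiplier of a forest edge, and the weight of this rounding in the mixture. -/
structure Rounding where
  /-- the threshold -/
  threshold : ℝ
  /-- the multiplier of the fractional solution -/
  mult : ℝ
  /-- the least multiplier of a forest edge -/
  floor : ℝ
  /-- the weight in the mixture -/
  weight : ℝ

namespace Rounding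

/-- The guaranteed coverage of a vertex of level `s`. -/
noncomputable def coverage (a : Rounding) (s : ℝ) : ℝ :=
  if a.threshold ≤ s then s * (1 + a.floor) / max (2 - 2 * a.mult * s) (1 + a.floor) else 0

/-- An affine lower bound for the coverage on an interval starting at `l`; on the convex part it is
the tangent at `m`. -/
noncomputable def affineBound (a : Rounding) (l m s : ℝ) : ℝ :=
  if a.threshold ≤ l then
    if 2 - 2 * a.mult * l ≤ 1 + a.floor then s
    else (1 + a.floor) * (s - a.mult * m ^ 2) / (2 * (1 - a.mult * m) ^ 2)
  else 0

/-- The conditions under which a rounding can be carried out. -/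
def Valid (a : Rounding) : Prop :=
  0 ≤ a.mult ∧ a.mult < 1 ∧ 0 ≤ a.floor ∧ 1 ≤ 2 * a.mult * a.threshold + 3 * a.floor ∧
    1 - 2 * a.mult ≤ a.floor ∧ a.threshold < 1 ∧ 0 ≤ a.weight

lemma Valid.affineBound_le_coverage {a : Rounding} (h : a.Valid) {l u m s : ℝ} (hl : 0 ≤ l)
    (hls : l ≤ s) (hsu : s ≤ u) (hm : m ≤ 1)
    (hb : 2 - 2 * a.mult * l ≤ 1 + a.floor ∨ 1 + a.floor ≤ 2 - 2 * a.mult * u) :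
    a.affineBound l m s ≤ a.coverage s := by
  obtain ⟨h1, h2, h3, -⟩ := h
  have hφ : 0 < 1 + a.floor := by linarith
  unfold affineBound coverage
  by_cases ht : a.threshold ≤ l
  · rw [if_pos ht, if_pos (ht.trans hls)]
    by_cases hl' : 2 - 2 * a.mult * l ≤ 1 + a.floor
    · have := mul_le_mul_of_nonneg_left hls h1
      rw [if_pos hl', max_eq_right (by linarith), mul_div_cancel_right₀ _ hφ.ne']
    · have hu := hb.resolve_left hl'
      have := mul_le_mul_of_nonneg_left hsu h1
      have hs : 0 < 2 - 2 * a.mult * s := by linarith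
      have hm' : 0 < 1 - a.mult * m := by nlinarith
      rw [if_neg hl', max_eq_left (by linarith), div_le_div_iff₀ (by positivity) hs]
      have h5 : 0 ≤ (1 + a.floor) * (a.mult * (s - m) ^ 2) := by positivity
      nlinarith
  · rw [if_neg ht]
    split_ifs
    · exact div_nonneg (mul_nonneg (hl.trans hls) hφ.le) (le_max_of_le_right hφ.le)
    · exact le_rfl

lemma affineBound_combo (a : Rounding) (l m p q s t : ℝ) (hst : s + t = 1) :
    a.affineBound l m (s * p + t * q) = s * a.affineBound l m p + t * a.affineBound l m q := by
  obtain rfl : t = 1 - s := by linarith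
  unfold affineBound
  split_ifs <;> ring

end Rounding

open Rounding

/-- The mixture of roundings. -/
noncomputable def mixture : List Rounding :=
  [⟨0.374, 0.38, 0.24, 0.1194⟩,
    ⟨0.396, 0.384, 0.232, 0.1297⟩,
    ⟨0.423, 0.388, 0.224, 0.1339⟩,
    ⟨0.456, 0.393, 0.214, 0.1088⟩,
    ⟨0.488, 0.398, 0.204, 0.0893⟩,
    ⟨0.519, 0.403, 0.194, 0.0759⟩,
    ⟨0.55, 0.408, 0.184, 0.0721⟩,
    ⟨0.585, 0.414, 0.172, 0.0601⟩,
    ⟨0.62, 0.42, 0.16, 0.0549⟩,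
    ⟨0.659, 0.428, 0.1453, 0.0421⟩,
    ⟨0.696, 0.435, 0.1315, 0.0394⟩,
    ⟨0.74, 0.45, 0.1114, 0.0322⟩,
    ⟨0.789, 0.47, 0.0862, 0.0242⟩,
    ⟨0.845, 0.4835, 0.061, 0.018⟩]

lemma mixture_valid : ∀ a ∈ mixture, a.Valid := by
  simp only [mixture, List.forall_mem_cons, Rounding.Valid]
  norm_num

lemma mixture_weight : (mixture.map fun a => a.weight).sum = 1 := by
  simp only [mixture, List.map_cons, List.map_nil, List.sum_cons, List.sum_nil]
  norm_num

lemma mixture_cost : (mixture.map fun a => a.weight * (1 + a.floor + a.mult)).sum ≤ 1.599 := by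
  simp only [mixture, List.map_cons, List.map_nil, List.sum_cons, List.sum_nil]
  norm_num

lemma list_affineBound_combo (L : List Rounding) (l m p q s t : ℝ) (hst : s + t = 1) :
    (L.map fun a => a.weight * a.affineBound l m (s * p + t * q)).sum =
      s * (L.map fun a => a.weight * a.affineBound l m p).sum +
        t * (L.map fun a => a.weight * a.affineBound l m q).sum := by
  induction L with
  | nil => simp
  | cons a L ih =>
    simp only [List.map_cons, List.sum_cons, ih, affineBound_combo a l m p q s t hst]
    ring

lemma mixture_coverage_of_endpoints (l u m : ℝ) (hl : 0 ≤ l) (hlu : l < u) (hm : m ≤ 1)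
    (hb : ∀ a ∈ mixture, 2 - 2 * a.mult * l ≤ 1 + a.floor ∨ 1 + a.floor ≤ 2 - 2 * a.mult * u)
    (h1 : 1.599 * l - 0.599 ≤ (mixture.map fun a => a.weight * a.affineBound l m l).sum)
    (h2 : 1.599 * u - 0.599 ≤ (mixture.map fun a => a.weight * a.affineBound l m u).sum)
    {s : ℝ} (hls : l ≤ s) (hsu : s ≤ u) :
    1.599 * s - 0.599 ≤ (mixture.map fun a => a.weight * a.coverage s).sum := by
  have hul : 0 < u - l := sub_pos.2 hlu
  have hs0 : 0 ≤ (s - l) / (u - l) := div_nonneg (sub_nonneg.2 hls) hul.le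
  have hs1 : 0 ≤ (u - s) / (u - l) := div_nonneg (sub_nonneg.2 hsu) hul.le
  have hone : (u - s) / (u - l) + (s - l) / (u - l) = 1 := by field_simp; ring
  have hs : s = (u - s) / (u - l) * l + (s - l) / (u - l) * u := by field_simp; ring
  have hle : (mixture.map fun a => a.weight * a.affineBound l m s).sum ≤
      (mixture.map fun a => a.weight * a.coverage s).sum :=
    List.sum_le_sum fun a ha => mul_le_mul_of_nonneg_left
      ((mixture_valid a ha).affineBound_le_coverage hl hls hsu hm (hb a ha))
      (mixture_valid a ha).2.2.2.2.2.2
  have hcombo := list_affineBound_combo mixture l m l u _ _ hone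
  rw [← hs] at hcombo
  have e1 := mul_le_mul_of_nonneg_left h1 hs1
  have e2 := mul_le_mul_of_nonneg_left h2 hs0
  calc 1.599 * s - 0.599 = (u - s) / (u - l) * (1.599 * l - 0.599) +
        (s - l) / (u - l) * (1.599 * u - 0.599) := by field_simp; ring
    _ ≤ (mixture.map fun a => a.weight * a.affineBound l m s).sum := by rw [hcombo]; linarith
    _ ≤ _ := hle

set_option maxHeartbeats 4000000 in
lemma mixture_coverage {s : ℝ} (h0 : 0 ≤ s) (h1 : s ≤ 1) :
    1.599 * s - 0.599 ≤ (mixture.map fun a => a.weight * a.coverage s).sum := by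
  have low : s ≤ 187 / 500 → 1.599 * s - 0.599 ≤
      (mixture.map fun a => a.weight * a.coverage s).sum := by
    intro h
    refine le_trans (by linarith) (List.sum_nonneg fun x hx => ?_)
    obtain ⟨a, ha, rfl⟩ := List.mem_map.1 hx
    have hv := mixture_valid a ha
    have hφ : 0 ≤ 1 + a.floor := by linarith [hv.2.2.1]
    refine mul_nonneg hv.2.2.2.2.2.2 ?_
    unfold Rounding.coverage
    split_ifs
    · exact div_nonneg (mul_nonneg h0 hφ) (le_max_of_le_right hφ)
    · exact le_rfl
  rcases le_total s (187 / 500) with hs | hs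
  · exact low hs
  rcases le_total s (99 / 250) with hs' | hs'
  · exact mixture_coverage_of_endpoints (187 / 500) (99 / 250) (2 / 5) (by norm_num)
      (by norm_num) (by norm_num) (by simp only [mixture, List.forall_mem_cons]; norm_num)
      (by norm_num [mixture, affineBound]) (by norm_num [mixture, affineBound]) hs hs'
  replace hs := hs'
  clear hs'
  rcases le_total s (423 / 1000) with hs' | hs'
  · exact mixture_coverage_of_endpoints (99 / 250) (423 / 1000) (2 / 5) (by norm_num)
      (by norm_num) (by norm_num) (by simp only [mixture, List.forall_mem_cons]; norm_num)
      (by norm_num [mixture, affineBound]) (by norm_num [mixture, affineBound]) hs hs'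
  replace hs := hs'
  clear hs'
  rcases le_total s (57 / 125) with hs' | hs'
  · exact mixture_coverage_of_endpoints (423 / 1000) (57 / 125) (9 / 20) (by norm_num)
      (by norm_num) (by norm_num) (by simp only [mixture, List.forall_mem_cons]; norm_num)
      (by norm_num [mixture, affineBound]) (by norm_num [mixture, affineBound]) hs hs'
  replace hs := hs'
  clear hs'
  rcases le_total s (61 / 125) with hs' | hs'
  · exact mixture_coverage_of_endpoints (57 / 125) (61 / 125) (1 / 2) (by norm_num)
      (by norm_num) (by norm_num) (by simp only [mixture, List.forall_mem_cons]; norm_num)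
      (by norm_num [mixture, affineBound]) (by norm_num [mixture, affineBound]) hs hs'
  replace hs := hs'
  clear hs'
  rcases le_total s (519 / 1000) with hs' | hs'
  · exact mixture_coverage_of_endpoints (61 / 125) (519 / 1000) (1 / 2) (by norm_num)
      (by norm_num) (by norm_num) (by simp only [mixture, List.forall_mem_cons]; norm_num)
      (by norm_num [mixture, affineBound]) (by norm_num [mixture, affineBound]) hs hs'
  replace hs := hs'
  clear hs'
  rcases le_total s (11 / 20) with hs' | hs'
  · exact mixture_coverage_of_endpoints (519 / 1000) (11 / 20) (11 / 20) (by norm_num)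
      (by norm_num) (by norm_num) (by simp only [mixture, List.forall_mem_cons]; norm_num)
      (by norm_num [mixture, affineBound]) (by norm_num [mixture, affineBound]) hs hs'
  replace hs := hs'
  clear hs'
  rcases le_total s (117 / 200) with hs' | hs'
  · exact mixture_coverage_of_endpoints (11 / 20) (117 / 200) (3 / 5) (by norm_num)
      (by norm_num) (by norm_num) (by simp only [mixture, List.forall_mem_cons]; norm_num)
      (by norm_num [mixture, affineBound]) (by norm_num [mixture, affineBound]) hs hs'
  replace hs := hs'
  clear hs'
  rcases le_total s (31 / 50) with hs' | hs'
  · exact mixture_coverage_of_endpoints (117 / 200) (31 / 50) (3 / 5) (by norm_num)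
      (by norm_num) (by norm_num) (by simp only [mixture, List.forall_mem_cons]; norm_num)
      (by norm_num [mixture, affineBound]) (by norm_num [mixture, affineBound]) hs hs'
  replace hs := hs'
  clear hs'
  rcases le_total s (659 / 1000) with hs' | hs'
  · exact mixture_coverage_of_endpoints (31 / 50) (659 / 1000) (13 / 20) (by norm_num)
      (by norm_num) (by norm_num) (by simp only [mixture, List.forall_mem_cons]; norm_num)
      (by norm_num [mixture, affineBound]) (by norm_num [mixture, affineBound]) hs hs'
  replace hs := hs'
  clear hs'
  rcases le_total s (87 / 125) with hs' | hs'
  · exact mixture_coverage_of_endpoints (659 / 1000) (87 / 125) (7 / 10) (by norm_num)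
      (by norm_num) (by norm_num) (by simp only [mixture, List.forall_mem_cons]; norm_num)
      (by norm_num [mixture, affineBound]) (by norm_num [mixture, affineBound]) hs hs'
  replace hs := hs'
  clear hs'
  rcases le_total s (37 / 50) with hs' | hs'
  · exact mixture_coverage_of_endpoints (87 / 125) (37 / 50) (3 / 4) (by norm_num)
      (by norm_num) (by norm_num) (by simp only [mixture, List.forall_mem_cons]; norm_num)
      (by norm_num [mixture, affineBound]) (by norm_num [mixture, affineBound]) hs hs'
  replace hs := hs'
  clear hs'
  rcases le_total s (789 / 1000) with hs' | hs'
  · exact mixture_coverage_of_endpoints (37 / 50) (789 / 1000) (4 / 5) (by norm_num)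
      (by norm_num) (by norm_num) (by simp only [mixture, List.forall_mem_cons]; norm_num)
      (by norm_num [mixture, affineBound]) (by norm_num [mixture, affineBound]) hs hs'
  replace hs := hs'
  clear hs'
  rcases le_total s (169 / 200) with hs' | hs'
  · exact mixture_coverage_of_endpoints (789 / 1000) (169 / 200) (17 / 20) (by norm_num)
      (by norm_num) (by norm_num) (by simp only [mixture, List.forall_mem_cons]; norm_num)
      (by norm_num [mixture, affineBound]) (by norm_num [mixture, affineBound]) hs hs'
  replace hs := hs'
  clear hs'
  rcases le_total s (91 / 100) with hs' | hs'
  · exact mixture_coverage_of_endpoints (169 / 200) (91 / 100) (9 / 10) (by norm_num)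
      (by norm_num) (by norm_num) (by simp only [mixture, List.forall_mem_cons]; norm_num)
      (by norm_num [mixture, affineBound]) (by norm_num [mixture, affineBound]) hs hs'
  replace hs := hs'
  clear hs'
  rcases le_total s (19 / 20) with hs' | hs'
  · exact mixture_coverage_of_endpoints (91 / 100) (19 / 20) (19 / 20) (by norm_num)
      (by norm_num) (by norm_num) (by simp only [mixture, List.forall_mem_cons]; norm_num)
      (by norm_num [mixture, affineBound]) (by norm_num [mixture, affineBound]) hs hs'
  replace hs := hs'
  clear hs'
  rcases le_total s (939 / 967) with hs' | hs'
  · exact mixture_coverage_of_endpoints (19 / 20) (939 / 967) (963 / 1000) (by norm_num)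
      (by norm_num) (by norm_num) (by simp only [mixture, List.forall_mem_cons]; norm_num)
      (by norm_num [mixture, affineBound]) (by norm_num [mixture, affineBound]) hs hs'
  replace hs := hs'
  clear hs'
  rcases le_total s (4569 / 4700) with hs' | hs'
  · exact mixture_coverage_of_endpoints (939 / 967) (4569 / 4700) (97 / 100) (by norm_num)
      (by norm_num) (by norm_num) (by simp only [mixture, List.forall_mem_cons]; norm_num)
      (by norm_num [mixture, affineBound]) (by norm_num [mixture, affineBound]) hs hs'
  replace hs := hs'
  clear hs'
  rcases le_total s (1481 / 1500) with hs' | hs'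
  · exact mixture_coverage_of_endpoints (4569 / 4700) (1481 / 1500) (49 / 50) (by norm_num)
      (by norm_num) (by norm_num) (by simp only [mixture, List.forall_mem_cons]; norm_num)
      (by norm_num [mixture, affineBound]) (by norm_num [mixture, affineBound]) hs hs'
  replace hs := hs'
  clear hs'
  rcases le_total s (579 / 580) with hs' | hs'
  · exact mixture_coverage_of_endpoints (1481 / 1500) (579 / 580) (99 / 100) (by norm_num)
      (by norm_num) (by norm_num) (by simp only [mixture, List.forall_mem_cons]; norm_num)
      (by norm_num [mixture, affineBound]) (by norm_num [mixture, affineBound]) hs hs'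
  replace hs := hs'
  clear hs'
  rcases le_total s (8547 / 8560) with hs' | hs'
  · exact mixture_coverage_of_endpoints (579 / 580) (8547 / 8560) (1) (by norm_num)
      (by norm_num) (by norm_num) (by simp only [mixture, List.forall_mem_cons]; norm_num)
      (by norm_num [mixture, affineBound]) (by norm_num [mixture, affineBound]) hs hs'
  replace hs := hs'
  clear hs'
  exact mixture_coverage_of_endpoints (8547 / 8560) (1) (1) (by norm_num)
      (by norm_num) (by norm_num) (by simp only [mixture, List.forall_mem_cons]; norm_num)
      (by norm_num [mixture, affineBound]) (by norm_num [mixture, affineBound]) hs h1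

/-- Averaging the bounds of the roundings of a mixture. -/
lemma weight_mul_le {V : Type*} [Fintype V] {π y : V → ℝ} {B P : ℝ} (L : List Rounding)
    (hL : ∀ a ∈ L, 0 ≤ a.weight ∧
      B ≤ (1 + a.floor + a.mult) * P + ∑ v, π v * (1 - a.coverage (y v))) :
    (L.map fun a => a.weight).sum * B ≤
      (L.map fun a => a.weight * (1 + a.floor + a.mult)).sum * P +
        ∑ v, π v * ((L.map fun a => a.weight).sum -
          (L.map fun a => a.weight * a.coverage (y v)).sum) := by
  induction L with
  | nil => simp
  | cons a L ih =>
    have h1 := ih fun b hb => hL b (List.mem_cons_of_mem a hb)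
    obtain ⟨h2, h3⟩ := hL a List.mem_cons_self
    have h4 := mul_le_mul_of_nonneg_left h3 h2
    simp only [List.map_cons, List.sum_cons]
    have h5 : ∑ v, π v * (a.weight + (L.map fun a => a.weight).sum -
          (a.weight * a.coverage (y v) + (L.map fun a => a.weight * a.coverage (y v)).sum)) =
        a.weight * ∑ v, π v * (1 - a.coverage (y v)) +
        ∑ v, π v * ((L.map fun a => a.weight).sum -
          (L.map fun a => a.weight * a.coverage (y v)).sum) := by
      rw [Finset.mul_sum, ← Finset.sum_add_distrib]
      exact Finset.sum_congr rfl fun v _ => by ring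
    rw [h5]
    linarith

/-- The bound obtained from the mixture. -/
theorem le_of_mixture {V : Type*} [Fintype V] {π y : V → ℝ} {B P : ℝ} (hP : 0 ≤ P)
    (hπ : ∀ v, 0 ≤ π v) (hy : ∀ v, 0 ≤ y v) (hy1 : ∀ v, y v ≤ 1)
    (hB : ∀ a : Rounding, a.Valid →
      B ≤ (1 + a.floor + a.mult) * P + ∑ v, π v * (1 - a.coverage (y v))) :
    B ≤ 1.599 * (P + ∑ v, π v * (1 - y v)) := by
  have h := weight_mul_le mixture fun a ha =>
    ⟨(mixture_valid a ha).2.2.2.2.2.2, hB a (mixture_valid a ha)⟩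
  rw [mixture_weight, one_mul] at h
  have h1 := mul_le_mul_of_nonneg_right mixture_cost hP
  have h2 : ∑ v, π v * (1 - (mixture.map fun a => a.weight * a.coverage (y v)).sum) ≤
      1.599 * ∑ v, π v * (1 - y v) := by
    rw [Finset.mul_sum]
    refine Finset.sum_le_sum fun v _ => ?_
    have := mul_le_mul_of_nonneg_left (mixture_coverage (hy v) (hy1 v)) (hπ v)
    linarith
  linarith

end Mixture
section Assembly
variable {V : Type*} [Fintype V] [DecidableEq V]

/-- The symmetric function of two vertices given by a function of edges, zero on the diagonal. -/
def pairFun (f : Finset V → ℝ) (a b : V) : ℝ := if a = b then 0 else f {a, b}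

lemma pairFun_symm (f : Finset V → ℝ) (a b : V) : pairFun f a b = pairFun f b a := by
  simp only [pairFun, eq_comm (a := a), Finset.pair_comm a b]

lemma pair_mem_completeEdges {a b : V} (h : a ≠ b) : ({a, b} : Finset V) ∈ completeEdges V := by
  simp [completeEdges, Finset.card_pair h]

lemma pairFun_nonneg {f : Finset V → ℝ} (hf : ∀ e ∈ completeEdges V, 0 ≤ f e) (a b : V) :
    0 ≤ pairFun f a b := by
  unfold pairFun
  split_ifs with h
  exacts [le_rfl, hf _ (pair_mem_completeEdges h)]

lemma isPseudoMetric_pairFun {c : Finset V → ℝ} (hc : ∀ e ∈ completeEdges V, 0 ≤ c e)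
    (htri : ∀ u v w : V, u ≠ v → v ≠ w → u ≠ w → c {u, w} ≤ c {u, v} + c {v, w}) :
    IsPseudoMetric (pairFun c) where
  nonneg := pairFun_nonneg hc
  symm := pairFun_symm c
  self a := by simp [pairFun]
  tri a b d := by
    have h1 := pairFun_nonneg hc a b
    have h2 := pairFun_nonneg hc b d
    by_cases had : a = d
    · subst had
      have : pairFun c a a = 0 := by simp [pairFun]
      linarith
    by_cases hab : a = b
    · subst hab; linarith
    by_cases hbd : b = d
    · subst hbd; linarith
    simpa [pairFun, had, hab, hbd] using htri a b d hab hbd had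

/-- Every edge corresponds to two ordered pairs. -/
lemma sum_pairFun (f : Finset V → ℝ) :
    ∑ a, ∑ b, pairFun f a b = 2 * ∑ e ∈ completeEdges V, f e := by
  have h1 : ∑ a, ∑ b, pairFun f a b = ∑ p ∈ (Finset.univ : Finset V).offDiag, f {p.1, p.2} := by
    have h0 : (Finset.univ : Finset V).offDiag =
        (Finset.univ : Finset (V × V)).filter fun p => p.1 ≠ p.2 := by
      ext p
      simp
    rw [← Fintype.sum_prod_type', h0, Finset.sum_filter]
    refine Finset.sum_congr rfl fun p _ => ?_
    simp only [pairFun, ne_eq, ite_not]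
  have hmap : ∀ p ∈ (Finset.univ : Finset V).offDiag, ({p.1, p.2} : Finset V) ∈ completeEdges V :=
    fun p hp => pair_mem_completeEdges (Finset.mem_offDiag.1 hp).2.2
  rw [h1, ← Finset.sum_fiberwise_of_maps_to hmap, Finset.mul_sum]
  refine Finset.sum_congr rfl fun e he => ?_
  obtain ⟨a, b, hab, rfl⟩ := Finset.card_eq_two.1 (Finset.mem_powersetCard.1 he).2
  have hfib : ((Finset.univ : Finset V).offDiag.filter
      fun p => ({p.1, p.2} : Finset V) = {a, b}) = {(a, b), (b, a)} := by
    ext ⟨p, q⟩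
    simp only [Finset.mem_filter, Finset.mem_offDiag, Finset.mem_univ, true_and,
      Finset.mem_insert, Finset.mem_singleton, Prod.mk.injEq]
    constructor
    · rintro ⟨hpq, h⟩
      have hp : p ∈ ({a, b} : Finset V) := h ▸ Finset.mem_insert_self _ _
      have hq : q ∈ ({a, b} : Finset V) := h ▸ by simp
      simp only [Finset.mem_insert, Finset.mem_singleton] at hp hq
      grind
    · rintro (⟨rfl, rfl⟩ | ⟨rfl, rfl⟩)
      · exact ⟨hab, rfl⟩
      · exact ⟨hab.symm, Finset.pair_comm _ _⟩
  rw [hfib, Finset.sum_pair (by simp [hab]), Finset.pair_comm b a]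
  ring

lemma pairCost_pairFun (c x : Finset V → ℝ) :
    pairCost (pairFun c) (pairFun x) = 2 * ∑ e ∈ completeEdges V, c e * x e := by
  rw [← sum_pairFun]
  refine Finset.sum_congr rfl fun a _ => Finset.sum_congr rfl fun b _ => ?_
  unfold pairFun
  split_ifs <;> simp

lemma wcut_pairFun (x : Finset V → ℝ) (S : Finset V) :
    wcut (pairFun x) S = ∑ e ∈ cutEdges V S, x e := by
  have h := sum_pairFun fun e => if (e ∩ S).card = 1 then x e else 0
  rw [← Finset.sum_filter] at h
  have h1 : ∑ a, ∑ b, pairFun (fun e => if (e ∩ S).card = 1 then x e else 0) a b =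
      wcut (pairFun x) S + wcut (pairFun x) Sᶜ := by
    unfold wcut
    simp only [← Finset.sum_add_distrib]
    refine Finset.sum_congr rfl fun a _ => Finset.sum_congr rfl fun b _ => ?_
    by_cases hab : a = b
    · simp [pairFun, hab]
    · by_cases ha : a ∈ S <;> by_cases hb : b ∈ S <;>
        simp [pairFun, hab, ha, hb, Finset.insert_inter_of_mem, Finset.insert_inter_of_notMem]
  rw [h1, wcut_compl (pairFun_symm x)] at h
  unfold cutEdges
  linarith

lemma isLevelWeight_pairFun {r : V} {x : Finset V → ℝ} {y : V → ℝ} (h : IsFeasibleLP r x y) :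
    IsLevelWeight r y Finset.univ (pairFun x) where
  symm := pairFun_symm x
  nonneg := pairFun_nonneg h.1
  supp a _ ha := absurd (Finset.mem_univ a) ha
  cut S hS u hu _ := by rw [wcut_pairFun]; exact h.2.2.2.2.2 S hS u hu
  deg u _ hu := by rw [wcut_pairFun]; exact (h.2.2.2.1 u hu).le

lemma le_one_of_isFeasibleLP {r : V} {x : Finset V → ℝ} {y : V → ℝ} (h : IsFeasibleLP r x y)
    (v : V) : y v ≤ 1 := by
  by_cases hv : v = r
  · rw [hv, h.2.2.1]
  · have h1 := h.2.2.2.2.2 {r}ᶜ (by simp) v (by simpa using hv)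
    rw [← wcut_pairFun, wcut_compl (pairFun_symm x), wcut_pairFun] at h1
    linarith [h.2.2.2.2.1]

lemma sum_zip_eq_walkCost (c : Finset V → ℝ) (z : V) (l : List V) (a : V) (hl : (a :: l).Nodup)
    (hz : z ∉ l) (ha : l = [] → a ≠ z) :
    (((a :: l).zip (l ++ [z])).map fun p => c {p.1, p.2}).sum =
      walkCost (pairFun c) a (l ++ [z]) := by
  induction l generalizing a with
  | nil => simp [walkCost, pairFun, ha rfl]
  | cons b l ih =>
    rw [List.mem_cons, not_or] at hz
    have hab : a ≠ b := fun h => (List.nodup_cons.1 hl).1 (h ▸ List.mem_cons_self)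
    have := ih b (List.nodup_cons.1 hl).2 hz.2 fun _ h => hz.1 h.symm
    rw [List.cons_append, List.zip_cons_cons, List.map_cons, List.sum_cons, this]
    simp [walkCost, pairFun, hab]

lemma tourCost_cons (c : Finset V → ℝ) (r : V) (l : List V) (hl : (r :: l).Nodup) :
    tourCost c (r :: l) = walkCost (pairFun c) r (l ++ [r]) := by
  rcases l.eq_nil_or_concat' with rfl | ⟨l', b, rfl⟩
  · simp [tourCost, walkCost, pairFun]
  · have hne : l' ++ [b] ≠ [] := by simp
    generalize l' ++ [b] = l at *
    rw [tourCost, if_neg (by simpa using hne),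
      ← sum_zip_eq_walkCost c r l r hl (List.nodup_cons.1 hl).1 fun h => absurd h hne]
    simp

end Assembly
end PCTSP

open PCTSP

/-- the integrality gap of the PCTSP LP relaxation is at most `1.599`. -/
theorem pctsp_gap_le_1599 (V : Type*) [Fintype V] [DecidableEq V]
    (hV : 2 ≤ Fintype.card V) (r : V)
    (c : Finset V → ℝ) (π : V → ℝ)
    (hc : ∀ e ∈ completeEdges V, 0 ≤ c e)
    (htri : ∀ u v w : V, u ≠ v → v ≠ w → u ≠ w → c {u, w} ≤ c {u, v} + c {v, w})
    (hπ : ∀ v : V, 0 ≤ π v) (hπr : π r = 0)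
    (x : Finset V → ℝ) (y : V → ℝ) (hxy : IsFeasibleLP r x y) :
    ∃ t : List V, t.Nodup ∧ t.head? = some r ∧
      tourCost c t + ∑ v ∈ Finset.univ \ t.toFinset, π v ≤
        1.599 * (∑ e ∈ completeEdges V, c e * x e + ∑ v : V, π v * (1 - y v)) := by

  have hfin : Finite {l : List V // (r :: l).Nodup} :=
    Finite.of_injective (β := {l : List V // l.Nodup})
      (fun l => ⟨l.1, (List.nodup_cons.1 l.2).2⟩) fun l l' h => Subtype.ext (Subtype.mk.inj h)
  have hne : Nonempty {l : List V // (r :: l).Nodup} := ⟨⟨[], by simp⟩⟩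
  obtain ⟨⟨l, hl⟩, hmin⟩ := Finite.exists_min fun l : {l : List V // (r :: l).Nodup} =>
    walkCost (pairFun c) r (l.1 ++ [r]) + ∑ v ∈ Finset.univ \ (r :: l.1).toFinset, π v
  refine ⟨r :: l, hl, rfl, ?_⟩
  have hy1 := le_one_of_isFeasibleLP hxy
  have hmetric := isPseudoMetric_pairFun hc htri
  have hcost := pairCost_pairFun c x
  have hcost0 : 0 ≤ ∑ e ∈ completeEdges V, c e * x e :=
    Finset.sum_nonneg fun e he => mul_nonneg (hc e he) (hxy.1 e he)
  rw [tourCost_cons c r l hl]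
  refine le_of_mixture hcost0 hπ hxy.2.1 hy1 fun a ha => ?_
  have := (isLevelWeight_pairFun hxy).le_of_threshold (σ := a.threshold) (α := a.mult)
    (φ := a.floor) hmetric ha.1 ha.2.2.1 ha.2.2.2.1 ha.2.2.2.2.1 ha.2.2.2.2.2.1 hπ hxy.2.1
    hxy.2.2.1 hy1 fun l hl => hmin ⟨l, hl⟩
  rwa [hcost, mul_div_cancel_left₀ _ two_ne_zero] at this
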